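/- arXiv:1404.4987 — 5 statements merged into one kernel-verified Lean document; each statement's English description precedes it below -/
import Mathlib

section
/- For every integer ℓ > 1 there exists ε > 0 such that, with high probability as n → ∞, the random graph G_{n,(1+ε)/n} either contains an odd cycle of length less than 2ℓ+1 or admits a graph homomorphism to the cycle C_{2ℓ+1}. -/
open Filter SimpleGraph

open scoped Classical in
/-- The probability, under the Erdős–Rényi random graph `G_{n,p}` on vertex set `Fin n`
(each of the `n.choose 2` potential edges present independently with probability `p`),
that the random graph satisfies the property `P`. -/
noncomputable def erProb (n : ℕ) (p : ℝ) (P : SimpleGraph (Fin n) → Prop) : ℝ :=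
  ∑ G : SimpleGraph (Fin n),
    if P G then p ^ G.edgeSet.ncard * (1 - p) ^ (n.choose 2 - G.edgeSet.ncard) else 0




/-- Non-backtracking walks, as lists of vertices. -/
def NB {W : Type*} (H : SimpleGraph W) : List W → Prop
  | [] => True
  | [_] => True
  | [a, b] => H.Adj a b
  | a :: b :: c :: l => H.Adj a b ∧ a ≠ c ∧ NB H (b :: c :: l)

section NBsec
variable {W : Type*} {H : SimpleGraph W}

theorem nb_tail {a : W} {l : List W} (h : NB H (a :: l)) : NB H l := by
  match l, h with
  | [], _ => simp [NB]
  | [b], _ => simp [NB]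
  | b :: c :: l, h => exact h.2.2

theorem nb_adj {a b : W} {l : List W} (h : NB H (a :: b :: l)) : H.Adj a b := by
  match l, h with
  | [], h => exact h
  | c :: l, h => exact h.1

theorem nb_right {A B : List W} (h : NB H (A ++ B)) : NB H B := by
  induction A with
  | nil => exact h
  | cons a A ih => exact ih (nb_tail h)

theorem nb_join2 {A l B : List W} {x y : W} (h : NB H (A ++ x :: y :: l))
    (h2 : NB H (x :: y :: l ++ B)) : NB H (A ++ (x :: y :: l ++ B)) := by
  induction A with
  | nil => exact h2
  | cons a A ih =>
    have := ih (nb_tail h)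
    match A, h, this with
    | [], h, t => exact ⟨h.1, h.2.1, t⟩
    | [b], h, t => exact ⟨h.1, h.2.1, t⟩
    | b :: c :: A, h, t => exact ⟨h.1, h.2.1, t⟩

theorem nb_join {A B : List W} {a v b : W} (h : NB H (A ++ [a, v]))
    (h2 : NB H (v :: b :: B)) (hab : a ≠ b) : NB H (A ++ a :: v :: b :: B) := by
  have h3 : NB H (a :: v :: b :: B) := ⟨nb_adj (nb_right h), hab, h2⟩
  exact nb_join2 h h3

theorem nb_reverse {l : List W} (h : NB H l) : NB H l.reverse := by
  induction l with
  | nil => exact h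
  | cons a l ih =>
    have h' := ih (nb_tail h)
    match l, h, h' with
    | [], h, h' => simp [NB]
    | [b], h, h' => exact (show H.Adj a b from h).symm
    | b :: c :: l, h, h' =>
      have e : (a :: b :: c :: l).reverse = l.reverse ++ c :: b :: a :: [] := by simp
      rw [e]
      refine nb_join (by simpa using h') ?_ h.2.1.symm
      exact (show H.Adj a b from h.1).symm

theorem nb_left {A B : List W} (h : NB H (A ++ B)) : NB H A := by
  have := nb_reverse h
  rw [List.reverse_append] at this
  simpa using nb_reverse (nb_right this)

theorem nb_diverge (N : ℕ) : ∀ (P1 P2 L : List W) (v x z1 z2 : W),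
    P1.length = P2.length → z1 ≠ z2 →
    NB H ((v :: P1) ++ x :: L) → NB H ((v :: P2) ++ x :: L) →
    (v :: P1).getLast? = some z1 → (v :: P2).getLast? = some z2 →
    2 * P1.length + 2 ≤ N →
    ∃ M : List W, M.length ≤ N ∧ NB H (M ++ x :: L) ∧ ¬ (M ++ x :: L).Nodup := by
  intro P1
  induction P1 with
  | nil =>
    intro P2 L v x z1 z2 hl hz h1 h2 e1 e2 hN
    have : P2 = [] := List.length_eq_zero_iff.mp (by simpa using hl.symm)
    subst this
    simp at e1 e2
    exact absurd (e1.symm.trans e2) hz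
  | cons a P1 ih =>
    intro P2 L v x z1 z2 hl hz h1 h2 e1 e2 hN
    match P2, hl, h2, e2 with
    | b :: P2, hl, h2, e2 =>
      by_cases hab : a = b
      · subst hab
        refine ih P2 L a x z1 z2 (by simpa using hl) hz (nb_tail h1) (nb_tail h2) ?_ ?_ ?_
        · simpa using e1
        · simpa using e2
        · simp at hN; omega
      · refine ⟨x :: P2.reverse ++ b :: v :: a :: P1, ?_, ?_, ?_⟩
        · simp at hN hl ⊢; omega
        · have h3 : NB H ((v :: b :: P2) ++ [x]) := by
            have : NB H (((v :: b :: P2) ++ [x]) ++ L) := by simpa using h2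
            exact nb_left this
          have h4 := nb_reverse h3
          have := nb_join (A := x :: P2.reverse) (a := b) (v := v) (b := a)
            (B := P1 ++ x :: L) (by simpa using h4) (by simpa using h1) (Ne.symm hab)
          simpa using this
        · simp

theorem nb_extend (h1 : ∀ L : List W, L ≠ [] → NB H L → ∃ z, NB H (z :: L)) (k : ℕ)
    (L : List W) (hL : L ≠ []) (h : NB H L) : ∃ M : List W, M.length = k ∧ NB H (M ++ L) := by
  induction k with
  | zero => exact ⟨[], rfl, h⟩
  | succ k ih =>
    obtain ⟨M, hM, hn⟩ := ih
    obtain ⟨z, hz⟩ := h1 (M ++ L) (by simp [hL]) hn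
    exact ⟨z :: M, by simp [hM], hz⟩

open scoped Classical in
theorem nb_grow (q N : ℕ) (h1 : ∀ L : List W, L ≠ [] → NB H L → ∃ z, NB H (z :: L))
    (h2 : ∀ L : List W, L ≠ [] → NB H L → ∃ M : List W, M.length ≤ q ∧
      ∃ z1 z2, z1 ≠ z2 ∧ NB H (z1 :: (M ++ L)) ∧ NB H (z2 :: (M ++ L)))
    (L0 : List W) (hL0 : L0 ≠ [])
    (hN : ∀ M : List W, M.length ≤ N → NB H (M ++ L0) → (M ++ L0).Nodup) (t : ℕ) :
    ∀ M0 : List W, NB H (M0 ++ L0) → M0.length + 2 * ((q + 1) * t) + 2 ≤ N →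
    ∃ X : Finset W, 2 ^ t ≤ X.card ∧ ∀ x ∈ X, ∃ M : List W, M.length = (q + 1) * t ∧
      NB H (M ++ (M0 ++ L0)) ∧ (M ++ (M0 ++ L0)).head? = some x := by
  induction t with
  | zero =>
    intro M0 hM0 _
    obtain ⟨x, l, hx⟩ := List.exists_cons_of_ne_nil (show M0 ++ L0 ≠ [] by simp [hL0])
    refine ⟨{x}, by simp, ?_⟩
    intro y hy
    simp at hy
    subst hy
    exact ⟨[], by simp, by simpa using hM0, by simp [hx]⟩
  | succ t ih =>
    intro M0 hM0 hlen
    obtain ⟨M, hM, z1, z2, hz, n1, n2⟩ := h2 (M0 ++ L0) (by simp [hL0]) hM0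
    have key : ∀ z, NB H (z :: (M ++ (M0 ++ L0))) → ∃ X : Finset W, 2 ^ t ≤ X.card ∧
        ∀ x ∈ X, ∃ M' : List W, M'.length + M.length + 1 = (q + 1) * (t + 1) ∧
        NB H (M' ++ z :: (M ++ (M0 ++ L0))) ∧
        (M' ++ z :: (M ++ (M0 ++ L0))).head? = some x := by
      intro z hnz
      obtain ⟨E, hE, hEn⟩ := nb_extend h1 (q - M.length) _ (by simp) hnz
      obtain ⟨X, hX, hXx⟩ := ih (E ++ z :: (M ++ M0)) (by simpa using hEn) (by
        simp [mul_add] at *; omega)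
      refine ⟨X, hX, fun x hx => ?_⟩
      obtain ⟨M', hM', a, b⟩ := hXx x hx
      refine ⟨M' ++ E, ?_, by simpa using a, by simpa using b⟩
      simp [mul_add, hM', hE]; omega
    obtain ⟨X1, c1, p1⟩ := key z1 n1
    obtain ⟨X2, c2, p2⟩ := key z2 n2
    have hdis : Disjoint X1 X2 := by
      rw [Finset.disjoint_left]
      intro x hx1 hx2
      obtain ⟨A1, l1, a1, b1⟩ := p1 x hx1
      obtain ⟨A2, l2, a2, b2⟩ := p2 x hx2
      obtain ⟨y, L, hy⟩ := List.exists_cons_of_ne_nil (show M ++ (M0 ++ L0) ≠ [] by simp [hL0])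
      obtain ⟨v1, P1, e1⟩ := List.exists_cons_of_ne_nil (show A1 ++ [z1] ≠ [] by simp)
      obtain ⟨v2, P2, e2⟩ := List.exists_cons_of_ne_nil (show A2 ++ [z2] ≠ [] by simp)
      have r1 : A1 ++ z1 :: (M ++ (M0 ++ L0)) = (v1 :: P1) ++ y :: L := by
        rw [← e1, ← hy]; simp
      have r2 : A2 ++ z2 :: (M ++ (M0 ++ L0)) = (v2 :: P2) ++ y :: L := by
        rw [← e2, ← hy]; simp
      rw [r1] at a1 b1
      rw [r2] at a2 b2
      simp at b1 b2
      subst b1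
      subst b2
      have k1 := congrArg List.length e1
      have k2 := congrArg List.length e2
      simp at k1 k2
      have g1 : (v2 :: P1).getLast? = some z1 := by rw [← e1]; simp
      have g2 : (v2 :: P2).getLast? = some z2 := by rw [← e2]; simp
      obtain ⟨F, f1, f2, f3⟩ := nb_diverge (2 * P1.length + 2) P1 P2 L v2 y z1 z2 (by omega) hz
        a1 a2 g1 g2 le_rfl
      rw [← hy] at f2 f3
      apply f3
      have := hN (F ++ M ++ M0) (by simp [mul_add] at *; omega) (by simpa using f2)
      simpa using this
    refine ⟨X1 ∪ X2, ?_, ?_⟩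
    · rw [Finset.card_union_of_disjoint hdis, pow_succ]; omega
    · intro x hx
      rcases Finset.mem_union.mp hx with hx | hx
      · obtain ⟨A, l, a, b⟩ := p1 x hx
        exact ⟨A ++ z1 :: M, by simp; omega, by simpa using a, by simpa using b⟩
      · obtain ⟨A, l, a, b⟩ := p2 x hx
        exact ⟨A ++ z2 :: M, by simp; omega, by simpa using a, by simpa using b⟩

/-- Every non-backtracking list that is a path extends to a path with a chord at its end. -/
theorem nb_close [Fintype W] (q T : ℕ)
    (h1 : ∀ L : List W, L ≠ [] → NB H L → ∃ z, NB H (z :: L))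
    (h2 : ∀ L : List W, L ≠ [] → NB H L → ∃ M : List W, M.length ≤ q ∧
      ∃ z1 z2, z1 ≠ z2 ∧ NB H (z1 :: (M ++ L)) ∧ NB H (z2 :: (M ++ L)))
    (hT : Fintype.card W < 2 ^ T)
    (L : List W) (hL : L ≠ []) (hnb : NB H L) (hnd : L.Nodup) :
    ∃ (M : List W) (z : W), M.length < 2 * ((q + 1) * T) + 2 ∧ NB H (z :: (M ++ L)) ∧
      (M ++ L).Nodup ∧ z ∈ M ++ L := by
  have ex : ∃ M : List W, M.length ≤ 2 * ((q + 1) * T) + 2 ∧ NB H (M ++ L) ∧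
      ¬ (M ++ L).Nodup := by
    by_contra hcon
    push Not at hcon
    obtain ⟨X, hX, -⟩ := nb_grow q _ h1 h2 L hL hcon T [] (by simpa using hnb) (by simp)
    have := X.card_le_univ
    omega
  obtain ⟨M, hM, hn, hd⟩ := ex
  induction M with
  | nil => exact absurd hnd (by simpa using hd)
  | cons z M ih =>
    by_cases hd' : (M ++ L).Nodup
    · refine ⟨M, z, by simp at hM; omega, hn, hd', ?_⟩
      by_contra hz
      exact hd (by simpa using ⟨by simpa using hz, hd'⟩)
    · exact ih (by simp at hM; omega) (nb_tail hn) hd'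

theorem nb_bicyclic [Fintype W] (q T : ℕ) [Nonempty W]
    (h1 : ∀ L : List W, L ≠ [] → NB H L → ∃ z, NB H (z :: L))
    (h2 : ∀ L : List W, L ≠ [] → NB H L → ∃ M : List W, M.length ≤ q ∧
      ∃ z1 z2, z1 ≠ z2 ∧ NB H (z1 :: (M ++ L)) ∧ NB H (z2 :: (M ++ L)))
    (hT : Fintype.card W < 2 ^ T) :
    ∃ (F : List W) (z z' : W), F.length ≤ 4 * ((q + 1) * T) + 4 ∧ F.Nodup ∧ z ∈ F ∧ z' ∈ F ∧
      NB H (z :: (F ++ [z'])) ∧ ¬ (F.head? = some z' ∧ F.getLast? = some z) := by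
  obtain ⟨a0⟩ := ‹Nonempty W›
  obtain ⟨a1, ha1⟩ := h1 [a0] (by simp) (by simp [NB])
  -- root of degree at least three
  obtain ⟨M, hM, z1, z2, hz, n1, n2⟩ := h2 [a1, a0] (by simp) ha1
  obtain ⟨r, z3, l, hr⟩ : ∃ r z3 l, M ++ [a1, a0] = r :: z3 :: l := by
    match M with
    | [] => exact ⟨_, _, _, rfl⟩
    | [b] => exact ⟨_, _, _, rfl⟩
    | b :: c :: M => exact ⟨_, _, _, rfl⟩
  rw [hr] at n1 n2
  have d1 : H.Adj z1 r := n1.1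
  have d2 : H.Adj z2 r := n2.1
  have d3 : H.Adj z3 r := (nb_adj n1.2.2).symm
  have e13 : z1 ≠ z3 := n1.2.1
  have e23 : z2 ≠ z3 := n2.2.1
  have three : ∀ s t : W, ∃ w, H.Adj w r ∧ w ≠ s ∧ w ≠ t := by
    intro s t
    by_contra hcon
    push Not at hcon
    have := hcon z1 d1
    have := hcon z2 d2
    have := hcon z3 d3
    clear hcon h1 h2 n1 n2 hr
    by_cases k1 : z1 = s <;> by_cases k2 : z2 = s <;> by_cases k3 : z3 = s <;> simp_all
  clear hr n1 n2
  obtain ⟨P, z, hP, pn, pd, pz⟩ := nb_close q T h1 h2 hT [r] (by simp) (by simp [NB]) (by simp)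
  obtain ⟨s, t, l', hl'⟩ : ∃ s t l', P ++ [r] = s :: t :: l' := by
    match P, pn, pz with
    | [], pn, pz =>
      simp at pz; subst pz
      exact absurd pn (by simp [NB])
    | [b], pn, pz => exact ⟨_, _, _, rfl⟩
    | b :: c :: M, _, _ => exact ⟨_, _, _, rfl⟩
  have pn' := nb_reverse pn
  have hrev : (P ++ [r]).reverse = r :: P.reverse := by simp
  obtain ⟨c, R, hR⟩ : ∃ c R, P.reverse = c :: R := by
    apply List.exists_cons_of_ne_nil
    intro h
    simp at h; subst h; simp at hl'
  have hlast : (r :: P.reverse).getLast? = some s := by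
    rw [← hrev, hl']; simp
  obtain ⟨w, wr, wc, ws⟩ := three c s
  have hnd : (r :: c :: R).Nodup := by
    rw [← hR, ← hrev]; exact List.nodup_reverse.mpr pd
  have hzm : z ∈ r :: c :: R := by
    rw [← hR, ← hrev]; exact List.mem_reverse.mpr pz
  have nR : NB H (r :: c :: R ++ [z]) := by
    rw [← hR, ← hrev]; simpa using pn'
  have nwR : NB H (w :: (r :: c :: R ++ [z])) := ⟨wr, wc, nR⟩
  rw [hR] at hlast
  have lenR : (r :: c :: R).length = P.length + 1 := by rw [← hR]; simp
  by_cases hw : w ∈ r :: c :: R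
  · refine ⟨r :: c :: R, w, z, by rw [lenR]; omega, hnd, hw, hzm, nwR, ?_⟩
    rintro ⟨-, h⟩
    rw [hlast] at h
    exact ws (by simpa using h.symm)
  · have hnd2 : (w :: r :: c :: R).Nodup := List.nodup_cons.mpr ⟨hw, hnd⟩
    have nw : NB H (w :: r :: c :: R) := by
      have : NB H ((w :: r :: c :: R) ++ [z]) := by simpa using nwR
      exact nb_left this
    obtain ⟨Q, y, hQ, qn, qd, qy⟩ := nb_close q T h1 h2 hT (w :: r :: c :: R) (by simp) nw hnd2
    refine ⟨Q ++ w :: r :: c :: R, y, z, ?_, qd, qy, ?_, ?_, ?_⟩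
    · simp only [List.length_append, List.length_cons] at lenR ⊢; omega
    · simp only [List.mem_append, List.mem_cons] at hzm ⊢; tauto
    · have := nb_join2 (A := y :: Q) (B := [z]) (by simpa using qn) (by simpa using nwR)
      simpa using this
    · rintro ⟨h, -⟩
      have hzh : z ∈ Q ++ [w] := by
        match Q, h with
        | [], h => simp at h; simp [h]
        | b :: Q, h => simp at h; simp [h]
      have e : Q ++ w :: r :: c :: R = (Q ++ [w]) ++ (r :: c :: R) := by simp
      rw [e] at qd
      exact (List.disjoint_of_nodup_append qd) hzh hzm

end NBsec
/-- `U` can be coloured by `C`. -/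
def Col {W K : Type*} (H : SimpleGraph W) (C : SimpleGraph K) (U : Set W) : Prop :=
  ∃ f : W → K, ∀ x ∈ U, ∀ y ∈ U, H.Adj x y → C.Adj (f x) (f y)

section Colsec
variable {W K : Type*} {H : SimpleGraph W} {C : SimpleGraph K}

theorem walk_pad {a b c : K} (h : C.Adj b c) (n : ℕ)
    (hw : ∃ w : C.Walk a b, w.length = n) (t : ℕ) :
    ∃ w : C.Walk a b, w.length = n + 2 * t := by
  induction t with
  | zero => simpa using hw
  | succ t ih =>
    obtain ⟨w, hw⟩ := ih
    exact ⟨(w.concat h).concat h.symm, by simp [hw]; ring⟩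

open Fin.CommRing in
theorem walk_cycle (m t : ℕ) (hm : m + 1 = 2 * t) (a b : Fin (m + 2)) :
    ∃ w : (cycleGraph (m + 2)).Walk a b, w.length = 2 * t := by
  have adj : ∀ x : Fin (m + 2), (cycleGraph (m + 2)).Adj x (x + 1) := by
    intro x; rw [cycleGraph_adj]; right; simp
  have fwd : ∀ (k : ℕ) (x : Fin (m + 2)),
      ∃ w : (cycleGraph (m + 2)).Walk x (x + (k : Fin (m + 2))), w.length = k := by
    intro k x
    induction k with
    | zero => exact ⟨Walk.nil.copy rfl (by simp), by simp⟩
    | succ k ih =>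
      obtain ⟨w, hw⟩ := ih
      exact ⟨(w.concat (adj _)).copy rfl (by push_cast; ring), by simp [hw]⟩
  have even_case : ∀ x y : Fin (m + 2), Even (y - x).val →
      ∃ w : (cycleGraph (m + 2)).Walk x y, w.length = 2 * t := by
    intro x y hev
    obtain ⟨k, hk⟩ := hev
    have hlt := (y - x).isLt
    obtain ⟨w, hw⟩ := fwd (y - x).val x
    have e : x + (((y - x).val : ℕ) : Fin (m + 2)) = y := by
      rw [Fin.cast_val_eq_self]; ring
    have := walk_pad (adj y) (y - x).val ⟨w.copy rfl e, by simp [hw]⟩ (t - k)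
    obtain ⟨w', hw'⟩ := this
    exact ⟨w', by omega⟩
  by_cases h : Even (b - a).val
  · exact even_case a b h
  · have hne : b - a ≠ 0 := by
      intro h0; rw [h0] at h; simp at h
    have hval : (a - b).val + (b - a).val = m + 2 := by
      have : a - b = -(b - a) := by ring
      rw [this, Fin.val_neg]
      simp only [hne, if_false]
      have := (b - a).isLt
      omega
    have h2 : Even (a - b).val := by
      rw [Nat.not_even_iff_odd] at h
      have h3 : Odd ((a - b).val + (b - a).val) := by
        rw [hval]; exact ⟨t, by omega⟩
      rw [Nat.odd_add] at h3
      by_contra hc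
      rw [Nat.not_even_iff_odd] at hc
      exact (Nat.not_even_iff_odd.mpr h) (h3.mp hc)
    obtain ⟨w, hw⟩ := even_case b a h2
    exact ⟨w.reverse, by simp [hw]⟩

theorem cycle_of_seq (y : ℕ → W) (hadj : ∀ i, H.Adj (y i) (y (i + 1))) (j : ℕ) (hj : 3 ≤ j)
    (hinj : ∀ i < j, ∀ k < j, y i = y k → i = k) (hjj : y j = y 0) :
    ∃ w : H.Walk (y 0) (y 0), w.IsCycle ∧ w.length = j := by
  have path : ∀ k, k + 1 ≤ j → ∃ w : H.Walk (y 0) (y k), w.length = k ∧ w.IsPath ∧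
      (∀ x ∈ w.support, ∃ i ≤ k, x = y i) ∧
      (∀ e ∈ w.edges, ∃ i < k, e = s(y i, y (i + 1))) := by
    intro k
    induction k with
    | zero => intro _; exact ⟨Walk.nil, by simp⟩
    | succ k ih =>
      intro hk
      obtain ⟨w, h1, h2, h3, h4⟩ := ih (by omega)
      refine ⟨w.concat (hadj k), by simp [h1], ?_, ?_, ?_⟩
      · refine h2.concat ?_ (hadj k)
        intro hmem
        obtain ⟨i, hi, e⟩ := h3 _ hmem
        have := hinj (k + 1) (by omega) i (by omega) e
        omega
      · intro x hx
        rw [Walk.support_concat] at hx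
        simp at hx
        rcases hx with hx | hx
        · obtain ⟨i, hi, e⟩ := h3 x hx
          exact ⟨i, by omega, e⟩
        · exact ⟨k + 1, le_rfl, hx⟩
      · intro e he
        rw [Walk.edges_concat] at he
        simp at he
        rcases he with he | he
        · obtain ⟨i, hi, e⟩ := h4 e he
          exact ⟨i, by omega, e⟩
        · exact ⟨k, by omega, he⟩
  obtain ⟨w, h1, h2, h3, h4⟩ := path (j - 1) (by omega)
  have ha : H.Adj (y (j - 1)) (y 0) := by
    have := hadj (j - 1)
    rwa [show j - 1 + 1 = j by omega, hjj] at this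
  refine ⟨Walk.cons ha.symm w.reverse, ?_, by simp [h1]; omega⟩
  rw [Walk.cons_isCycle_iff]
  refine ⟨h2.reverse, ?_⟩
  intro he
  rw [Walk.edges_reverse, List.mem_reverse] at he
  obtain ⟨i, hi, e⟩ := h4 _ he
  rw [Sym2.eq_iff] at e
  rcases e with ⟨e1, e2⟩ | ⟨e1, e2⟩
  · have := hinj 0 (by omega) i (by omega) e1
    have := hinj (j - 1) (by omega) (i + 1) (by omega) e2
    omega
  · have := hinj 0 (by omega) (i + 1) (by omega) e1
    omega

open scoped Classical in
theorem thread (ℓ : ℕ) (hℓ : 1 < ℓ)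
    (hC : ∀ a b : K, ∃ w : C.Walk a b, w.length = 2 * ℓ)
    (hC1 : ∀ a : K, ∃ b, C.Adj a b)
    (hbad : ¬ Col H C Set.univ) (hcrit : ∀ T : Set W, T.Nonempty → Col H C Tᶜ)
    (hcyc : ∀ (u : W) (w : H.Walk u u), w.IsCycle → Odd w.length → 2 * ℓ + 1 ≤ w.length)
    (y : ℕ → W) (hadj : ∀ i, H.Adj (y i) (y (i + 1))) (hnb : ∀ i, y (i + 2) ≠ y i) :
    ∃ i, i + 2 ≤ 2 * ℓ ∧ ∃ z, H.Adj z (y (i + 1)) ∧ z ≠ y i ∧ z ≠ y (i + 2) := by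
  by_contra hcon
  push Not at hcon
  have hcon' : ∀ i, 1 ≤ i → i < 2 * ℓ → ∀ z, H.Adj z (y i) → z = y (i - 1) ∨ z = y (i + 1) := by
    intro i h1 h2 z hz
    by_contra hc
    push Not at hc
    have := hcon (i - 1) (by omega) z (by rwa [show i - 1 + 1 = i by omega]) hc.1
    rw [show i - 1 + 2 = i + 1 by omega] at this
    exact hc.2 this
  have hex : ∃ j, 1 ≤ j ∧ (j = 2 * ℓ ∨ ∃ i < j, y j = y i) := ⟨2 * ℓ, by omega, Or.inl rfl⟩
  obtain ⟨j, ⟨hj1, hj⟩, hmin⟩ : ∃ j, (1 ≤ j ∧ (j = 2 * ℓ ∨ ∃ i < j, y j = y i)) ∧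
      ∀ k < j, ¬ (1 ≤ k ∧ (k = 2 * ℓ ∨ ∃ i < k, y k = y i)) :=
    ⟨Nat.find hex, Nat.find_spec hex, fun k hk => Nat.find_min hex hk⟩
  have hj2 : j ≤ 2 * ℓ := by
    by_contra h
    exact hmin (2 * ℓ) (by omega) ⟨by omega, Or.inl rfl⟩
  have hinj' : ∀ k < j, ∀ i < k, y k ≠ y i := by
    intro k hk i hi h
    exact hmin k hk ⟨by omega, Or.inr ⟨i, hi, h⟩⟩
  have hinj : ∀ i < j, ∀ k < j, y i = y k → i = k := by
    intro i hi k hk h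
    rcases lt_trichotomy i k with h' | h' | h'
    · exact absurd h.symm (hinj' k hk i h')
    · exact h'
    · exact absurd h (hinj' i hi k h')
  have hend : ∀ i, 1 ≤ i → i < j → y j ≠ y i := by
    intro i h1 h2 h
    have ha : H.Adj (y (j - 1)) (y i) := by
      rw [← h]
      have := hadj (j - 1)
      rwa [show j - 1 + 1 = j by omega] at this
    rcases hcon' i h1 (by omega) _ ha with e | e
    · have := hinj (j - 1) (by omega) (i - 1) (by omega) e
      omega
    · by_cases hij : i + 1 < j
      · have := hinj (j - 1) (by omega) (i + 1) hij e
        have e2 : j = i + 2 := by omega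
        subst e2
        exact hnb i h
      · have e2 : j = i + 1 := by omega
        subst e2
        exact (hadj i).ne h.symm
  have hj3 : 3 ≤ j := by
    by_contra h
    rcases hj with hj | ⟨i, hi, hy⟩
    · omega
    · by_cases hi0 : i = 0
      · subst hi0
        have : j = 1 ∨ j = 2 := by omega
        rcases this with rfl | rfl
        · exact (hadj 0).ne hy.symm
        · exact hnb 0 hy
      · exact hend i (by omega) hi hy
  let T : Set W := {x | ∃ i, 1 ≤ i ∧ i < j ∧ x = y i}
  obtain ⟨f, hf⟩ := hcrit T ⟨y 1, 1, le_rfl, by omega, rfl⟩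
  -- colours along the thread
  obtain ⟨w, hw⟩ : ∃ w : C.Walk (f (y 0)) (f (y j)), w.length = j := by
    by_cases hjl : j = 2 * ℓ
    · subst hjl; exact hC _ _
    · rcases hj with hj | ⟨i, hi, hy⟩
      · exact absurd hj hjl
      · have hi0 : i = 0 := by
          by_contra hi0
          exact hend i (by omega) hi hy
        subst hi0
        have hev : Even j := by
          by_contra hodd
          rw [Nat.not_even_iff_odd] at hodd
          obtain ⟨w, w1, w2⟩ := cycle_of_seq y hadj j hj3 hinj hy
          have := hcyc _ w w1 (by rwa [w2])
          omega
        obtain ⟨k, hk⟩ := hev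
        rw [hy]
        obtain ⟨c, hc⟩ := hC1 (f (y 0))
        obtain ⟨w, hw⟩ := walk_pad hc 0 ⟨Walk.nil, rfl⟩ k
        exact ⟨w, by omega⟩
  have hg : ∀ i < j, C.Adj (w.getVert i) (w.getVert (i + 1)) := by
    intro i hi
    exact w.adj_getVert_succ (by omega)
  let f' : W → K := fun x => if h : ∃ i, 1 ≤ i ∧ i < j ∧ x = y i then w.getVert h.choose else f x
  have fT : ∀ i ≤ j, f' (y i) = w.getVert i := by
    intro i hi
    by_cases h : ∃ k, 1 ≤ k ∧ k < j ∧ y i = y k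
    · simp only [f', dif_pos h]
      have h3 := h.choose_spec
      have : i < j := by
        by_contra hc
        have : i = j := by omega
        subst this
        exact hend _ h3.1 h3.2.1 h3.2.2
      rw [← hinj i this _ h3.2.1 h3.2.2]
    · simp only [f', dif_neg h]
      have : i = 0 ∨ i = j := by
        by_contra hc
        exact h ⟨i, by omega, by omega, rfl⟩
      rcases this with rfl | rfl
      · simp
      · have hlen := w.getVert_length
        rw [hw] at hlen
        exact hlen.symm
  have fN : ∀ x ∉ T, f' x = f x := by
    intro x hx
    have hx' : ¬ ∃ i, 1 ≤ i ∧ i < j ∧ x = y i := hx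
    simp only [f']
    rw [dif_neg hx']
  have step : ∀ x z, x ∈ T → H.Adj x z → C.Adj (f' x) (f' z) := by
    rintro x z ⟨i, h1, h2, rfl⟩ hz
    rcases hcon' i h1 (by omega) z hz.symm with e | e
    · subst e
      rw [fT _ h2.le, fT _ (by omega)]
      have := hg (i - 1) (by omega)
      rw [show i - 1 + 1 = i by omega] at this
      exact this.symm
    · subst e
      rw [fT _ h2.le, fT _ (by omega)]
      exact hg i h2
  apply hbad
  refine ⟨f', fun x _ z _ hxz => ?_⟩
  by_cases hx : x ∈ T
  · exact step x z hx hxz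
  · by_cases hz : z ∈ T
    · exact (step z x hz hxz.symm).symm
    · rw [fN x hx, fN z hz]
      exact hf x hx z hz hxz

open scoped Classical in
theorem crit_deg (hC1 : ∀ a : K, ∃ b, C.Adj a b) [Nonempty K]
    (hbad : ¬ Col H C Set.univ) (hcrit : ∀ T : Set W, T.Nonempty → Col H C Tᶜ) (x b : W) :
    ∃ c, H.Adj c x ∧ c ≠ b := by
  by_contra hcon
  push Not at hcon
  obtain ⟨f, hf⟩ := hcrit {x} ⟨x, rfl⟩
  obtain ⟨k, hk⟩ := hC1 (f b)
  apply hbad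
  refine ⟨fun z => if z = x then k else f z, fun u _ v _ huv => ?_⟩
  by_cases hu : u = x
  · subst hu
    have hv := hcon v huv.symm
    subst hv
    simp only [if_true, huv.ne', if_false]
    exact hk.symm
  · by_cases hv : v = x
    · subst hv
      have := hcon u huv
      subst this
      simp only [if_true, huv.ne, if_false]
      exact hk
    · simp only [hu, hv, if_false]
      exact hf u hu v hv huv

end Colsec
/-- A path on `m + 1` vertices with a chord at each end. -/
def Bic {V : Type*} (G : SimpleGraph V) (m : ℕ) : Prop :=
  ∃ (v : Fin (m + 1) → V) (i j : Fin (m + 1)), Function.Injective v ∧ 2 ≤ i.val ∧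
    j.val + 2 ≤ m ∧ ¬ (i.val = m ∧ j.val = 0) ∧
    (∀ t : Fin m, G.Adj (v t.castSucc) (v t.succ)) ∧ G.Adj (v 0) (v i) ∧
    G.Adj (v (Fin.last m)) (v j)

theorem nb_getElem {W : Type*} {H : SimpleGraph W} (L : List W) (h : NB H L) :
    (∀ (t : ℕ) (a b : W), L[t]? = some a → L[t + 1]? = some b → H.Adj a b) ∧
    (∀ (t : ℕ) (a b : W), L[t]? = some a → L[t + 2]? = some b → a ≠ b) := by
  induction L with
  | nil => simp
  | cons x L ih =>
    obtain ⟨ih1, ih2⟩ := ih (nb_tail h)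
    constructor
    · intro t a b ha hb
      cases t with
      | zero =>
        match L, h, hb with
        | y :: L, h, hb =>
          simp at ha hb
          subst ha; subst hb
          exact nb_adj h
      | succ t => exact ih1 t a b (by simpa using ha) (by simpa using hb)
    · intro t a b ha hb
      cases t with
      | zero =>
        match L, h, hb with
        | y :: z :: L, h, hb =>
          simp at ha hb
          subst ha; subst hb
          exact h.2.1
      | succ t => exact ih2 t a b (by simpa using ha) (by simpa using hb)

theorem bic_of_list {V : Type*} {G : SimpleGraph V} {S : Set V}
    (F : List S) (z z' : S) (hnd : F.Nodup) (hz : z ∈ F) (hz' : z' ∈ F)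
    (hnb : NB (G.induce S) (z :: (F ++ [z'])))
    (hne : ¬ (F.head? = some z' ∧ F.getLast? = some z)) :
    ∃ m, m + 1 = F.length ∧ Bic G m := by
  obtain ⟨i, hi, ei⟩ := List.mem_iff_getElem.mp hz
  obtain ⟨j, hj, ej⟩ := List.mem_iff_getElem.mp hz'
  obtain ⟨m, hm⟩ : ∃ m, F.length = m + 1 := ⟨F.length - 1, by omega⟩
  obtain ⟨g1, g2⟩ := nb_getElem _ hnb
  have gF : ∀ t (ht : t < F.length), (z :: (F ++ [z']))[t + 1]? = some F[t] := by
    intro t ht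
    simp [List.getElem?_append_left ht, List.getElem?_eq_getElem ht]
  have gl : (z :: (F ++ [z']))[F.length + 1]? = some z' := by simp
  have adj : ∀ t (ht : t + 1 < F.length), (G.induce S).Adj F[t] F[t + 1] :=
    fun t ht => g1 (t + 1) _ _ (gF t (by omega)) (gF (t + 1) ht)
  have a0 : (G.induce S).Adj z F[0] := g1 0 _ _ (by simp) (gF 0 (by omega))
  have al : (G.induce S).Adj F[m] z' :=
    g1 (m + 1) _ _ (gF m (by omega)) (by rw [← hm]; exact gl)
  have hi2 : 2 ≤ i := by
    by_contra hc
    have : i = 0 ∨ i = 1 := by omega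
    rcases this with rfl | rfl
    · exact a0.ne ei.symm
    · exact g2 0 _ _ (by simp) (gF 1 hi) ei.symm
  have hj2 : j + 2 ≤ m := by
    by_contra hc
    have : j = m ∨ j + 1 = m := by omega
    rcases this with rfl | rfl
    · exact al.ne ej
    · exact g2 (j + 1) _ _ (gF j hj) (by rw [show j + 1 + 2 = F.length + 1 by omega]; exact gl) ej
  refine ⟨m, hm.symm, fun t => (F[t.val]'(by omega)).val, ⟨i, by omega⟩, ⟨j, by omega⟩, ?_, hi2,
    hj2, ?_, ?_, ?_, ?_⟩
  · intro s t hst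
    have := (List.Nodup.getElem_inj_iff hnd).mp (Subtype.ext hst)
    exact Fin.ext this
  · rintro ⟨h1, h2⟩
    simp at h1 h2
    subst h1; subst h2
    apply hne
    constructor
    · rw [List.head?_eq_getElem?, List.getElem?_eq_getElem hj, ej]
    · rw [List.getLast?_eq_getElem?, hm, Nat.add_sub_cancel, List.getElem?_eq_getElem hi, ei]
  · intro t
    exact adj t.val (by omega)
  · have := a0.symm
    rw [← ei] at this
    exact this
  · rw [← ej] at al
    exact al

theorem deterministic (ℓ : ℕ) (hℓ : 1 < ℓ) (n T : ℕ) (hT : n < 2 ^ T) (G : SimpleGraph (Fin n))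
    (hcyc : ¬ ∃ (u : Fin n) (w : G.Walk u u), w.IsCycle ∧ Odd w.length ∧ w.length < 2 * ℓ + 1)
    (hhom : ¬ Nonempty (G →g cycleGraph (2 * ℓ + 1))) :
    ∃ m, m + 1 ≤ 4 * ((2 * ℓ + 1) * T) + 4 ∧ Bic G m := by
  classical
  set C := cycleGraph (2 * ℓ + 1) with hCdef
  have hC : ∀ a b : Fin (2 * ℓ + 1), ∃ w : C.Walk a b, w.length = 2 * ℓ := by
    obtain ⟨m, hm⟩ : ∃ m, 2 * ℓ = m + 1 := ⟨2 * ℓ - 1, by omega⟩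
    have := walk_cycle m ℓ hm.symm
    rw [hCdef]
    have e : 2 * ℓ + 1 = m + 2 := by omega
    rw [e]
    exact this
  have hC1 : ∀ a : Fin (2 * ℓ + 1), ∃ b, C.Adj a b := by
    intro a
    obtain ⟨w, hw⟩ := hC a a
    have := w.adj_getVert_succ (i := 0) (by omega)
    simp at this
    exact ⟨_, this⟩
  have hbadU : ¬ Col G C Set.univ := by
    rintro ⟨f, hf⟩
    exact hhom ⟨⟨f, fun {a b} h => hf a trivial b trivial h⟩⟩
  obtain ⟨S, hS, hmin⟩ := WellFounded.has_min (wellFounded_lt (α := Set (Fin n)))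
    {S | ¬ Col G C S} ⟨_, hbadU⟩
  let H := G.induce S
  have hbad : ¬ Col H C Set.univ := by
    rintro ⟨f, hf⟩
    apply hS
    refine ⟨fun x => if h : x ∈ S then f ⟨x, h⟩ else 0, fun x hx y hy hxy => ?_⟩
    simp only [hx, hy, dif_pos]
    exact hf ⟨x, hx⟩ trivial ⟨y, hy⟩ trivial hxy
  have hcrit : ∀ T : Set S, T.Nonempty → Col H C Tᶜ := by
    rintro T ⟨x, hx⟩
    have hlt : (Subtype.val '' Tᶜ : Set (Fin n)) < S := by
      rw [Set.ssubset_iff_of_subset]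
      · refine ⟨x.val, x.2, ?_⟩
        rintro ⟨y, hy, e⟩
        exact hy (by rwa [Subtype.ext e])
      · rintro _ ⟨y, -, rfl⟩
        exact y.2
    have hcol : Col G C (Subtype.val '' Tᶜ) := by
      by_contra h
      exact hmin _ h hlt
    obtain ⟨f, hf⟩ := hcol
    exact ⟨fun s => f s.val, fun a ha b hb hab => hf _ ⟨a, ha, rfl⟩ _ ⟨b, hb, rfl⟩ hab⟩
  have hcycH : ∀ (u : S) (w : H.Walk u u), w.IsCycle → Odd w.length → 2 * ℓ + 1 ≤ w.length := by
    intro u w hw ho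
    by_contra hlt
    apply hcyc
    have hinj : Function.Injective (Embedding.induce (G := G) S).toHom :=
      (Embedding.induce (G := G) S).injective
    refine ⟨_, w.map (Embedding.induce (G := G) S).toHom, ?_, ?_, ?_⟩
    · exact (Walk.isCycle_map_iff_of_injective hinj).mpr hw
    · have hl : (w.map (Embedding.induce (G := G) S).toHom).length = w.length :=
        Walk.length_map _ _
      exact hl.symm ▸ ho
    · have hl : (w.map (Embedding.induce (G := G) S).toHom).length = w.length :=
        Walk.length_map _ _
      exact lt_of_eq_of_lt hl (not_le.mp hlt)
  have hne : Nonempty S := by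
    by_contra hc
    apply hbad
    exact ⟨fun _ => 0, fun x => absurd ⟨x⟩ hc⟩
  have hdeg := crit_deg hC1 hbad hcrit
  have h1 : ∀ L : List S, L ≠ [] → NB H L → ∃ z, NB H (z :: L) := by
    intro L hL hn
    match L, hL, hn with
    | [x], _, _ =>
      obtain ⟨c, hc, -⟩ := hdeg x x
      exact ⟨c, hc⟩
    | x :: b :: l, _, hn =>
      obtain ⟨c, hc, hcb⟩ := hdeg x b
      exact ⟨c, hc, hcb, hn⟩
  have h2 : ∀ L : List S, L ≠ [] → NB H L → ∃ M : List S, M.length ≤ 2 * ℓ ∧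
      ∃ z1 z2, z1 ≠ z2 ∧ NB H (z1 :: (M ++ L)) ∧ NB H (z2 :: (M ++ L)) := by
    intro L hL hn
    match L, hL, hn with
    | [x], _, _ =>
      obtain ⟨c, hc, -⟩ := hdeg x x
      obtain ⟨d, hd, hdc⟩ := hdeg x c
      exact ⟨[], by simp, d, c, hdc, hd, hc⟩
    | a :: b :: l, _, hn =>
      choose nxt hnxt1 hnxt2 using hdeg
      let s : ℕ → S × S := fun k => Nat.rec (b, a) (fun _ p => (p.2, nxt p.2 p.1)) k
      let y : ℕ → S := fun k => (s k).1
      have y1 : ∀ k, y (k + 1) = (s k).2 := fun k => rfl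
      have y2 : ∀ k, y (k + 2) = nxt (y (k + 1)) (y k) := fun k => rfl
      have hadj : ∀ i, H.Adj (y i) (y (i + 1)) := by
        intro i
        cases i with
        | zero => exact (nb_adj hn).symm
        | succ i => rw [y2]; exact (hnxt1 _ _).symm
      have hnb : ∀ i, y (i + 2) ≠ y i := by
        intro i; rw [y2]; exact hnxt2 _ _
      obtain ⟨i, hi, z, hz1, hz2, hz3⟩ := thread ℓ hℓ hC hC1 hbad hcrit hcycH y hadj hnb
      have ext : ∀ i, ∃ M l', M.length = i ∧ M ++ (a :: b :: l) = y (i + 1) :: y i :: l' ∧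
          NB H (M ++ (a :: b :: l)) := by
        intro i
        induction i with
        | zero => exact ⟨[], l, rfl, rfl, hn⟩
        | succ i ih =>
          obtain ⟨M, l', e1, e2, e3⟩ := ih
          refine ⟨y (i + 2) :: M, y i :: l', by simp [e1], by simp [e2], ?_⟩
          rw [List.cons_append, e2]
          rw [e2] at e3
          exact ⟨(hadj (i + 1)).symm, hnb i, e3⟩
      obtain ⟨M, l', e1, e2, e3⟩ := ext i
      refine ⟨M, by omega, y (i + 2), z, hz3.symm, ?_, ?_⟩
      · rw [e2] at e3 ⊢
        exact ⟨(hadj (i + 1)).symm, hnb i, e3⟩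
      · rw [e2] at e3 ⊢
        exact ⟨hz1, hz2, e3⟩
  have hcard : Fintype.card S < 2 ^ T := by
    refine lt_of_le_of_lt ?_ hT
    have := Fintype.card_subtype_le (fun x => x ∈ S)
    simpa using this
  obtain ⟨F, z, z', f1, f2, f3, f4, f5, f6⟩ := nb_bicyclic (2 * ℓ) T h1 h2 hcard
  obtain ⟨m, hm, hB⟩ := bic_of_list F z z' f2 f3 f4 f5 f6
  exact ⟨m, by omega, hB⟩

open scoped Classical in
theorem erProb_eq_finset (n : ℕ) (p : ℝ) (E0 : Finset (Sym2 (Fin n))) :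
    erProb n p (fun G => (E0 : Set (Sym2 (Fin n))) ⊆ G.edgeSet) =
      ∑ F ∈ (⊤ : SimpleGraph (Fin n)).edgeFinset.powerset.filter (fun F => E0 ⊆ F),
        p ^ F.card * (1 - p) ^ (n.choose 2 - F.card) := by
  unfold erProb
  rw [← Finset.sum_filter]
  refine Finset.sum_bij (fun G _ => G.edgeFinset) ?_ ?_ ?_ ?_
  · intro G hG
    simp only [Finset.mem_filter, Finset.mem_univ, true_and] at hG
    simp only [Finset.mem_filter, Finset.mem_powerset]
    refine ⟨SimpleGraph.edgeFinset_mono le_top, ?_⟩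
    intro e he
    exact SimpleGraph.mem_edgeFinset.mpr (hG he)
  · intro G _ G' _ h
    exact SimpleGraph.edgeFinset_inj.mp h
  · intro F hF
    simp only [Finset.mem_filter, Finset.mem_powerset] at hF
    have key : (SimpleGraph.fromEdgeSet (F : Set (Sym2 (Fin n)))).edgeSet = F := by
      rw [SimpleGraph.edgeSet_fromEdgeSet]
      ext e
      simp only [Set.mem_sdiff, Finset.mem_coe, and_iff_left_iff_imp]
      intro he
      have := hF.1 he
      rw [SimpleGraph.mem_edgeFinset] at this
      exact SimpleGraph.not_isDiag_of_mem_edgeSet _ this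
    refine ⟨SimpleGraph.fromEdgeSet (F : Set (Sym2 (Fin n))), ?_, ?_⟩
    · simp only [Finset.mem_filter, Finset.mem_univ, true_and, key]
      exact_mod_cast hF.2
    · apply Finset.coe_injective
      rw [SimpleGraph.coe_edgeFinset, key]
  · intro G _
    have : G.edgeSet.ncard = G.edgeFinset.card := by
      rw [← SimpleGraph.coe_edgeFinset, Set.ncard_coe_finset]
    rw [this]

open scoped Classical in
theorem erProb_subset (n : ℕ) (p : ℝ) (E0 : Finset (Sym2 (Fin n)))
    (hE : E0 ⊆ (⊤ : SimpleGraph (Fin n)).edgeFinset) :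
    erProb n p (fun G => (E0 : Set (Sym2 (Fin n))) ⊆ G.edgeSet) = p ^ E0.card := by
  rw [erProb_eq_finset]
  have hN : (⊤ : SimpleGraph (Fin n)).edgeFinset.card = n.choose 2 := by
    have := SimpleGraph.card_edgeFinset_top_eq_card_choose_two (V := Fin n)
    rw [Fintype.card_fin] at this
    convert this
  set E := (⊤ : SimpleGraph (Fin n)).edgeFinset with hEd
  have h1 : ∑ F ∈ E.powerset.filter (fun F => E0 ⊆ F),
        p ^ F.card * (1 - p) ^ (n.choose 2 - F.card) =
      ∑ F ∈ (E \ E0).powerset,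
        p ^ E0.card * (p ^ F.card * (1 - p) ^ ((E \ E0).card - F.card)) := by
    symm
    refine Finset.sum_bij (fun F _ => E0 ∪ F) ?_ ?_ ?_ ?_
    · intro F hF
      rw [Finset.mem_powerset] at hF
      simp only [Finset.mem_filter, Finset.mem_powerset]
      exact ⟨Finset.union_subset hE (hF.trans Finset.sdiff_subset), Finset.subset_union_left⟩
    · intro F hF F' hF' h
      rw [Finset.mem_powerset] at hF hF'
      ext e
      have h2 : e ∈ E0 ∪ F ↔ e ∈ E0 ∪ F' := by rw [h]
      have a := @hF e
      have b := @hF' e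
      simp only [Finset.mem_union, Finset.mem_sdiff] at h2 a b
      tauto
    · intro F hF
      simp only [Finset.mem_filter, Finset.mem_powerset] at hF
      exact ⟨F \ E0, by rw [Finset.mem_powerset]; exact Finset.sdiff_subset_sdiff hF.1 le_rfl,
        Finset.union_sdiff_of_subset hF.2⟩
    · intro F hF
      rw [Finset.mem_powerset] at hF
      have hd : Disjoint E0 F := by
        rw [Finset.disjoint_left]
        intro e he hf
        exact (Finset.mem_sdiff.mp (hF hf)).2 he
      rw [Finset.card_union_of_disjoint hd, Finset.card_sdiff_of_subset hE, hN, pow_add,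
        Nat.sub_sub, mul_assoc]
  rw [h1, ← Finset.mul_sum, Finset.sum_pow_mul_eq_add_pow]
  simp

theorem erProb_true (n : ℕ) (p : ℝ) : erProb n p (fun _ => True) = 1 := by
  have := erProb_subset n p ∅ (Finset.empty_subset _)
  simpa using this

theorem erw_nonneg (n : ℕ) {p : ℝ} (h0 : 0 ≤ p) (h1 : p ≤ 1) (G : SimpleGraph (Fin n)) :
    0 ≤ p ^ G.edgeSet.ncard * (1 - p) ^ (n.choose 2 - G.edgeSet.ncard) :=
  mul_nonneg (pow_nonneg h0 _) (pow_nonneg (by linarith) _)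

theorem erProb_mono (n : ℕ) {p : ℝ} (h0 : 0 ≤ p) (h1 : p ≤ 1) {P Q : SimpleGraph (Fin n) → Prop}
    (h : ∀ G, P G → Q G) : erProb n p P ≤ erProb n p Q := by
  unfold erProb
  refine Finset.sum_le_sum fun G _ => ?_
  have := erw_nonneg n h0 h1 G
  by_cases hP : P G
  · simp [hP, h G hP]
  · by_cases hQ : Q G
    · simpa [hP, hQ] using this
    · simp [hP, hQ]

theorem erProb_compl (n : ℕ) (p : ℝ) (P : SimpleGraph (Fin n) → Prop) :
    erProb n p P + erProb n p (fun G => ¬ P G) = 1 := by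
  rw [← erProb_true n p]
  unfold erProb
  rw [← Finset.sum_add_distrib]
  refine Finset.sum_congr rfl fun G _ => ?_
  by_cases hP : P G <;> simp [hP]

theorem erProb_union (n : ℕ) {p : ℝ} (h0 : 0 ≤ p) (h1 : p ≤ 1) {ι : Type*} [Fintype ι]
    (Q : ι → SimpleGraph (Fin n) → Prop) :
    erProb n p (fun G => ∃ i, Q i G) ≤ ∑ i, erProb n p (Q i) := by
  classical
  unfold erProb
  rw [Finset.sum_comm]
  refine Finset.sum_le_sum fun G _ => ?_
  have hw := erw_nonneg n h0 h1 G
  have hnn : ∀ i ∈ Finset.univ, 0 ≤ (if Q i G then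
      p ^ G.edgeSet.ncard * (1 - p) ^ (n.choose 2 - G.edgeSet.ncard) else 0) := by
    intro i _
    split_ifs
    · exact hw
    · exact le_rfl
  by_cases h : ∃ i, Q i G
  · obtain ⟨i, hi⟩ := h
    have := Finset.single_le_sum hnn (Finset.mem_univ i)
    rw [if_pos hi] at this
    rw [if_pos ⟨i, hi⟩]
    convert this
  · rw [if_neg h]
    convert Finset.sum_nonneg hnn

/-- The edge pattern of a bicyclic path configuration. -/
def patE (m : ℕ) (i j : Fin (m + 1)) : Finset (Sym2 (Fin (m + 1))) :=
  insert s(0, i) (insert s(Fin.last m, j)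
    (Finset.univ.image (fun t : Fin m => s(t.castSucc, t.succ))))

theorem patE_card (m : ℕ) (i j : Fin (m + 1)) (hi : 2 ≤ i.val) (hj : j.val + 2 ≤ m)
    (hij : ¬ (i.val = m ∧ j.val = 0)) : (patE m i j).card = m + 2 := by
  unfold patE
  rw [Finset.card_insert_of_notMem, Finset.card_insert_of_notMem, Finset.card_image_of_injective]
  · simp
  · intro a b h
    simp only [Sym2.eq_iff, Fin.ext_iff, Fin.val_castSucc, Fin.val_succ] at h
    apply Fin.ext
    omega
  · simp only [Finset.mem_image, Finset.mem_univ, true_and, not_exists]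
    intro t h
    simp only [Sym2.eq_iff, Fin.ext_iff, Fin.val_castSucc, Fin.val_succ, Fin.val_last] at h
    omega
  · simp only [Finset.mem_insert, Finset.mem_image, Finset.mem_univ, true_and, not_or, not_exists]
    constructor
    · intro h
      simp only [Sym2.eq_iff, Fin.ext_iff, Fin.val_zero, Fin.val_last] at h
      omega
    · intro t h
      simp only [Sym2.eq_iff, Fin.ext_iff, Fin.val_castSucc, Fin.val_succ, Fin.val_zero] at h
      omega

theorem patE_notDiag (m : ℕ) (i j : Fin (m + 1)) (hi : 2 ≤ i.val) (hj : j.val + 2 ≤ m)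
    (e : Sym2 (Fin (m + 1))) (he : e ∈ patE m i j) : ¬ e.IsDiag := by
  unfold patE at he
  simp only [Finset.mem_insert, Finset.mem_image, Finset.mem_univ, true_and] at he
  rcases he with rfl | rfl | ⟨t, rfl⟩
  · simp only [Sym2.mk_isDiag_iff, Fin.ext_iff, Fin.val_zero]
    omega
  · simp only [Sym2.mk_isDiag_iff, Fin.ext_iff, Fin.val_last]
    omega
  · simp only [Sym2.mk_isDiag_iff, Fin.ext_iff, Fin.val_castSucc, Fin.val_succ]
    omega

theorem erProb_bic (n m : ℕ) {p : ℝ} (h0 : 0 ≤ p) (h1 : p ≤ 1) :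
    erProb n p (fun G => Bic G m) ≤ (n : ℝ) ^ (m + 1) * ((m + 1 : ℕ) : ℝ) ^ 2 * p ^ (m + 2) := by
  classical
  let Q : (Fin (m + 1) → Fin n) × Fin (m + 1) × Fin (m + 1) → SimpleGraph (Fin n) → Prop :=
    fun x G => Function.Injective x.1 ∧ 2 ≤ x.2.1.val ∧
      x.2.2.val + 2 ≤ m ∧ ¬ (x.2.1.val = m ∧ x.2.2.val = 0) ∧
      (∀ t : Fin m, G.Adj (x.1 t.castSucc) (x.1 t.succ)) ∧ G.Adj (x.1 0) (x.1 x.2.1) ∧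
      G.Adj (x.1 (Fin.last m)) (x.1 x.2.2)
  have hQ : ∀ x, erProb n p (Q x) ≤ p ^ (m + 2) := by
    rintro ⟨v, i, j⟩
    by_cases hc : Function.Injective v ∧ 2 ≤ i.val ∧ j.val + 2 ≤ m ∧ ¬ (i.val = m ∧ j.val = 0)
    · obtain ⟨hv, hi, hj, hij⟩ := hc
      have hcard : ((patE m i j).image (Sym2.map v)).card = m + 2 := by
        rw [Finset.card_image_of_injective _ (Sym2.map.injective hv), patE_card m i j hi hj hij]
      have hsub : (patE m i j).image (Sym2.map v) ⊆ (⊤ : SimpleGraph (Fin n)).edgeFinset := by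
        intro e he
        obtain ⟨f, hf, rfl⟩ := Finset.mem_image.mp he
        have hnd := patE_notDiag m i j hi hj f hf
        induction f with
        | h a b =>
          rw [Sym2.mk_isDiag_iff] at hnd
          simpa using fun h => hnd (hv h)
      rw [← hcard, ← erProb_subset n p _ (by convert hsub)]
      refine erProb_mono n h0 h1 ?_
      rintro G ⟨_, _, _, _, hp, ha, hb⟩ e he
      simp only [Finset.coe_image, Set.mem_image, Finset.mem_coe] at he
      obtain ⟨f, hf, rfl⟩ := he
      unfold patE at hf
      simp only [Finset.mem_insert, Finset.mem_image, Finset.mem_univ, true_and] at hf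
      rcases hf with rfl | rfl | ⟨t, rfl⟩
      · exact ha
      · exact hb
      · exact hp t
    · refine le_trans (le_of_eq ?_) (pow_nonneg h0 _)
      unfold erProb
      refine Finset.sum_eq_zero fun G _ => if_neg ?_
      rintro ⟨a, b, c, d, _⟩
      exact hc ⟨a, b, c, d⟩
  calc erProb n p (fun G => Bic G m) ≤ erProb n p (fun G => ∃ x, Q x G) := by
        refine erProb_mono n h0 h1 ?_
        rintro G ⟨v, i, j, h⟩
        exact ⟨(v, i, j), h⟩
    _ ≤ ∑ x, erProb n p (Q x) := erProb_union n h0 h1 Q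
    _ ≤ ∑ x : (Fin (m + 1) → Fin n) × Fin (m + 1) × Fin (m + 1), p ^ (m + 2) :=
        Finset.sum_le_sum fun x _ => hQ x
    _ = _ := by
        rw [Finset.sum_const, Finset.card_univ, nsmul_eq_mul]
        simp only [Fintype.card_prod, Fintype.card_fun, Fintype.card_fin]
        push_cast
        ring

theorem erProb_bad (n K : ℕ) (hn : 0 < n) {r : ℝ} (hr : 1 ≤ r) (hrn : r ≤ n) :
    erProb n (r / n) (fun G => ∃ m, m + 1 ≤ K ∧ Bic G m) ≤ (K : ℝ) ^ 3 * r ^ (K + 1) / n := by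
  have hn' : (0 : ℝ) < n := by exact_mod_cast hn
  have h0 : 0 ≤ r / n := by positivity
  have h1 : r / n ≤ 1 := by rw [div_le_one hn']; exact hrn
  calc erProb n (r / n) (fun G => ∃ m, m + 1 ≤ K ∧ Bic G m)
      ≤ erProb n (r / n) (fun G => ∃ m : Fin K, Bic G m.val) := by
        refine erProb_mono n h0 h1 ?_
        rintro G ⟨m, hm, h⟩
        exact ⟨⟨m, hm⟩, h⟩
    _ ≤ ∑ m : Fin K, erProb n (r / n) (fun G => Bic G m.val) := erProb_union n h0 h1 _
    _ ≤ ∑ m : Fin K, (K : ℝ) ^ 2 * r ^ (K + 1) / n := by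
        refine Finset.sum_le_sum fun m _ => (erProb_bic n m.val h0 h1).trans ?_
        have e : (n : ℝ) ^ (m.val + 1) * ((m.val + 1 : ℕ) : ℝ) ^ 2 * (r / n) ^ (m.val + 2) =
            ((m.val + 1 : ℕ) : ℝ) ^ 2 * r ^ (m.val + 2) / n := by
          rw [div_pow, pow_succ (n : ℝ) (m.val + 1)]
          field_simp
        rw [e]
        have hm : m.val + 1 ≤ K := m.isLt
        have a1 : ((m.val + 1 : ℕ) : ℝ) ≤ K := by exact_mod_cast hm
        have a2 : r ^ (m.val + 2) ≤ r ^ (K + 1) := pow_le_pow_right₀ hr (by omega)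
        gcongr
    _ = _ := by
        rw [Finset.sum_const, Finset.card_univ, Fintype.card_fin, nsmul_eq_mul]
        ring

/-- For every integer `ℓ > 1` there exists `ε > 0` such that w.h.p. `G_{n,(1+ε)/n}` either
contains an odd cycle of length less than `2ℓ+1` or admits a homomorphism to `C_{2ℓ+1}`. -/
theorem statement0 (ℓ : ℕ) (hℓ : 1 < ℓ) :
    ∃ ε : ℝ, 0 < ε ∧
      Tendsto
        (fun n : ℕ => erProb n ((1 + ε) / n) (fun G =>
          (∃ (u : Fin n) (w : G.Walk u u), w.IsCycle ∧ Odd w.length ∧ w.length < 2 * ℓ + 1) ∨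
          Nonempty (G →g cycleGraph (2 * ℓ + 1))))
        atTop (nhds 1) := by
  obtain ⟨A, hA⟩ : ∃ A : ℕ, A = 8 * ℓ + 13 := ⟨_, rfl⟩
  have hA0 : (0 : ℝ) < A := by rw [hA]; positivity
  obtain ⟨r, hrd⟩ : ∃ r : ℝ, r = (2 : ℝ) ^ (1 / (2 * (A : ℝ))) := ⟨_, rfl⟩
  have hr1 : 1 < r := by rw [hrd]; exact Real.one_lt_rpow (by norm_num) (by positivity)
  obtain ⟨s, hs⟩ : ∃ s : ℝ, s = r ^ A := ⟨_, rfl⟩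
  have hs1 : 1 < s := by
    rw [hs]
    exact one_lt_pow₀ hr1 (by omega)
  have hs2 : s ^ 2 = 2 := by
    rw [hs, hrd, ← pow_mul, ← Real.rpow_natCast, ← Real.rpow_mul (by norm_num)]
    have : 1 / (2 * (A : ℝ)) * ((A * 2 : ℕ) : ℝ) = 1 := by
      push_cast
      field_simp
    rw [this, Real.rpow_one]
  refine ⟨r - 1, by linarith, ?_⟩
  have hr' : 1 + (r - 1) = r := by ring
  rw [hr']
  have hlog : Tendsto (fun n : ℕ => Nat.log 2 n + 1) atTop atTop := by
    rw [tendsto_atTop]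
    intro b
    filter_upwards [eventually_ge_atTop (2 ^ b)] with n hn
    have := Nat.le_log_of_pow_le (by norm_num) hn
    omega
  have hlim : Tendsto (fun n : ℕ => (A : ℝ) ^ 3 * 2 *
      (((Nat.log 2 n + 1 : ℕ) : ℝ) ^ 3 / s ^ (Nat.log 2 n + 1))) atTop (nhds 0) := by
    have := ((tendsto_pow_const_div_const_pow_of_one_lt 3 hs1).comp hlog).const_mul
      ((A : ℝ) ^ 3 * 2)
    simpa using this
  have hlow : Tendsto (fun n : ℕ => 1 - (A : ℝ) ^ 3 * 2 *
      (((Nat.log 2 n + 1 : ℕ) : ℝ) ^ 3 / s ^ (Nat.log 2 n + 1))) atTop (nhds 1) := by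
    simpa using hlim.const_sub 1
  have hbig : ∀ᶠ n : ℕ in atTop, r ≤ n ∧ 0 < n := by
    filter_upwards [tendsto_natCast_atTop_atTop.eventually_ge_atTop r,
      eventually_gt_atTop 0] with n h1 h2
    exact ⟨h1, h2⟩
  refine tendsto_of_tendsto_of_tendsto_of_le_of_le' hlow tendsto_const_nhds ?_ ?_
  · filter_upwards [hbig] with n hn
    obtain ⟨hrn, hn0⟩ := hn
    have hn' : (0 : ℝ) < n := by exact_mod_cast hn0
    have h0 : 0 ≤ r / n := by positivity
    have h1 : r / n ≤ 1 := by rw [div_le_one hn']; exact hrn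
    obtain ⟨L, hL⟩ : ∃ L, L = Nat.log 2 n := ⟨_, rfl⟩
    have hc := erProb_compl n (r / n) (fun G =>
          (∃ (u : Fin n) (w : G.Walk u u), w.IsCycle ∧ Odd w.length ∧ w.length < 2 * ℓ + 1) ∨
          Nonempty (G →g cycleGraph (2 * ℓ + 1)))
    obtain ⟨K, hK⟩ : ∃ K, K = 4 * ((2 * ℓ + 1) * (L + 1)) + 4 := ⟨_, rfl⟩
    have hb : erProb n (r / n) (fun G => ¬ (
          (∃ (u : Fin n) (w : G.Walk u u), w.IsCycle ∧ Odd w.length ∧ w.length < 2 * ℓ + 1) ∨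
          Nonempty (G →g cycleGraph (2 * ℓ + 1)))) ≤
        erProb n (r / n) (fun G => ∃ m, m + 1 ≤ K ∧ Bic G m) := by
      refine erProb_mono n h0 h1 ?_
      intro G hG
      rw [not_or] at hG
      rw [hK, hL]
      exact deterministic ℓ hℓ n _ (Nat.lt_pow_succ_log_self (by norm_num) n) G hG.1 hG.2
    have hb2 := erProb_bad n K hn0 hr1.le hrn
    have hKA : K + 1 ≤ A * (L + 1) := by
      rw [hK, hA]
      nlinarith
    have e1 : (K : ℝ) ≤ A * ((L + 1 : ℕ) : ℝ) := by
      have : K ≤ A * (L + 1) := by omega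
      exact_mod_cast this
    have e2 : r ^ (K + 1) ≤ s ^ (L + 1) := by
      rw [hs, ← pow_mul]
      exact pow_le_pow_right₀ hr1.le hKA
    have e3 : s ^ (2 * L) ≤ n := by
      rw [pow_mul, hs2, hL]
      exact_mod_cast Nat.pow_log_le_self 2 hn0.ne'
    have hs0 : 0 < s := by linarith
    have hr0 : 0 < r := by linarith
    have e4 : (K : ℝ) ^ 3 * r ^ (K + 1) / n ≤ (A : ℝ) ^ 3 * 2 *
      (((L + 1 : ℕ) : ℝ) ^ 3 / s ^ (L + 1)) := by
      calc (K : ℝ) ^ 3 * r ^ (K + 1) / n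
          ≤ (A * ((L + 1 : ℕ) : ℝ)) ^ 3 * s ^ (L + 1) / s ^ (2 * L) := by gcongr
        _ = _ := by
          rw [← hs2]
          field_simp
          ring
    rw [← hL]
    linarith
  · filter_upwards [hbig] with n hn
    obtain ⟨hrn, hn0⟩ := hn
    have hn' : (0 : ℝ) < n := by exact_mod_cast hn0
    have h0 : 0 ≤ r / n := by positivity
    have h1 : r / n ≤ 1 := by rw [div_le_one hn']; exact hrn
    rw [← erProb_true n (r / n)]
    exact erProb_mono n h0 h1 fun _ _ => trivial
end

section
/- With high probability as n → ∞, the random graph G_{n,4/n} admits no graph homomorphism to the cycle C_5. -/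
open Filter SimpleGraph

lemma nml_tangent (x y : ℝ) (hx : 0 ≤ x) (hy : 0 < y) :
    Real.negMulLog x ≤ y - x - x * Real.log y := by
  rcases hx.eq_or_lt with rfl | hx
  · simp [hy.le]
  · have h := Real.log_le_sub_one_of_pos (div_pos hy hx)
    rw [Real.log_div hy.ne' hx.ne'] at h
    have h2 := mul_le_mul_of_nonneg_left h hx.le
    have h3 : x * (y / x - 1) = y - x := by field_simp
    rw [h3] at h2
    unfold Real.negMulLog
    linarith

lemma log_half_pow (k : ℕ) : Real.log ((1 / 2 : ℝ) ^ k) = - (k * Real.log 2) := by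
  rw [Real.log_pow, one_div, Real.log_inv]; ring

lemma nml_pow (x : ℝ) (hx : 0 ≤ x) (k : ℕ) :
    Real.negMulLog x ≤ (1 / 2 : ℝ) ^ k - x + x * (k * Real.log 2) := by
  have := nml_tangent x ((1 / 2 : ℝ) ^ k) hx (by positivity)
  rw [log_half_pow] at this
  linarith

lemma nml_quad (x : ℝ) (hx : 0 ≤ x) (hx' : x ≤ 3 / 5) :
    Real.negMulLog x ≤ 0.353 + 0.91 * (x - 0.2) - 2.5 * (x - 0.2) ^ 2 := by
  have l2 := Real.log_two_lt_d9
  have hl : x * Real.log 2 ≤ x * 0.6931471808 := mul_le_mul_of_nonneg_left l2.le hx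
  rcases le_total x 0.0901 with h | h
  · have := nml_pow x hx 4
    norm_num at this hl h ⊢
    nlinarith [mul_nonneg hx (sub_nonneg.2 h)]
  rcases le_total x 0.2 with h1 | h1
  · have := nml_pow x hx 3
    norm_num at this hl h h1 ⊢
    nlinarith [mul_nonneg (sub_nonneg.2 h) (sub_nonneg.2 h1)]
  rcases le_total x 0.4 with h2 | h2
  · have := nml_pow x hx 2
    norm_num at this hl h1 h2 ⊢
    nlinarith [mul_nonneg (sub_nonneg.2 h1) (sub_nonneg.2 h2)]
  · have := nml_pow x hx 1
    norm_num at this hl h2 ⊢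
    nlinarith [mul_nonneg (sub_nonneg.2 h2) (sub_nonneg.2 hx')]

lemma analytic_big (a b c d e : ℝ) (ha : 3 / 5 ≤ a) (hb : 0 ≤ b) (hc : 0 ≤ c) (hd : 0 ≤ d)
    (he : 0 ≤ e) (hs : a + b + c + d + e = 1) :
    8 * (a * b + b * c + c * d + d * e + e * a) + (Real.negMulLog a + Real.negMulLog b +
      Real.negMulLog c + Real.negMulLog d + Real.negMulLog e) ≤ 3.365 := by
  have l2 := Real.log_two_lt_d9
  have h0 := nml_pow a (by linarith) 1
  have h1 := nml_pow b hb 3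
  have h2 := nml_pow c hc 3
  have h3 := nml_pow d hd 3
  have h4 := nml_pow e he 3
  have hq : a * b + b * c + c * d + d * e + e * a ≤ a * (1 - a) := by
    nlinarith [mul_nonneg hc (by linarith : 0 ≤ a - b - d), mul_nonneg hd (by linarith : 0 ≤ a - e)]
  have hl : Real.log 2 * (3 - 2 * a) ≤ 0.6931471808 * (3 - 2 * a) :=
    mul_le_mul_of_nonneg_right l2.le (by linarith)
  have hsum : Real.negMulLog a + Real.negMulLog b +
      Real.negMulLog c + Real.negMulLog d + Real.negMulLog e ≤ Real.log 2 * (3 - 2 * a) := by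
    norm_num at h0 h1 h2 h3 h4
    have : b = 1 - a - c - d - e := by linarith
    subst this
    nlinarith
  norm_num at hl ⊢
  nlinarith [mul_nonneg (sub_nonneg.2 ha) (sub_nonneg.2 ha)]

lemma analytic (x : Fin 5 → ℝ) (h0 : ∀ i, 0 ≤ x i) (hs : ∑ i, x i = 1) :
    8 * (∑ i, x i * x (i + 1)) + ∑ i, Real.negMulLog (x i) ≤ 3.365 := by
  have e1 : (∑ i, x i * x (i + 1)) =
      x 0 * x 1 + x 1 * x 2 + x 2 * x 3 + x 3 * x 4 + x 4 * x 0 := by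
    rw [Fin.sum_univ_five]; rfl
  rw [e1]
  rw [Fin.sum_univ_five] at hs ⊢
  have a0 := h0 0
  have a1 := h0 1
  have a2 := h0 2
  have a3 := h0 3
  have a4 := h0 4
  generalize x 0 = a at *
  generalize x 1 = b at *
  generalize x 2 = c at *
  generalize x 3 = d at *
  generalize x 4 = e at *
  by_cases ha : 3 / 5 ≤ a
  · exact analytic_big a b c d e ha a1 a2 a3 a4 hs
  by_cases hb : 3 / 5 ≤ b
  · have := analytic_big b c d e a hb a2 a3 a4 a0 (by linarith)
    linarith
  by_cases hc : 3 / 5 ≤ c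
  · have := analytic_big c d e a b hc a3 a4 a0 a1 (by linarith)
    linarith
  by_cases hd : 3 / 5 ≤ d
  · have := analytic_big d e a b c hd a4 a0 a1 a2 (by linarith)
    linarith
  by_cases he : 3 / 5 ≤ e
  · have := analytic_big e a b c d he a0 a1 a2 a3 (by linarith)
    linarith
  push Not at ha hb hc hd he
  have q0 := nml_quad a a0 ha.le
  have q1 := nml_quad b a1 hb.le
  have q2 := nml_quad c a2 hc.le
  have q3 := nml_quad d a3 hd.le
  have q4 := nml_quad e a4 he.le
  have hsq : (a + b + c + d + e) ^ 2 = 1 := by rw [hs]; norm_num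
  have s : 0 ≤ 18 / 5 * (a - 29 / 36 * b + 11 / 36 * c + 11 / 36 * d - 29 / 36 * e) ^ 2
    + 91 / 72 * (b - 145 / 91 * c + 11 / 7 * d - 89 / 91 * e) ^ 2
    + 5 / 91 * (c - 13 / 10 * d + 3 / 10 * e) ^ 2 + 1 / 20 * (d - e) ^ 2 := by positivity
  norm_num at q0 q1 q2 q3 q4 ⊢
  linarith

open scoped Classical in
lemma sum_graphs (n : ℕ) (S : Finset (Sym2 (Fin n)))
    (hS : S ⊆ (⊤ : SimpleGraph (Fin n)).edgeFinset) (x y : ℝ) :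
    (∑ G : SimpleGraph (Fin n), if G.edgeSet ⊆ (S : Set (Sym2 (Fin n))) then
      x ^ G.edgeSet.ncard * y ^ (n.choose 2 - G.edgeSet.ncard) else 0) =
    (x + y) ^ S.card * y ^ (n.choose 2 - S.card) := by
  have hN : (⊤ : SimpleGraph (Fin n)).edgeFinset.card = n.choose 2 := by
    have h := SimpleGraph.card_edgeFinset_top_eq_card_choose_two (V := Fin n)
    rw [Fintype.card_fin] at h
    convert h
  have hSN : S.card ≤ n.choose 2 := hN ▸ Finset.card_le_card hS
  rw [← Finset.sum_pow_mul_eq_add_pow, Finset.sum_mul, ← Finset.sum_filter]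
  refine Finset.sum_bij' (fun G _ => G.edgeFinset)
    (fun T _ => SimpleGraph.fromEdgeSet (T : Set (Sym2 (Fin n)))) ?_ ?_ ?_ ?_ ?_
  · intro G hG
    rw [Finset.mem_filter] at hG
    rw [Finset.mem_powerset, ← Finset.coe_subset, SimpleGraph.coe_edgeFinset]
    exact hG.2
  · intro T hT
    rw [Finset.mem_powerset] at hT
    simp only [Finset.mem_filter, Finset.mem_univ, true_and, SimpleGraph.edgeSet_fromEdgeSet]
    exact fun e he => hT he.1
  · intro G hG
    simp
  · intro T hT
    rw [Finset.mem_powerset] at hT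
    rw [← Finset.coe_inj, SimpleGraph.coe_edgeFinset, SimpleGraph.edgeSet_fromEdgeSet]
    ext e
    simp only [Set.mem_sdiff, Finset.mem_coe]
    refine ⟨fun h => h.1, fun h => ⟨h, ?_⟩⟩
    have := hS (hT h)
    rw [SimpleGraph.mem_edgeFinset] at this
    exact SimpleGraph.not_isDiag_of_mem_edgeSet _ this
  · intro G hG
    rw [Finset.mem_filter] at hG
    have h1 : G.edgeSet.ncard = G.edgeFinset.card := by
      rw [← SimpleGraph.coe_edgeFinset, Set.ncard_coe_finset]
    have h2 : G.edgeFinset.card ≤ S.card := by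
      apply Finset.card_le_card
      rw [← Finset.coe_subset, SimpleGraph.coe_edgeFinset]
      exact hG.2
    rw [h1, mul_assoc, ← pow_add]
    congr 2
    omega

/-- Number of vertices mapped to `i`. -/
def cnt {n : ℕ} (σ : Fin n → Fin 5) (i : Fin 5) : ℕ := (Finset.univ.filter (fun v => σ v = i)).card

lemma cnt_sum {n : ℕ} (σ : Fin n → Fin 5) : ∑ i, cnt σ i = n := by
  have := Finset.card_eq_sum_card_fiberwise (f := σ) (s := Finset.univ) (t := Finset.univ)
    (by intro x _; simp)
  simp only [Finset.card_univ, Fintype.card_fin] at this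
  exact this.symm

open scoped Classical in
lemma card_allowed {n : ℕ} (σ : Fin n → Fin 5) :
    ((cycleGraph 5).comap σ).edgeFinset.card ≤ ∑ i, cnt σ i * cnt σ (i + 1) := by
  have hsub : ((cycleGraph 5).comap σ).edgeFinset ⊆ Finset.univ.biUnion (fun i : Fin 5 =>
      ((Finset.univ.filter (fun v => σ v = i)) ×ˢ
        (Finset.univ.filter (fun v => σ v = i + 1))).image (fun p => s(p.1, p.2))) := by
    intro e
    induction e using Sym2.ind with
    | _ u v =>
      intro h
      rw [SimpleGraph.mem_edgeFinset, SimpleGraph.mem_edgeSet, SimpleGraph.comap_adj,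
        SimpleGraph.cycleGraph_adj] at h
      simp only [Finset.mem_biUnion, Finset.mem_univ, true_and, Finset.mem_image,
        Finset.mem_product, Finset.mem_filter]
      rcases h with h | h
      · exact ⟨σ v, (v, u), ⟨rfl, by rw [← h]; simp⟩, Sym2.eq_swap⟩
      · exact ⟨σ u, (u, v), ⟨rfl, by rw [← h]; simp⟩, rfl⟩
  refine (Finset.card_le_card hsub).trans (Finset.card_biUnion_le.trans ?_)
  refine Finset.sum_le_sum fun i _ => ?_
  refine Finset.card_image_le.trans ?_
  rw [Finset.card_product]
  rfl

lemma exp_neg_entropy {n : ℕ} (hn : 0 < n) (σ : Fin n → Fin 5) :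
    Real.exp (-(n * ∑ i, Real.negMulLog ((cnt σ i : ℝ) / n))) =
      ∏ v, ((cnt σ (σ v) : ℝ) / n) := by
  have hn' : (0 : ℝ) < n := by exact_mod_cast hn
  have hpos : ∀ v, (0 : ℝ) < (cnt σ (σ v) : ℝ) / n := by
    intro v
    apply div_pos _ hn'
    have : 0 < cnt σ (σ v) := Finset.card_pos.2 ⟨v, by simp⟩
    exact_mod_cast this
  have h : ∑ v, Real.log ((cnt σ (σ v) : ℝ) / n) =
      -(n * ∑ i, Real.negMulLog ((cnt σ i : ℝ) / n)) := by
    rw [← Finset.sum_fiberwise (s := Finset.univ) (g := σ), Finset.mul_sum,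
      ← Finset.sum_neg_distrib]
    refine Finset.sum_congr rfl fun i _ => ?_
    rw [Finset.sum_congr rfl (g := fun _ => Real.log ((cnt σ i : ℝ) / n))]
    · rw [Finset.sum_const, nsmul_eq_mul]
      change (cnt σ i : ℝ) * _ = _
      unfold Real.negMulLog
      field_simp
    · intro v hv
      rw [(Finset.mem_filter.1 hv).2]
  rw [← h, Real.exp_sum]
  exact Finset.prod_congr rfl fun v _ => Real.exp_log (hpos v)

lemma sum_prod_cnt {n : ℕ} (hn : 0 < n) :
    ∑ σ : Fin n → Fin 5, ∏ v, ((cnt σ (σ v) : ℝ) / n) ≤ ((n : ℝ) + 1) ^ 5 := by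
  have hn' : (0 : ℝ) < n := by exact_mod_cast hn
  let K : Finset (Fin 5 → Fin (n + 1)) := Finset.univ.filter (fun k => ∑ i, (k i : ℕ) = n)
  have h1 : ∀ σ : Fin n → Fin 5, ∏ v, ((cnt σ (σ v) : ℝ) / n) ≤
      ∑ k ∈ K, ∏ v, (((k (σ v) : ℕ) : ℝ) / n) := by
    intro σ
    have hle : ∀ i, cnt σ i < n + 1 := by
      intro i
      have h := cnt_sum σ
      have := Finset.single_le_sum (f := cnt σ) (fun i _ => Nat.zero_le _) (Finset.mem_univ i)
      omega
    have := Finset.single_le_sum (s := K) (a := fun i => (⟨cnt σ i, hle i⟩ : Fin (n + 1)))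
      (f := fun k => ∏ v, (((k (σ v) : ℕ) : ℝ) / n))
      (fun k _ => Finset.prod_nonneg fun v _ => by positivity)
      (by simp only [K, Finset.mem_filter, Finset.mem_univ, true_and]; exact cnt_sum σ)
    exact this
  refine (Finset.sum_le_sum fun σ _ => h1 σ).trans ?_
  rw [Finset.sum_comm]
  have h2 : ∀ k ∈ K, ∑ σ : Fin n → Fin 5, ∏ v, (((k (σ v) : ℕ) : ℝ) / n) = 1 := by
    intro k hk
    rw [← Fintype.sum_pow (fun i => ((k i : ℕ) : ℝ) / n) n, ← Finset.sum_div]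
    have : ∑ i, (k i : ℕ) = n := (Finset.mem_filter.1 hk).2
    rw [← Nat.cast_sum, this, div_self hn'.ne', one_pow]
  rw [Finset.sum_congr rfl h2, Finset.sum_const, nsmul_eq_mul, mul_one]
  have : K.card ≤ (n + 1) ^ 5 := by
    refine (Finset.card_le_univ _).trans ?_
    simp
  exact_mod_cast this

lemma sum_exp_bound {n : ℕ} (hn : 0 < n) :
    ∑ σ : Fin n → Fin 5, Real.exp (8 / n * ((∑ i, cnt σ i * cnt σ (i + 1) : ℕ) : ℝ)) ≤
      Real.exp (3.365 * n) * ((n : ℝ) + 1) ^ 5 := by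
  have hn' : (0 : ℝ) < n := by exact_mod_cast hn
  have h1 : ∀ σ : Fin n → Fin 5,
      Real.exp (8 / n * ((∑ i, cnt σ i * cnt σ (i + 1) : ℕ) : ℝ)) ≤
      Real.exp (3.365 * n) * ∏ v, ((cnt σ (σ v) : ℝ) / n) := by
    intro σ
    rw [← exp_neg_entropy hn, ← Real.exp_add, Real.exp_le_exp]
    have h := analytic (fun i => (cnt σ i : ℝ) / n) (fun i => by positivity) (by
      rw [← Finset.sum_div, ← Nat.cast_sum, cnt_sum, div_self hn'.ne'])
    have h' := mul_le_mul_of_nonneg_left h hn'.le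
    have e : (n : ℝ) * (8 * ∑ i, (cnt σ i : ℝ) / n * ((cnt σ (i + 1) : ℝ) / n)) =
        8 / n * ((∑ i, cnt σ i * cnt σ (i + 1) : ℕ) : ℝ) := by
      push_cast
      rw [Finset.mul_sum, Finset.mul_sum, Finset.mul_sum]
      refine Finset.sum_congr rfl fun i _ => ?_
      field_simp
    rw [mul_add, e] at h'
    linarith
  refine (Finset.sum_le_sum fun σ _ => h1 σ).trans ?_
  rw [← Finset.mul_sum]
  exact mul_le_mul_of_nonneg_left (sum_prod_cnt hn) (Real.exp_pos _).le

open scoped Classical in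
lemma erProb_bound {n : ℕ} (hn : 4 ≤ n) :
    1 - erProb n (4 / n) (fun G => IsEmpty (G →g cycleGraph 5)) ≤
      Real.exp (1.99 * n / 499) * Real.exp (-(2 * (n - 1)) / 500) +
      Real.exp (-(1.99 * n * Real.log 2)) * (Real.exp (-(2 * (n - 1))) *
        (Real.exp (3.365 * n) * ((n : ℝ) + 1) ^ 5)) := by
  have hn4 : (4 : ℝ) ≤ n := by exact_mod_cast hn
  have hn' : (0 : ℝ) < n := by linarith
  have hN : ((n.choose 2 : ℕ) : ℝ) = n * (n - 1) / 2 := Nat.cast_choose_two ℝ n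
  set p : ℝ := 4 / n with hp
  have hp0 : 0 ≤ p := by positivity
  have hp1 : 0 ≤ 1 - p := by
    rw [hp, sub_nonneg, div_le_one hn']; exact hn4
  have hpN : p * (n.choose 2 : ℕ) = 2 * (n - 1) := by
    rw [hN, hp]; field_simp; ring
  set w : SimpleGraph (Fin n) → ℝ :=
    fun G => p ^ G.edgeSet.ncard * (1 - p) ^ (n.choose 2 - G.edgeSet.ncard) with hw
  have hw0 : ∀ G, 0 ≤ w G := fun G => by positivity
  have htopsub : ∀ G : SimpleGraph (Fin n), G.edgeSet ⊆
      ((⊤ : SimpleGraph (Fin n)).edgeFinset : Set (Sym2 (Fin n))) := by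
    intro G
    rw [SimpleGraph.coe_edgeFinset]
    exact SimpleGraph.edgeSet_mono le_top
  have hcard : (⊤ : SimpleGraph (Fin n)).edgeFinset.card = n.choose 2 := by
    have h := SimpleGraph.card_edgeFinset_top_eq_card_choose_two (V := Fin n)
    rw [Fintype.card_fin] at h
    convert h
  have htot : ∀ x y : ℝ, ∑ G : SimpleGraph (Fin n),
      x ^ G.edgeSet.ncard * y ^ (n.choose 2 - G.edgeSet.ncard) = (x + y) ^ n.choose 2 := by
    intro x y
    have := sum_graphs n _ (subset_refl _) x y
    simp only [htopsub, if_true] at this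
    rw [this, hcard]
    simp
  have hone : ∑ G, w G = 1 := by
    rw [hw, htot]; simp
  -- pointwise bound
  have hpt : ∀ G : SimpleGraph (Fin n),
      w G - (if IsEmpty (G →g cycleGraph 5) then w G else 0) ≤
      Real.exp (1.99 * n / 499) *
        ((499 / 500 * p) ^ G.edgeSet.ncard * (1 - p) ^ (n.choose 2 - G.edgeSet.ncard)) +
      Real.exp (-(1.99 * n * Real.log 2)) * ∑ σ : Fin n → Fin 5,
        (if G.edgeSet ⊆ (((cycleGraph 5).comap σ).edgeFinset : Set (Sym2 (Fin n))) then
          (2 * p) ^ G.edgeSet.ncard * (1 - p) ^ (n.choose 2 - G.edgeSet.ncard) else 0) := by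
    intro G
    have t1 : 0 ≤ Real.exp (1.99 * n / 499) *
        ((499 / 500 * p) ^ G.edgeSet.ncard * (1 - p) ^ (n.choose 2 - G.edgeSet.ncard)) := by
      positivity
    have t2 : ∀ σ : Fin n → Fin 5, 0 ≤
        (if G.edgeSet ⊆ (((cycleGraph 5).comap σ).edgeFinset : Set (Sym2 (Fin n))) then
          (2 * p) ^ G.edgeSet.ncard * (1 - p) ^ (n.choose 2 - G.edgeSet.ncard) else 0) := by
      intro σ
      split_ifs
      · positivity
      · exact le_rfl
    have t3 := mul_nonneg (Real.exp_pos (-(1.99 * n * Real.log 2))).le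
      (Finset.sum_nonneg fun σ (_ : σ ∈ Finset.univ) => t2 σ)
    split_ifs with hG
    · rw [sub_self]; exact add_nonneg t1 t3
    rw [sub_zero]
    rw [not_isEmpty_iff] at hG
    obtain ⟨f⟩ := hG
    rcases le_total (G.edgeSet.ncard : ℝ) (1.99 * n) with he | he
    · refine le_trans ?_ (le_add_of_nonneg_right t3)
      have h1 : 1 ≤ Real.exp (1.99 * n / 499) * (499 / 500 : ℝ) ^ G.edgeSet.ncard := by
        have hl : -(1 / 499 : ℝ) ≤ Real.log (499 / 500) := by
          have := Real.one_sub_inv_le_log_of_pos (show (0 : ℝ) < 499 / 500 by norm_num)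
          norm_num at this ⊢
          linarith
        rw [← Real.exp_log (show (0 : ℝ) < 499 / 500 by norm_num), ← Real.exp_nat_mul,
          ← Real.exp_add]
        apply Real.one_le_exp
        have := mul_le_mul_of_nonneg_left hl (Nat.cast_nonneg (α := ℝ) G.edgeSet.ncard)
        linarith
      calc w G = 1 * w G := (one_mul _).symm
        _ ≤ _ := mul_le_mul_of_nonneg_right h1 (hw0 G)
        _ = _ := by rw [hw, mul_pow]; ring
    · refine le_trans ?_ (le_add_of_nonneg_left t1)
      have h1 : 1 ≤ Real.exp (-(1.99 * n * Real.log 2)) * (2 : ℝ) ^ G.edgeSet.ncard := by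
        have e2 : (2 : ℝ) ^ G.edgeSet.ncard = Real.exp (G.edgeSet.ncard * Real.log 2) := by
          rw [Real.exp_nat_mul, Real.exp_log (by norm_num)]
        rw [e2, ← Real.exp_add]
        apply Real.one_le_exp
        have := mul_le_mul_of_nonneg_right he (Real.log_nonneg (show (1 : ℝ) ≤ 2 by norm_num))
        linarith
      have h2 := Finset.single_le_sum (fun σ (_ : σ ∈ Finset.univ) => t2 σ)
        (Finset.mem_univ (f : Fin n → Fin 5))
      have h3 : G.edgeSet ⊆ (((cycleGraph 5).comap f).edgeFinset : Set (Sym2 (Fin n))) := by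
        rw [SimpleGraph.coe_edgeFinset]
        apply SimpleGraph.edgeSet_mono
        intro u v huv
        exact f.map_adj huv
      simp only [if_pos h3] at h2
      refine le_trans ?_ (mul_le_mul_of_nonneg_left h2 (Real.exp_pos _).le)
      calc w G = 1 * w G := (one_mul _).symm
        _ ≤ _ := mul_le_mul_of_nonneg_right h1 (hw0 G)
        _ = _ := by rw [hw, mul_pow]; ring
  have hL : 1 - erProb n p (fun G => IsEmpty (G →g cycleGraph 5)) =
      ∑ G, (w G - (if IsEmpty (G →g cycleGraph 5) then w G else 0)) := by
    rw [Finset.sum_sub_distrib, hone]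
    rfl
  rw [hL]
  refine (Finset.sum_le_sum fun G _ => hpt G).trans ?_
  rw [Finset.sum_add_distrib, ← Finset.mul_sum, ← Finset.mul_sum, htot, Finset.sum_comm]
  refine add_le_add (mul_le_mul_of_nonneg_left ?_ (Real.exp_pos _).le)
    (mul_le_mul_of_nonneg_left ?_ (Real.exp_pos _).le)
  · have h1 : 499 / 500 * p + (1 - p) ≤ Real.exp (-(p / 500)) := by
      have := Real.add_one_le_exp (-(p / 500)); linarith
    refine (pow_le_pow_left₀ (by positivity) h1 _).trans ?_
    rw [← Real.exp_nat_mul, Real.exp_le_exp]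
    linarith
  · refine le_trans ?_ (mul_le_mul_of_nonneg_left (sum_exp_bound (by omega)) (Real.exp_pos _).le)
    rw [Finset.mul_sum]
    refine Finset.sum_le_sum fun σ _ => ?_
    have hsub : ((cycleGraph 5).comap σ).edgeFinset ⊆ (⊤ : SimpleGraph (Fin n)).edgeFinset :=
      SimpleGraph.edgeFinset_mono le_top
    rw [sum_graphs n _ hsub]
    have hc := card_allowed σ
    have hcN : ((cycleGraph 5).comap σ).edgeFinset.card ≤ n.choose 2 :=
      hcard ▸ Finset.card_le_card hsub
    set s := ((cycleGraph 5).comap σ).edgeFinset.card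
    have a1 : 2 * p + (1 - p) ≤ Real.exp p := by
      have := Real.add_one_le_exp p; linarith
    have a2 : 1 - p ≤ Real.exp (-p) := by
      have := Real.add_one_le_exp (-p); linarith
    refine (mul_le_mul (pow_le_pow_left₀ (by positivity) a1 _) (pow_le_pow_left₀ hp1 a2 _)
      (by positivity) (by positivity)).trans ?_
    rw [← Real.exp_nat_mul, ← Real.exp_nat_mul, ← Real.exp_add, ← Real.exp_add, Real.exp_le_exp,
      Nat.cast_sub hcN]
    have hc' : (s : ℝ) ≤ ((∑ i, cnt σ i * cnt σ (i + 1) : ℕ) : ℝ) := by exact_mod_cast hc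
    have h8 : (8 : ℝ) / n = 2 * p := by rw [hp]; ring
    rw [h8]
    have := mul_le_mul_of_nonneg_left hc' hp0
    nlinarith

lemma erProb_le_one {n : ℕ} (hn : 4 ≤ n) (P : SimpleGraph (Fin n) → Prop) :
    erProb n (4 / n) P ≤ 1 := by
  classical
  have hn4 : (4 : ℝ) ≤ n := by exact_mod_cast hn
  have hn' : (0 : ℝ) < n := by linarith
  have hp1 : 0 ≤ 1 - 4 / (n : ℝ) := by
    rw [sub_nonneg, div_le_one hn']; exact hn4
  have h := sum_graphs n _ (subset_refl _) (4 / (n : ℝ)) (1 - 4 / n)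
  have htopsub : ∀ G : SimpleGraph (Fin n), G.edgeSet ⊆
      ((⊤ : SimpleGraph (Fin n)).edgeFinset : Set (Sym2 (Fin n))) := by
    intro G
    rw [SimpleGraph.coe_edgeFinset]
    exact SimpleGraph.edgeSet_mono le_top
  have hcard : (⊤ : SimpleGraph (Fin n)).edgeFinset.card = n.choose 2 := by
    have h := SimpleGraph.card_edgeFinset_top_eq_card_choose_two (V := Fin n)
    rw [Fintype.card_fin] at h
    convert h
  simp only [htopsub, if_true] at h
  rw [hcard] at h
  simp only [add_sub_cancel, one_pow, Nat.sub_self, pow_zero, mul_one] at h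
  rw [← h]
  unfold erProb
  refine Finset.sum_le_sum fun G _ => ?_
  split_ifs
  · exact le_rfl
  · positivity

lemma bound_tendsto : Tendsto (fun n : ℕ =>
      Real.exp (1.99 * n / 499) * Real.exp (-(2 * (n - 1)) / 500) +
      Real.exp (-(1.99 * n * Real.log 2)) * (Real.exp (-(2 * (n - 1))) *
        (Real.exp (3.365 * n) * ((n : ℝ) + 1) ^ 5))) atTop (nhds 0) := by
  have hb : 0 < 1.99 * Real.log 2 + 2 - 3.365 := by
    have := Real.log_two_gt_d9
    norm_num at this ⊢
    linarith
  have h1 : Tendsto (fun n : ℕ => Real.exp (2 / 500) *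
      Real.exp (-((2 / 500 - 1.99 / 499) * (n : ℝ)))) atTop (nhds 0) := by
    rw [← mul_zero (Real.exp (2 / 500))]
    refine Tendsto.const_mul _ (Real.tendsto_exp_neg_atTop_nhds_zero.comp ?_)
    exact Tendsto.const_mul_atTop (by norm_num) tendsto_natCast_atTop_atTop
  have h2 : Tendsto (fun n : ℕ => (Real.exp 2 * Real.exp (1.99 * Real.log 2 + 2 - 3.365)) *
      (((n : ℝ) + 1) ^ 5 * Real.exp (-(1.99 * Real.log 2 + 2 - 3.365) * ((n : ℝ) + 1))))
      atTop (nhds 0) := by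
    rw [← mul_zero (Real.exp 2 * Real.exp (1.99 * Real.log 2 + 2 - 3.365))]
    refine Tendsto.const_mul _ ?_
    have h := tendsto_rpow_mul_exp_neg_mul_atTop_nhds_zero 5 _ hb
    have h' := h.comp (tendsto_atTop_add_const_right atTop (1 : ℝ)
      (tendsto_natCast_atTop_atTop (R := ℝ)))
    refine h'.congr fun n => ?_
    simp only [Function.comp]
    norm_cast
  have h3 := h1.add h2
  rw [add_zero] at h3
  refine h3.congr fun n => ?_
  congr 1
  · rw [← Real.exp_add, ← Real.exp_add]; congr 1; ring
  · rw [← Real.exp_add]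
    rw [mul_left_comm, ← Real.exp_add, ← mul_assoc, ← mul_assoc, ← Real.exp_add, mul_comm,
      ← Real.exp_add]
    congr 2
    ring

/-- W.h.p. the random graph `G_{n,4/n}` admits no homomorphism to the cycle `C_5`. -/
theorem statement2 :
    Tendsto
      (fun n : ℕ => erProb n (4 / n) (fun G => IsEmpty (G →g cycleGraph 5)))
      atTop (nhds 1) := by
  have h := bound_tendsto.const_sub 1
  rw [sub_zero] at h
  refine tendsto_of_tendsto_of_tendsto_of_le_of_le' h tendsto_const_nhds ?_ ?_
  · filter_upwards [eventually_ge_atTop 4] with n hn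
    have := erProb_bound hn
    linarith
  · filter_upwards [eventually_ge_atTop 4] with n hn
    exact erProb_le_one hn _
end

section
/- Let 0 < α < 1/10 and let c be a positive constant with c < exp((1−6α)/(3α)). Then with high probability as n → ∞, any two cycles of length less than α·log n in G_{n,c/n} are at graph distance more than α·log n from each other. -/
open Filter SimpleGraph

open scoped Classical in
lemma er_contains (n : ℕ) (p : ℝ) (F : Finset (Sym2 (Fin n))) (hF : ∀ e ∈ F, ¬ e.IsDiag) :
    erProb n p (fun G => (F : Set (Sym2 (Fin n))) ⊆ G.edgeSet) = p ^ F.card := by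
  unfold erProb
  rw [← Finset.sum_filter]
  set E : Finset (Sym2 (Fin n)) := (⊤ : SimpleGraph (Fin n)).edgeFinset with hE
  have hEc : E.card = n.choose 2 := by
    rw [hE, card_edgeFinset_top_eq_card_choose_two, Fintype.card_fin]
  have memE : ∀ e, e ∈ E ↔ ¬ e.IsDiag := by
    intro e; simp [hE]
  have hFE : F ⊆ E := fun e he => (memE e).2 (hF e he)
  have key : ∑ G : SimpleGraph (Fin n) with (F : Set (Sym2 (Fin n))) ⊆ G.edgeSet,
      p ^ G.edgeSet.ncard * (1 - p) ^ (n.choose 2 - G.edgeSet.ncard)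
      = ∑ t ∈ (E \ F).powerset, p ^ F.card * (p ^ t.card * (1 - p) ^ ((E \ F).card - t.card)) := by
    refine Finset.sum_nbij' (fun G => G.edgeFinset \ F)
      (fun t => fromEdgeSet ((F ∪ t : Finset (Sym2 (Fin n))) : Set (Sym2 (Fin n)))) ?_ ?_ ?_ ?_ ?_
    · intro G hG
      rw [Finset.mem_powerset]
      apply Finset.sdiff_subset_sdiff _ (Finset.Subset.refl _)
      intro e he
      rw [mem_edgeFinset] at he
      exact (memE e).2 (G.not_isDiag_of_mem_edgeSet he)
    · intro t ht
      rw [Finset.mem_powerset] at ht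
      simp only [Finset.mem_filter, Finset.mem_univ, true_and, edgeSet_fromEdgeSet]
      intro e he
      refine ⟨by simp; exact Or.inl he, ?_⟩
      exact hF e he
    · intro G hG
      simp only [Finset.mem_filter, Finset.mem_univ, true_and] at hG
      have : ((F ∪ (G.edgeFinset \ F) : Finset (Sym2 (Fin n))) : Set (Sym2 (Fin n))) = G.edgeSet := by
        rw [Finset.union_sdiff_of_subset]
        · simp
        · intro e he
          rw [mem_edgeFinset]; exact hG he
      show fromEdgeSet _ = G
      rw [this, fromEdgeSet_edgeSet]
    · intro t ht
      rw [Finset.mem_powerset] at ht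
      ext e
      simp only [Finset.mem_sdiff, mem_edgeFinset, edgeSet_fromEdgeSet]
      constructor
      · rintro ⟨⟨h1, h2⟩, h3⟩
        simp at h1
        tauto
      · intro he
        have := Finset.mem_sdiff.1 (ht he)
        refine ⟨⟨by simp [he], ?_⟩, this.2⟩
        exact (memE e).1 this.1
    · intro G hG
      simp only [Finset.mem_filter, Finset.mem_univ, true_and] at hG
      have hFG : F ⊆ G.edgeFinset := by
        intro e he
        rw [mem_edgeFinset]; exact hG he
      have h1 : G.edgeSet.ncard = G.edgeFinset.card := by
        rw [← coe_edgeFinset, Set.ncard_coe_finset]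
      have h2 := Finset.card_sdiff_add_card_eq_card hFG
      have h3 := Finset.card_sdiff_add_card_eq_card hFE
      have h4 : n.choose 2 - G.edgeSet.ncard = (E \ F).card - (G.edgeFinset \ F).card := by
        omega
      rw [h4, ← mul_assoc, ← pow_add, h1, ← h2, add_comm]
  rw [key, ← Finset.mul_sum, Finset.sum_pow_mul_eq_add_pow]
  simp

open scoped Classical in
lemma er_union {ι : Type*} (n : ℕ) (p : ℝ) (hp0 : 0 ≤ p) (hp1 : p ≤ 1)
    (P : SimpleGraph (Fin n) → Prop) (I : Finset ι) (F : ι → Finset (Sym2 (Fin n)))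
    (hF : ∀ i ∈ I, ∀ e ∈ F i, ¬ e.IsDiag)
    (h : ∀ G, ¬ P G → ∃ i ∈ I, (F i : Set (Sym2 (Fin n))) ⊆ G.edgeSet) :
    1 - ∑ i ∈ I, p ^ (F i).card ≤ erProb n p P ∧ erProb n p P ≤ 1 := by
  have h1 : erProb n p (fun _ => True) = 1 := by
    have := er_contains n p ∅ (by simp)
    simpa using this
  have hw : ∀ G : SimpleGraph (Fin n),
      0 ≤ p ^ G.edgeSet.ncard * (1 - p) ^ (n.choose 2 - G.edgeSet.ncard) := fun G =>
    mul_nonneg (pow_nonneg hp0 _) (pow_nonneg (by linarith) _)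
  constructor
  · have h2 : ∑ i ∈ I, p ^ (F i).card
        = ∑ i ∈ I, erProb n p (fun G => (F i : Set (Sym2 (Fin n))) ⊆ G.edgeSet) :=
      Finset.sum_congr rfl fun i hi => (er_contains n p _ (hF i hi)).symm
    rw [h2, ← h1, sub_le_iff_le_add]
    unfold erProb
    rw [Finset.sum_comm, ← Finset.sum_add_distrib]
    refine Finset.sum_le_sum fun G _ => ?_
    by_cases hG : P G
    · simp only [hG, if_true]
      refine le_add_of_nonneg_right (Finset.sum_nonneg fun i _ => ?_)
      split_ifs
      · exact hw G
      · exact le_rfl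
    · obtain ⟨i, hi, hiG⟩ := h G hG
      simp only [hG, if_true, if_false, zero_add]
      refine le_trans (le_of_eq ?_) (Finset.single_le_sum (f := fun i => 
        if (F i : Set (Sym2 (Fin n))) ⊆ G.edgeSet then
          p ^ G.edgeSet.ncard * (1 - p) ^ (n.choose 2 - G.edgeSet.ncard) else 0)
          (fun j _ => ?_) hi)
      · simp [hiG]
      · split_ifs
        · exact hw G
        · exact le_rfl
  · rw [← h1]
    unfold erProb
    refine Finset.sum_le_sum fun G _ => ?_
    simp only [if_true]
    split_ifs
    · exact le_rfl
    · exact hw G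

lemma count_bound (n k m : ℕ) (c : ℝ) (hc : 0 < c) (hn : 0 < n) (hm : m ≤ k ^ 2) :
    (n.choose k : ℝ) * (m.choose (k + 1) : ℝ) * (c / n) ^ (k + 1)
      ≤ (Real.exp 2 * c) ^ k * (c * (k : ℝ) ^ 2 / n) := by
  have hn' : (0 : ℝ) < n := by exact_mod_cast hn
  have hk : (0 : ℝ) < (k.factorial : ℝ) := by exact_mod_cast k.factorial_pos
  have h1 : (n.choose k : ℝ) ≤ (n : ℝ) ^ k / k.factorial := Nat.choose_le_pow_div k n
  have h2 : (m.choose (k + 1) : ℝ) ≤ ((k : ℝ) ^ 2) ^ (k + 1) / k.factorial := by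
    refine (Nat.choose_le_pow_div (k + 1) m).trans ?_
    have : (m : ℝ) ≤ (k : ℝ) ^ 2 := by exact_mod_cast hm
    have h3 : (k.factorial : ℝ) ≤ ((k + 1).factorial : ℝ) := by
      exact_mod_cast Nat.factorial_le (Nat.le_succ k)
    gcongr
  have h3 : (k : ℝ) ^ k / k.factorial ≤ Real.exp k := Real.pow_div_factorial_le_exp (k : ℝ) (by positivity) k
  calc (n.choose k : ℝ) * (m.choose (k + 1) : ℝ) * (c / n) ^ (k + 1)
      ≤ ((n : ℝ) ^ k / k.factorial) * (((k : ℝ) ^ 2) ^ (k + 1) / k.factorial) * (c / n) ^ (k + 1) := by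
        gcongr
    _ = ((k : ℝ) ^ k / k.factorial) ^ 2 * (c ^ k * (c * (k : ℝ) ^ 2 / n)) := by
        rw [div_pow c]
        field_simp
        ring
    _ ≤ (Real.exp k) ^ 2 * (c ^ k * (c * (k : ℝ) ^ 2 / n)) := by gcongr
    _ = (Real.exp 2 * c) ^ k * (c * (k : ℝ) ^ 2 / n) := by
        have : (Real.exp k) ^ 2 = (Real.exp 2) ^ k := by
          rw [← Real.exp_nat_mul, ← Real.exp_nat_mul]; congr 1; push_cast; ring
        rw [this, mul_pow]; ring

lemma analytic_s3 (α c : ℝ) (hα0 : 0 < α) (hc0 : 0 < c)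
    (hc : c < Real.exp ((1 - 6 * α) / (3 * α))) :
    Tendsto (fun n : ℕ => ∑ k ∈ Finset.range (⌊3 * α * Real.log n⌋₊ + 1),
      (Real.exp 2 * c) ^ k * (c * (k : ℝ) ^ 2 / n)) atTop (nhds 0) := by
  set B : ℝ := max 1 (Real.exp 2 * c) with hB
  have hB1 : 1 ≤ B := le_max_left _ _
  have hBpos : 0 < B := by linarith
  have hβ : 3 * α * Real.log B < 1 := by
    have h0 : Real.exp 2 * c < Real.exp (1 / (3 * α)) := by
      have : Real.exp (1 / (3 * α)) = Real.exp 2 * Real.exp ((1 - 6 * α) / (3 * α)) := by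
        rw [← Real.exp_add]; congr 1; field_simp; ring
      rw [this]; gcongr
    have h1 : B < Real.exp (1 / (3 * α)) := by
      refine max_lt ?_ h0
      rw [Real.one_lt_exp_iff]; positivity
    have h2 := (Real.log_lt_iff_lt_exp hBpos).2 h1
    rw [lt_div_iff₀ (by positivity)] at h2
    linarith
  set β := 3 * α * Real.log B with hβd
  have lim : Tendsto (fun x : ℝ => c * (3 * α + 1) ^ 3 * (Real.log x ^ (3 : ℝ) / x ^ (1 - β)))
      atTop (nhds 0) := by
    have := (isLittleO_log_rpow_rpow_atTop (s := 1 - β) 3 (by linarith)).tendsto_div_nhds_zero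
    simpa using this.const_mul (c * (3 * α + 1) ^ 3)
  have lim' := lim.comp (tendsto_natCast_atTop_atTop (R := ℝ))
  refine squeeze_zero' (Eventually.of_forall fun n => ?_) ?_ lim'
  · exact Finset.sum_nonneg fun k _ => by positivity
  have hlog : ∀ᶠ n : ℕ in atTop, 1 ≤ Real.log n :=
    (Real.tendsto_log_atTop.comp tendsto_natCast_atTop_atTop).eventually_ge_atTop 1
  filter_upwards [hlog, eventually_gt_atTop 0] with n hl hn
  have hn' : (0 : ℝ) < n := by exact_mod_cast hn
  set L := Real.log n with hL
  have hfl : (⌊3 * α * L⌋₊ : ℝ) ≤ 3 * α * L := Nat.floor_le (by positivity)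
  have term : ∀ k ∈ Finset.range (⌊3 * α * L⌋₊ + 1),
      (Real.exp 2 * c) ^ k * (c * (k : ℝ) ^ 2 / n) ≤ (n : ℝ) ^ β * (c * ((3 * α + 1) * L) ^ 2 / n) := by
    intro k hk
    have hk1 : k ≤ ⌊3 * α * L⌋₊ := by simpa [Nat.lt_succ_iff] using hk
    have hk2 : (k : ℝ) ≤ 3 * α * L := le_trans (by exact_mod_cast hk1) hfl
    have e1 : (Real.exp 2 * c) ^ k ≤ (n : ℝ) ^ β := by
      calc (Real.exp 2 * c) ^ k ≤ B ^ k := by gcongr; exact le_max_right _ _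
        _ = B ^ (k : ℝ) := (Real.rpow_natCast _ _).symm
        _ ≤ B ^ (3 * α * L) := Real.rpow_le_rpow_of_exponent_le hB1 hk2
        _ = (n : ℝ) ^ β := by
          rw [Real.rpow_def_of_pos hBpos, Real.rpow_def_of_pos hn', hβd]; congr 1; ring
    have e2 : (k : ℝ) ≤ (3 * α + 1) * L := by linarith
    gcongr
  refine (Finset.sum_le_card_nsmul _ _ _ term).trans ?_
  rw [Finset.card_range, nsmul_eq_mul]
  push_cast
  have e3 : (⌊3 * α * L⌋₊ : ℝ) + 1 ≤ (3 * α + 1) * L := by linarith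
  calc ((⌊3 * α * L⌋₊ : ℝ) + 1) * ((n : ℝ) ^ β * (c * ((3 * α + 1) * L) ^ 2 / n))
      ≤ ((3 * α + 1) * L) * ((n : ℝ) ^ β * (c * ((3 * α + 1) * L) ^ 2 / n)) := by gcongr
    _ = c * (3 * α + 1) ^ 3 * (L ^ (3 : ℝ) / (n : ℝ) ^ (1 - β)) := by
      rw [Real.rpow_sub hn', Real.rpow_one]
      have : L ^ (3 : ℝ) = L ^ 3 := by exact_mod_cast Real.rpow_natCast L 3
      rw [this]
      have := Real.rpow_pos_of_pos hn' β
      field_simp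


lemma two_cycles {V : Type*} [Finite V] (H : SimpleGraph V) (hH : H.Connected) {u v : V}
    (c₁ : H.Walk u u) (c₂ : H.Walk v v) (h₁ : c₁.IsCycle) (h₂ : c₂.IsCycle) (e : Sym2 V)
    (he₁ : e ∈ c₁.edges) (he₂ : e ∉ c₂.edges) :
    Nat.card V + 1 ≤ H.edgeSet.ncard := by
  have hb : ¬ H.IsBridge e := fun h => h.notMem_edges_of_isCycle h₁ he₁
  have hc2 : ∀ e' ∈ c₂.edges, e' ∉ ({e} : Set (Sym2 V)) := by
    intro e' he' h
    rw [Set.mem_singleton_iff] at h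
    exact he₂ (h ▸ he')
  have hcyc := Walk.IsCycle.toDeleteEdges H ({e} : Set (Sym2 V)) h₂ hc2
  have hcon : (H.deleteEdges {e}).Connected := by
    induction e with
    | h x y => exact hH.connected_delete_edge_of_not_isBridge hb
  have heH : e ∈ H.edgeSet := c₁.edges_subset_edgeSet he₁
  obtain ⟨f, hf⟩ : ∃ f, f ∈ (c₂.toDeleteEdges {e} hc2).edges := by
    refine List.exists_mem_of_ne_nil _ ?_
    intro h
    have := congrArg List.length h
    rw [Walk.length_edges] at this
    have h3 := hcyc.three_le_length
    rw [List.length_nil] at this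
    omega
  have hb' : ¬ (H.deleteEdges {e}).IsBridge f := fun h => h.notMem_edges_of_isCycle hcyc hf
  have hfH : f ∈ (H.deleteEdges {e}).edgeSet := Walk.edges_subset_edgeSet _ hf
  have hcon' : ((H.deleteEdges {e}).deleteEdges {f}).Connected := by
    induction f with
    | h x y => exact hcon.connected_delete_edge_of_not_isBridge hb'
  have key := hcon'.card_vert_le_card_edgeSet_add_one
  rw [Nat.card_coe_set_eq, edgeSet_deleteEdges] at key
  have a1 := Set.ncard_sdiff_singleton_add_one hfH
  have a2 := Set.ncard_sdiff_singleton_add_one heH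
  rw [edgeSet_deleteEdges] at a1 key
  omega

lemma tail_mem {n : ℕ} {G : SimpleGraph (Fin n)} {u : Fin n} (c : G.Walk u u) (h : c.IsCycle) :
    ∀ x, x ∈ c.support → x ∈ c.support.tail := by
  intro x hx
  rcases Walk.mem_support_iff c |>.1 hx with rfl | h'
  · exact c.end_mem_tail_support h.not_nil
  · exact h'

lemma det_lemma {n : ℕ} (G : SimpleGraph (Fin n)) {u v x y : Fin n}
    (c₁ : G.Walk u u) (c₂ : G.Walk v v) (h₁ : c₁.IsCycle) (h₂ : c₂.IsCycle)
    (hne : c₁.edges.toFinset ≠ c₂.edges.toFinset) (hx : x ∈ c₁.support) (hy : y ∈ c₂.support)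
    (w : G.Walk x y) :
    ∃ S : Finset (Fin n), S.card ≤ c₁.length + c₂.length + w.length ∧
      ∃ F ∈ Finset.powersetCard (S.card + 1) (S.sym2.filter (fun e => ¬ e.IsDiag)),
        (F : Set (Sym2 (Fin n))) ⊆ G.edgeSet := by
  classical
  set S : Finset (Fin n) :=
    c₁.support.tail.toFinset ∪ c₂.support.tail.toFinset ∪ w.support.tail.toFinset with hS
  have hcard : S.card ≤ c₁.length + c₂.length + w.length := by
    have t : ∀ {a b : Fin n} (p : G.Walk a b), p.support.tail.toFinset.card ≤ p.length := by
      intro a b p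
      refine (List.toFinset_card_le _).trans ?_
      simp
    calc S.card ≤ _ := Finset.card_union_le _ _
      _ ≤ _ := Nat.add_le_add_right (Finset.card_union_le _ _) _
      _ ≤ _ := by
        have := t c₁; have := t c₂; have := t w; omega
  have hS1 : ∀ z ∈ c₁.support, z ∈ (S : Set (Fin n)) := by
    intro z hz
    have := tail_mem c₁ h₁ z hz
    simp [hS, this]
  have hS2 : ∀ z ∈ c₂.support, z ∈ (S : Set (Fin n)) := by
    intro z hz
    have := tail_mem c₂ h₂ z hz
    simp [hS, this]
  have hS3 : ∀ z ∈ w.support, z ∈ (S : Set (Fin n)) := by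
    intro z hz
    rcases Walk.mem_support_iff w |>.1 hz with rfl | h'
    · exact hS1 _ hx
    · simp [hS, h']
  have hSeq : (S : Set (Fin n)) =
      ({z | z ∈ c₁.support} ∪ {z | z ∈ w.support}) ∪ {z | z ∈ c₂.support} := by
    apply Set.Subset.antisymm
    · intro z hz
      simp only [hS, Finset.coe_union, List.coe_toFinset, Set.mem_union, Set.mem_ofPred_eq] at hz ⊢
      rcases hz with (h | h) | h
      · exact Or.inl (Or.inl (List.mem_of_mem_tail h))
      · exact Or.inr (List.mem_of_mem_tail h)
      · exact Or.inl (Or.inr (List.mem_of_mem_tail h))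
    · rintro z ((h | h) | h)
      · exact hS1 z h
      · exact hS3 z h
      · exact hS2 z h
  have hcon : (G.induce (S : Set (Fin n))).Connected := by
    rw [hSeq]
    refine induce_union_connected (induce_union_connected
      c₁.connected_induce_support.preconnected w.connected_induce_support.preconnected
      ⟨x, hx, w.start_mem_support⟩).preconnected c₂.connected_induce_support.preconnected
      ⟨y, Or.inr w.end_mem_support, hy⟩
  set H := G.induce (S : Set (Fin n)) with hH
  have inj : Function.Injective (Embedding.induce (G := G) (S : Set (Fin n))).toHom :=
    (Embedding.induce (G := G) (S : Set (Fin n))).injective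
  set d₁ := c₁.induce (S : Set (Fin n)) hS1 with hd₁
  set d₂ := c₂.induce (S : Set (Fin n)) hS2 with hd₂
  have m1 : d₁.map (Embedding.induce (S : Set (Fin n))).toHom = c₁ := Walk.map_induce _ _
  have m2 : d₂.map (Embedding.induce (S : Set (Fin n))).toHom = c₂ := Walk.map_induce _ _
  have cy1 : d₁.IsCycle := by
    rw [← Walk.isCycle_map_iff_of_injective inj, m1]; exact h₁
  have cy2 : d₂.IsCycle := by
    rw [← Walk.isCycle_map_iff_of_injective inj, m2]; exact h₂
  have hne' : d₁.edges.toFinset ≠ d₂.edges.toFinset := by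
    intro h
    apply hne
    have e1 := congrArg Walk.edges m1
    have e2 := congrArg Walk.edges m2
    rw [Walk.edges_map] at e1 e2
    have e1' : c₁.edges = d₁.edges.map (Sym2.map Subtype.val) := e1.symm
    have e2' : c₂.edges = d₂.edges.map (Sym2.map Subtype.val) := e2.symm
    rw [e1', e2']
    ext e
    have h' : ∀ e, e ∈ d₁.edges ↔ e ∈ d₂.edges := by
      intro e
      have := congrArg (e ∈ ·) h
      simpa using this
    simp only [List.mem_toFinset, List.mem_map, h']
  have hE : Nat.card (S : Set (Fin n)) + 1 ≤ H.edgeSet.ncard := by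
    by_contra hcon'
    apply hne'
    ext e
    simp only [List.mem_toFinset]
    constructor
    · intro he; by_contra he'
      exact hcon' (two_cycles H hcon d₁ d₂ cy1 cy2 e he he')
    · intro he; by_contra he'
      exact hcon' (two_cycles H hcon d₂ d₁ cy2 cy1 e he he')
  have hSc : Nat.card (S : Set (Fin n)) = S.card := by simp
  rw [hSc] at hE
  refine ⟨S, hcard, ?_⟩
  have hE' : S.card + 1 ≤ (H.edgeFinset.image (Sym2.map Subtype.val)).card := by
    rw [Finset.card_image_of_injective _ (Sym2.map.injective Subtype.val_injective)]
    rwa [← Set.ncard_coe_finset H.edgeFinset, coe_edgeFinset]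
  obtain ⟨F, hF, hFc⟩ := Finset.exists_subset_card_eq hE'
  have hFG : ∀ e ∈ F, e ∈ G.edgeSet ∧ e ∈ S.sym2 := by
    intro e he
    obtain ⟨e', he', rfl⟩ := Finset.mem_image.1 (hF he)
    rw [mem_edgeFinset] at he'
    induction e' with
    | h a b =>
      refine ⟨by simpa [hH] using he', ?_⟩
      simp only [Sym2.map_mk, Finset.mk_mem_sym2_iff]
      exact ⟨a.2, b.2⟩
  refine ⟨F, ?_, fun e he => (hFG e he).1⟩
  rw [Finset.mem_powersetCard]
  refine ⟨fun e he => ?_, hFc⟩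
  rw [Finset.mem_filter]
  exact ⟨(hFG e he).2, G.not_isDiag_of_mem_edgeSet (hFG e he).1⟩

lemma sum_bound (n K : ℕ) (c : ℝ) (hc : 0 < c) (hn : 0 < n) :
    ∑ i ∈ ((Finset.range (K + 1)).sigma
        (fun k => Finset.powersetCard k (Finset.univ : Finset (Fin n)))).sigma
        (fun a => Finset.powersetCard (a.1 + 1) (a.2.sym2.filter (fun e => ¬ e.IsDiag))),
      (c / n : ℝ) ^ (i.2.card)
    ≤ ∑ k ∈ Finset.range (K + 1), (Real.exp 2 * c) ^ k * (c * (k : ℝ) ^ 2 / n) := by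
  rw [Finset.sum_sigma, Finset.sum_sigma]
  refine Finset.sum_le_sum fun k _ => ?_
  have hm : (k + 1).choose 2 ≤ k ^ 2 := by
    rw [Nat.choose_two_right, Nat.add_sub_cancel]
    apply Nat.div_le_of_le_mul
    rcases k with _ | k
    · simp
    · nlinarith
  refine le_trans ?_ (count_bound n k _ c hc hn hm)
  have hin : ∀ S ∈ Finset.powersetCard k (Finset.univ : Finset (Fin n)),
      ∑ F ∈ Finset.powersetCard (k + 1) (S.sym2.filter (fun e => ¬ e.IsDiag)),
        (c / n : ℝ) ^ F.card ≤ (((k + 1).choose 2).choose (k + 1) : ℝ) * (c / n) ^ (k + 1) := by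
    intro S hS
    have hSk : S.card = k := (Finset.mem_powersetCard.1 hS).2
    rw [Finset.sum_congr rfl (g := fun _ => (c / n : ℝ) ^ (k + 1))
      (fun F hF => by rw [(Finset.mem_powersetCard.1 hF).2])]
    rw [Finset.sum_const, nsmul_eq_mul, Finset.card_powersetCard]
    have h1 : (S.sym2.filter (fun e => ¬ e.IsDiag)).card ≤ (k + 1).choose 2 := by
      refine (Finset.card_filter_le _ _).trans ?_
      rw [Finset.card_sym2, hSk]
    gcongr
  refine (Finset.sum_le_card_nsmul _ _ _ hin).trans (le_of_eq ?_)
  rw [nsmul_eq_mul, Finset.card_powersetCard, Finset.card_univ, Fintype.card_fin, mul_assoc]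

/-- If `0 < α < 1/10` and `0 < c < exp((1-6α)/(3α))`, then w.h.p. any two (distinct) cycles of
length less than `α log n` in `G_{n,c/n}` are at graph distance more than `α log n`:
every walk joining a vertex of one to a vertex of the other has length more than `α log n`. -/
theorem statement3 (α c : ℝ) (hα0 : 0 < α) (hα : α < 1 / 10) (hc0 : 0 < c)
    (hc : c < Real.exp ((1 - 6 * α) / (3 * α))) :
    Tendsto
      (fun n : ℕ => erProb n (c / n) (fun G =>
        ∀ (u v : Fin n) (w₁ : G.Walk u u) (w₂ : G.Walk v v),
          w₁.IsCycle → w₂.IsCycle →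
          (w₁.length : ℝ) < α * Real.log n → (w₂.length : ℝ) < α * Real.log n →
          w₁.edges.toFinset ≠ w₂.edges.toFinset →
          ∀ x ∈ w₁.support, ∀ y ∈ w₂.support,
            ∀ w : G.Walk x y, α * Real.log n < (w.length : ℝ)))
      atTop (nhds 1) := by
  have hA := analytic_s3 α c hα0 hc0 hc
  have hlow := hA.const_sub 1
  rw [sub_zero] at hlow
  have hev : ∀ᶠ n : ℕ in atTop, c ≤ (n : ℝ) ∧ 0 < n := by
    filter_upwards [(tendsto_natCast_atTop_atTop (R := ℝ)).eventually_ge_atTop c,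
      eventually_gt_atTop 0] with n h1 h2
    exact ⟨h1, h2⟩
  have main : ∀ n : ℕ, c ≤ (n : ℝ) → 0 < n → ∀ P : SimpleGraph (Fin n) → Prop,
      (∀ G, ¬ P G → ∃ S : Finset (Fin n), S.card ≤ ⌊3 * α * Real.log n⌋₊ ∧
        ∃ F ∈ Finset.powersetCard (S.card + 1) (S.sym2.filter (fun e => ¬ e.IsDiag)),
          (F : Set (Sym2 (Fin n))) ⊆ G.edgeSet) →
      1 - ∑ k ∈ Finset.range (⌊3 * α * Real.log n⌋₊ + 1),
        (Real.exp 2 * c) ^ k * (c * (k : ℝ) ^ 2 / n) ≤ erProb n (c / n) P ∧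
        erProb n (c / n) P ≤ 1 := by
    intro n hcn hn P hP
    have hn' : (0 : ℝ) < n := by exact_mod_cast hn
    have hs := sum_bound n ⌊3 * α * Real.log n⌋₊ c hc0 hn
    have hu := er_union n (c / n) (by positivity) ((div_le_one hn').2 hcn) P
      (((Finset.range (⌊3 * α * Real.log n⌋₊ + 1)).sigma
        (fun k => Finset.powersetCard k (Finset.univ : Finset (Fin n)))).sigma
        (fun a => Finset.powersetCard (a.1 + 1) (a.2.sym2.filter (fun e => ¬ e.IsDiag))))
      (fun i => i.2) ?_ ?_
    · exact ⟨by linarith [hu.1], hu.2⟩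
    · rintro ⟨⟨k, S⟩, F⟩ hi e he
      have h1 := (Finset.mem_sigma.1 hi).2
      have h2 := (Finset.mem_powersetCard.1 h1).1 he
      exact (Finset.mem_filter.1 h2).2
    · intro G hG
      obtain ⟨S, hS, F, hF, hFG⟩ := hP G hG
      refine ⟨⟨⟨S.card, S⟩, F⟩, ?_, hFG⟩
      refine Finset.mem_sigma.2 ⟨Finset.mem_sigma.2 ⟨?_, ?_⟩, hF⟩
      · exact Finset.mem_range.2 (Nat.lt_succ_of_le hS)
      · exact Finset.mem_powersetCard.2 ⟨Finset.subset_univ _, rfl⟩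
  have both : ∀ᶠ n : ℕ in atTop, _ := hev.mono fun n hn => main n hn.1 hn.2 (fun G =>
        ∀ (u v : Fin n) (w₁ : G.Walk u u) (w₂ : G.Walk v v),
          w₁.IsCycle → w₂.IsCycle →
          (w₁.length : ℝ) < α * Real.log n → (w₂.length : ℝ) < α * Real.log n →
          w₁.edges.toFinset ≠ w₂.edges.toFinset →
          ∀ x ∈ w₁.support, ∀ y ∈ w₂.support,
            ∀ w : G.Walk x y, α * Real.log n < (w.length : ℝ)) (by
      intro G hG
      push Not at hG
      obtain ⟨u, v, w₁, w₂, h₁, h₂, l₁, l₂, hne, x, hx, y, hy, w, hw⟩ := hG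
      obtain ⟨S, hS, hF⟩ := det_lemma G w₁ w₂ h₁ h₂ hne hx hy w
      refine ⟨S, Nat.le_floor ?_, hF⟩
      have : (S.card : ℝ) ≤ w₁.length + w₂.length + w.length := by exact_mod_cast hS
      linarith)
  exact tendsto_of_tendsto_of_tendsto_of_le_of_le' hlow tendsto_const_nhds
    (both.mono fun n h => h.1) (both.mono fun n h => h.2)
end

section
/- For any α > 0 and any positive integer k there exists ε_0 > 0 such that for all 0 < ε < ε_0, with high probability as n → ∞, the edge set of G = G_{n,(1+ε)/n} can be partitioned as F ∪ M, where F is a forest and the distance in F between any two edges of M is at least k. -/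
open Filter SimpleGraph

open scoped Classical in
/-- Number of neighbours of `v` inside `U`. -/
noncomputable def dg {V : Type*} (G : SimpleGraph V) (U : Finset V) (v : V) : ℕ :=
  (U.filter (fun u => G.Adj v u)).card

/-- Sets inducing minimum degree at least two. -/
def IsCoreSet {V : Type*} (G : SimpleGraph V) (U : Finset V) : Prop := ∀ v ∈ U, 2 ≤ dg G U v

/-- The 2-core. -/
def InCore {V : Type*} (G : SimpleGraph V) (v : V) : Prop := ∃ U : Finset V, v ∈ U ∧ IsCoreSet G U

section det
open scoped Classical

variable {V : Type*}

lemma dg_mono {G G' : SimpleGraph V} (h : G ≤ G') {U U' : Finset V} (hU : U ⊆ U') (v : V) :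
    dg G U v ≤ dg G' U' v := by
  unfold dg
  apply Finset.card_le_card
  intro u hu
  simp only [Finset.mem_filter] at hu ⊢
  exact ⟨hU hu.1, h hu.2⟩

lemma IsCoreSet.mono {G G' : SimpleGraph V} (h : G ≤ G') {U : Finset V} (hU : IsCoreSet G U) :
    IsCoreSet G' U := fun v hv => (hU v hv).trans (dg_mono h (Finset.Subset.refl _) v)

lemma InCore.mono {G G' : SimpleGraph V} (h : G ≤ G') {v : V} (hv : InCore G v) : InCore G' v := by
  obtain ⟨U, hU, hc⟩ := hv
  exact ⟨U, hU, hc.mono h⟩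

/-- The maximal core set. -/
noncomputable def coreF [Fintype V] (G : SimpleGraph V) : Finset V :=
  Finset.univ.filter (InCore G)

lemma mem_coreF [Fintype V] {G : SimpleGraph V} {v : V} : v ∈ coreF G ↔ InCore G v := by
  simp [coreF]

lemma coreF_isCoreSet [Fintype V] (G : SimpleGraph V) : IsCoreSet G (coreF G) := by
  intro v hv
  obtain ⟨U, hU, hc⟩ := mem_coreF.1 hv
  refine (hc v hU).trans (dg_mono le_rfl ?_ v)
  intro u hu
  exact mem_coreF.2 ⟨U, hu, hc⟩

lemma two_le_dg_of_subgraph {G : SimpleGraph V} {U : Finset V} {v : V} (H : G.Subgraph)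
    (hH : (H.neighborSet v).ncard = 2) (hsub : ∀ u ∈ H.verts, u ∈ U) : 2 ≤ dg G U v := by
  rw [← hH, dg, ← Set.ncard_coe_finset]
  apply Set.ncard_le_ncard _ (Finset.finite_toSet _)
  intro u hu
  simp only [Finset.coe_filter, Set.mem_ofPred_eq]
  exact ⟨hsub _ (H.edge_vert (Subgraph.Adj.symm hu)), H.adj_sub hu⟩

lemma acyclic_of_coreF_empty [Fintype V] {G : SimpleGraph V} (h : coreF G = ∅) : G.IsAcyclic := by
  intro v c hc
  have : v ∈ coreF G := by
    rw [mem_coreF]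
    refine ⟨c.support.toFinset, by simp, ?_⟩
    intro u hu
    refine two_le_dg_of_subgraph c.toSubgraph
      (hc.ncard_neighborSet_toSubgraph_eq_two (by simpa using hu)) ?_
    intro x hx
    simpa using hx
  simp [h] at this

lemma path_support_core [Fintype V] {G : SimpleGraph V} {a b : V} (p : G.Walk a b) (hp : p.IsPath)
    (ha : a ∈ coreF G) (hb : b ∈ coreF G) : ∀ v ∈ p.support, v ∈ coreF G := by
  intro v hv
  rw [mem_coreF]
  refine ⟨coreF G ∪ p.support.toFinset, by simp [hv], ?_⟩
  intro u hu
  by_cases huc : u ∈ coreF G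
  · exact (coreF_isCoreSet G u huc).trans (dg_mono le_rfl Finset.subset_union_left u)
  · have hus : u ∈ p.support := by simpa [huc] using hu
    obtain ⟨i, rfl, hi⟩ := Walk.mem_support_iff_exists_getVert.1 hus
    have h0 : i ≠ 0 := by
      rintro rfl
      simp [ha] at huc
    have h1 : i < p.length := by
      rcases hi.lt_or_eq with h | h
      · exact h
      · subst h
        simp [hb] at huc
    refine two_le_dg_of_subgraph p.toSubgraph
      (hp.ncard_neighborSet_toSubgraph_internal_eq_two h0 h1) ?_
    intro x hx
    simp at hx
    simp [hx]

/-- Next level. -/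
noncomputable def nextT (G : SimpleGraph V) (U N : Finset V) : Finset V :=
  U.filter (fun v => v ∉ N ∧ ∃ u ∈ N, G.Adj u v)

/-- Vertices of `U` within distance `j` from a branch vertex. -/
noncomputable def lev (G : SimpleGraph V) (U : Finset V) : ℕ → Finset V
  | 0 => U.filter (fun v => 3 ≤ dg G U v)
  | (j+1) => lev G U j ∪ nextT G U (lev G U j)

lemma lev_mono (G : SimpleGraph V) (U : Finset V) : Monotone (lev G U) :=
  monotone_nat_of_le_succ fun _ => Finset.subset_union_left

lemma lev_subset (G : SimpleGraph V) (U : Finset V) (j : ℕ) : lev G U j ⊆ U := by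
  induction j with
  | zero => exact Finset.filter_subset _ _
  | succ j ih => exact Finset.union_subset ih (Finset.filter_subset _ _)

lemma not_mem_lev_of_adj {G : SimpleGraph V} {U : Finset V} {j : ℕ} {a b : V} (ha : a ∈ U)
    (hN : a ∉ lev G U (j+1)) (hab : G.Adj a b) : b ∉ lev G U j := by
  intro hb
  apply hN
  simp only [lev, Finset.mem_union, nextT, Finset.mem_filter]
  by_cases h : a ∈ lev G U j
  · exact Or.inl h
  · exact Or.inr ⟨ha, h, b, hb, hab.symm⟩

lemma dg_le_two_of_not_mem {G : SimpleGraph V} {U : Finset V} {j : ℕ} {a : V} (ha : a ∈ U)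
    (hN : a ∉ lev G U j) : dg G U a ≤ 2 := by
  by_contra h
  apply hN
  apply lev_mono G U (Nat.zero_le j)
  simp only [lev, Finset.mem_filter]
  exact ⟨ha, by omega⟩

lemma nextT_zero_card (G : SimpleGraph V) (U : Finset V) :
    (nextT G U (lev G U 0)).card ≤ ∑ v ∈ lev G U 0, dg G U v := by
  calc (nextT G U (lev G U 0)).card
      ≤ ((lev G U 0).biUnion (fun v => U.filter (fun u => G.Adj v u))).card := by
        apply Finset.card_le_card
        intro v hv
        simp only [nextT, Finset.mem_filter] at hv
        obtain ⟨hvU, _, u, hu, huv⟩ := hv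
        simp only [Finset.mem_biUnion, Finset.mem_filter]
        exact ⟨u, hu, hvU, huv⟩
    _ ≤ _ := Finset.card_biUnion_le

lemma nextT_succ_card (G : SimpleGraph V) (U : Finset V) (j : ℕ) :
    (nextT G U (lev G U (j+1))).card ≤ (nextT G U (lev G U j)).card := by
  calc (nextT G U (lev G U (j+1))).card
      ≤ ((nextT G U (lev G U j)).biUnion
          (fun v => (U.filter (fun u => G.Adj v u)).filter (fun u => u ∉ lev G U (j+1)))).card := by
        apply Finset.card_le_card
        intro v hv
        simp only [nextT, Finset.mem_filter] at hv
        obtain ⟨hvU, hvN, u, hu, huv⟩ := hv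
        simp only [Finset.mem_biUnion, Finset.mem_filter]
        refine ⟨u, ?_, ⟨hvU, huv⟩, hvN⟩
        simp only [lev, Finset.mem_union] at hu
        rcases hu with hu | hu
        · exact absurd hu (not_mem_lev_of_adj hvU hvN huv.symm)
        · exact hu
    _ ≤ (nextT G U (lev G U j)).card * 1 := by
        apply Finset.card_biUnion_le_card_mul
        intro v hv
        simp only [nextT, Finset.mem_filter] at hv
        obtain ⟨hvU, hvN, u, hu, huv⟩ := hv
        have h2 := dg_le_two_of_not_mem hvU hvN
        have hlt : ((U.filter (fun u => G.Adj v u)).filter (fun u => u ∉ lev G U (j+1))).card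
            < (U.filter (fun u => G.Adj v u)).card := by
          apply Finset.card_lt_card
          refine Finset.filter_ssubset.2 ⟨u, ?_, ?_⟩
          · simp only [Finset.mem_filter]
            exact ⟨lev_subset G U j hu, huv.symm⟩
          · simpa using lev_mono G U (Nat.le_succ j) hu
        unfold dg at h2
        omega
    _ = _ := by simp

lemma lev_card (G : SimpleGraph V) (U : Finset V) (j : ℕ) :
    (lev G U j).card ≤ (lev G U 0).card + j * ∑ v ∈ lev G U 0, dg G U v := by
  have hT : ∀ j, (nextT G U (lev G U j)).card ≤ ∑ v ∈ lev G U 0, dg G U v := by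
    intro j
    induction j with
    | zero => exact nextT_zero_card G U
    | succ j ih => exact (nextT_succ_card G U j).trans ih
  induction j with
  | zero => simp
  | succ j ih =>
    have h1 : (lev G U (j+1)).card ≤ (lev G U j).card + (nextT G U (lev G U j)).card :=
      Finset.card_union_le _ _
    have h2 := hT j
    rw [add_mul]
    omega

lemma exists_far {G : SimpleGraph V} {U : Finset V} {k A : ℕ} (hA : 6 * k + 3 ≤ A)
    (hc : IsCoreSet G U) (hne : U.Nonempty)
    (hD : A * ∑ v ∈ U, dg G U v ≤ 2 * (A + 1) * U.card) : ∃ x ∈ U, x ∉ lev G U k := by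
  by_contra hcon
  push Not at hcon
  have hle : U.card ≤ (lev G U k).card := Finset.card_le_card hcon
  have h1 := lev_card G U k
  have hsplit : ∑ v ∈ U, dg G U v = 2 * U.card + ∑ v ∈ U, (dg G U v - 2) := by
    rw [mul_comm, ← smul_eq_mul, ← Finset.sum_const, ← Finset.sum_add_distrib]
    refine Finset.sum_congr rfl fun v hv => ?_
    have := hc v hv
    omega
  set X := ∑ v ∈ U, (dg G U v - 2) with hX
  have hsub : ∑ v ∈ lev G U 0, (dg G U v - 2) ≤ X :=
    Finset.sum_le_sum_of_subset (lev_subset G U 0)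
  have hb : (lev G U 0).card ≤ ∑ v ∈ lev G U 0, (dg G U v - 2) := by
    rw [Finset.card_eq_sum_ones]
    refine Finset.sum_le_sum fun v hv => ?_
    simp only [lev, Finset.mem_filter] at hv
    omega
  have hB : ∑ v ∈ lev G U 0, dg G U v ≤ 3 * ∑ v ∈ lev G U 0, (dg G U v - 2) := by
    rw [Finset.mul_sum]
    refine Finset.sum_le_sum fun v hv => ?_
    simp only [lev, Finset.mem_filter] at hv
    omega
  have hpos : 0 < U.card := Finset.card_pos.2 hne
  have h3 : U.card ≤ X + k * (3 * X) := by
    calc U.card ≤ _ := hle.trans h1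
      _ ≤ X + k * (3 * X) := by
        gcongr
        · omega
        · omega
  have h4 : A * X ≤ 2 * U.card := by
    rw [hsplit] at hD
    nlinarith
  have h5 : (6 * k + 3) * X ≤ 2 * U.card := (Nat.mul_le_mul_right X hA).trans h4
  nlinarith

lemma walk_back {G G' : SimpleGraph V} (hG : G' ≤ G) {U U' : Finset V} (hUU : U' ⊆ U)
    (hc : IsCoreSet G' U') {a u : V} (w : G'.Walk a u) (hu : u ∈ U')
    (hsup : ∀ v ∈ w.support, v ∈ U) {j : ℕ} (hj : w.length ≤ j) (hN : a ∉ lev G U j) : a ∈ U' := by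
  induction w generalizing j with
  | nil => exact hu
  | @cons a b u hab w ih =>
    simp only [Walk.length_cons] at hj
    obtain ⟨j, rfl⟩ : ∃ i, j = i + 1 := ⟨j - 1, by omega⟩
    have haU : a ∈ U := hsup a (by simp)
    have hbU : b ∈ U := hsup b (by simp)
    have hbN : b ∉ lev G U j := not_mem_lev_of_adj haU hN (hG hab)
    have hb : b ∈ U' := ih hu (fun v hv => hsup v (by simp [hv])) (by omega) hbN
    have h2 := hc b hb
    have h3 := dg_le_two_of_not_mem hbU hbN
    have hsubset : U'.filter (fun u => G'.Adj b u) ⊆ U.filter (fun u => G.Adj b u) := by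
      intro x hx
      simp only [Finset.mem_filter] at hx ⊢
      exact ⟨hUU hx.1, hG hx.2⟩
    have heq := Finset.eq_of_subset_of_card_le hsubset (by unfold dg at h2 h3; omega)
    have : a ∈ U.filter (fun u => G.Adj b u) := by
      simp only [Finset.mem_filter]
      exact ⟨haU, (hG hab).symm⟩
    rw [← heq] at this
    exact (Finset.mem_filter.1 this).1

theorem det_main [Fintype V] (k A : ℕ) (hk : 0 < k) (hA : 6 * k + 3 ≤ A) (G : SimpleGraph V)
    (hD : ∀ U : Finset V, A * ∑ v ∈ U, dg G U v ≤ 2 * (A + 1) * U.card) :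
    ∃ M : Set (Sym2 V), M ⊆ G.edgeSet ∧ (G.deleteEdges M).IsAcyclic ∧
      (∀ e ∈ M, ∀ x ∈ e, InCore G x) ∧
      ∀ e₁ ∈ M, ∀ e₂ ∈ M, e₁ ≠ e₂ → ∀ x ∈ e₁, ∀ y ∈ e₂,
        ∀ w : (G.deleteEdges M).Walk x y, k ≤ w.length := by
  induction G using WellFoundedLT.induction with
  | ind G IH =>
  rcases (coreF G).eq_empty_or_nonempty with hE | hE
  · refine ⟨∅, by simp, ?_, by simp, by simp⟩
    simpa using acyclic_of_coreF_empty hE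
  set U := coreF G with hU
  have hcU : IsCoreSet G U := coreF_isCoreSet G
  obtain ⟨x, hxU, hxN⟩ := exists_far hA hcU hE (hD U)
  obtain ⟨y, hy⟩ : (U.filter (fun u => G.Adj x u)).Nonempty := by
    apply Finset.card_pos.1
    have := hcU x hxU
    unfold dg at this
    omega
  simp only [Finset.mem_filter] at hy
  obtain ⟨hyU, hxy⟩ := hy
  obtain ⟨G', hG'⟩ : ∃ H, H = G.deleteEdges {s(x, y)} := ⟨_, rfl⟩
  have hle : G' ≤ G := hG' ▸ deleteEdges_le _
  have hlt : G' < G := by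
    refine lt_of_le_of_ne hle ?_
    intro h
    rw [← h] at hxy
    simp [hG'] at hxy
  obtain ⟨M, hMG, hac, hcore, hdist⟩ := IH G' hlt (fun W => by
    refine le_trans ?_ (hD W)
    gcongr with v hv
    exact dg_mono hle (Finset.Subset.refl _) v)
  have hFeq : G.deleteEdges (insert s(x, y) M) = G'.deleteEdges M := by
    rw [hG', deleteEdges_deleteEdges]
    rfl
  have hU'U : coreF G' ⊆ U := fun v hv => mem_coreF.2 ((mem_coreF.1 hv).mono hle)
  -- key distance claim
  have key : ∀ z ∈ U, z ∈ s(x, y) → z ∉ lev G U (k - 1) → ∀ u, InCore G' u →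
      ∀ w : (G'.deleteEdges M).Walk z u, k ≤ w.length := by
    intro z hzU hze hzN u hu w
    by_contra hlen
    have hFle : G'.deleteEdges M ≤ G' := deleteEdges_le _
    have hFle2 : G'.deleteEdges M ≤ G := hFle.trans hle
    have hpl : w.bypass.length ≤ k - 1 := by
      have := w.length_bypass_le_length
      omega
    have hsup : ∀ v ∈ w.bypass.support, v ∈ U := by
      intro v hv
      have := path_support_core (w.bypass.mapLe hFle2)
        ((Walk.isPath_mapLe hFle2).2 w.bypass_isPath) hzU
        (mem_coreF.2 (hu.mono hle)) v
      apply this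
      simpa using hv
    have hz : z ∈ coreF G' := by
      refine walk_back hle hU'U (coreF_isCoreSet G') (w.bypass.mapLe hFle) (mem_coreF.2 hu) ?_
        (j := k - 1) ?_ hzN
      · simpa using hsup
      · simpa using hpl
    have h2 := coreF_isCoreSet G' z hz
    have h3 := dg_le_two_of_not_mem hzU hzN
    obtain ⟨z', hz'U, hzz', hee⟩ : ∃ z' ∈ U, G.Adj z z' ∧ s(z, z') = s(x, y) := by
      rcases Sym2.mem_iff.1 hze with rfl | rfl
      · exact ⟨y, hyU, hxy, rfl⟩
      · exact ⟨x, hxU, hxy.symm, Sym2.eq_swap⟩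
    have hlt2 : dg G' (coreF G') z < dg G U z := by
      apply Finset.card_lt_card
      refine Finset.ssubset_iff_subset_ne.2 ⟨?_, ?_⟩
      · intro a ha
        simp only [Finset.mem_filter] at ha ⊢
        exact ⟨hU'U ha.1, hle ha.2⟩
      · intro h
        have : z' ∈ U.filter (fun u => G.Adj z u) := by
          simp only [Finset.mem_filter]
          exact ⟨hz'U, hzz'⟩
        rw [← h] at this
        have h5 := (Finset.mem_filter.1 this).2
        rw [hG', deleteEdges_adj, hee] at h5
        exact h5.2 rfl
    omega
  have hxN' : x ∉ lev G U (k - 1) := fun h => hxN (lev_mono G U (Nat.sub_le k 1) h)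
  have hyN' : y ∉ lev G U (k - 1) := by
    obtain ⟨j, rfl⟩ : ∃ j, k = j + 1 := ⟨k - 1, by omega⟩
    exact not_mem_lev_of_adj hxU hxN hxy
  have key2 : ∀ z ∈ s(x, y), ∀ u, InCore G' u →
      ∀ w : (G'.deleteEdges M).Walk z u, k ≤ w.length := by
    intro z hz
    rcases Sym2.mem_iff.1 hz with rfl | rfl
    · exact key _ hxU hz hxN'
    · exact key _ hyU hz hyN'
  refine ⟨insert s(x, y) M, ?_, ?_, ?_, ?_⟩
  · rintro e (rfl | he)
    · exact hxy
    · exact edgeSet_subset_edgeSet.2 hle (hMG he)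
  · rw [hFeq]; exact hac
  · rintro e (rfl | he) z hz
    · rcases Sym2.mem_iff.1 hz with rfl | rfl
      · exact mem_coreF.1 hxU
      · exact mem_coreF.1 hyU
    · exact (hcore e he z hz).mono hle
  · rw [hFeq]
    rintro e₁ (rfl | he₁) e₂ (rfl | he₂) hne a ha b hb w
    · exact absurd rfl hne
    · exact key2 a ha b (hcore e₂ he₂ b hb) w
    · have := key2 b hb a (hcore e₁ he₁ a ha) w.reverse
      simpa using this
    · exact hdist e₁ he₁ e₂ he₂ hne a ha b hb w

end det
section prob
open scoped Classical

variable {α : Type*}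

/-- Expectation over a binomial random subset. -/
noncomputable def Ex (p : ℝ) (E : Finset α) (f : Finset α → ℝ) : ℝ :=
  ∑ S ∈ E.powerset, p ^ S.card * (1 - p) ^ (E.card - S.card) * f S

lemma Ex_empty (p : ℝ) (f : Finset α → ℝ) : Ex p ∅ f = f ∅ := by simp [Ex]

lemma Ex_insert [DecidableEq α] (p : ℝ) {E : Finset α} {a : α} (ha : a ∉ E) (f : Finset α → ℝ) :
    Ex p (insert a E) f = (1 - p) * Ex p E f + p * Ex p E (fun S => f (insert a S)) := by
  unfold Ex
  rw [Finset.sum_powerset_insert ha, Finset.mul_sum, Finset.mul_sum]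
  congr 1
  · refine Finset.sum_congr rfl fun S hS => ?_
    have hSE := Finset.mem_powerset.1 hS
    have hc := Finset.card_le_card hSE
    rw [Finset.card_insert_of_notMem ha, show E.card + 1 - S.card = (E.card - S.card) + 1 by omega,
      pow_succ]
    ring
  · refine Finset.sum_congr rfl fun S hS => ?_
    have hSE := Finset.mem_powerset.1 hS
    have haS : a ∉ S := fun h => ha (hSE h)
    rw [Finset.card_insert_of_notMem ha, Finset.card_insert_of_notMem haS,
      show E.card + 1 - (S.card + 1) = (E.card - S.card) by omega, pow_succ]
    ring

lemma Ex_mono {p : ℝ} (h0 : 0 ≤ p) (h1 : p ≤ 1) {E : Finset α} {f g : Finset α → ℝ}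
    (h : ∀ S ⊆ E, f S ≤ g S) : Ex p E f ≤ Ex p E g := by
  unfold Ex
  refine Finset.sum_le_sum fun S hS => ?_
  have := h S (Finset.mem_powerset.1 hS)
  have h2 : 0 ≤ 1 - p := by linarith
  gcongr

lemma Ex_add (p : ℝ) (E : Finset α) (f g : Finset α → ℝ) :
    Ex p E (fun S => f S + g S) = Ex p E f + Ex p E g := by
  simp [Ex, mul_add, Finset.sum_add_distrib]

lemma Ex_mul (p : ℝ) (E : Finset α) (c : ℝ) (f : Finset α → ℝ) :
    Ex p E (fun S => c * f S) = c * Ex p E f := by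
  simp only [Ex, Finset.mul_sum]
  exact Finset.sum_congr rfl fun S _ => by ring

lemma Ex_sum {ι : Type*} (p : ℝ) (E : Finset α) (s : Finset ι) (f : ι → Finset α → ℝ) :
    Ex p E (fun S => ∑ i ∈ s, f i S) = ∑ i ∈ s, Ex p E (f i) := by
  simp only [Ex, Finset.mul_sum]
  exact Finset.sum_comm

lemma Ex_const (p : ℝ) (E : Finset α) (c : ℝ) : Ex p E (fun _ => c) = c := by
  have := Finset.sum_pow_mul_eq_add_pow p (1 - p) E
  unfold Ex
  rw [← Finset.sum_mul, this]
  simp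

lemma Ex_two_pow (p : ℝ) (E : Finset α) : Ex p E (fun S => 2 ^ S.card) = (1 + p) ^ E.card := by
  have := Finset.sum_pow_mul_eq_add_pow (2 * p) (1 - p) E
  rw [show 1 + p = 2 * p + (1 - p) by ring, ← this]
  unfold Ex
  refine Finset.sum_congr rfl fun S _ => ?_
  rw [mul_pow]
  ring

lemma Ex_subset {p : ℝ} (h0 : 0 ≤ p) (E T : Finset α) :
    Ex p E (fun S => if T ⊆ S then 1 else 0) ≤ p ^ T.card := by
  induction E using Finset.induction_on generalizing T with
  | empty =>
    rw [Ex_empty]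
    split_ifs with h
    · have : T = ∅ := Finset.subset_empty.1 h
      simp [this]
    · positivity
  | insert a E ha ih =>
    rw [Ex_insert p ha]
    by_cases hT : a ∈ T
    · have e1 : Ex p E (fun S => if T ⊆ S then (1:ℝ) else 0) = 0 := by
        unfold Ex
        refine Finset.sum_eq_zero fun S hS => ?_
        have : ¬ T ⊆ S := fun h => ha (Finset.mem_powerset.1 hS (h hT))
        simp [this]
      have e2 : (fun S => if T ⊆ insert a S then (1:ℝ) else 0)
          = fun S => if T.erase a ⊆ S then (1:ℝ) else 0 := by
        funext S
        simp only [Finset.subset_insert_iff]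
      rw [e1, e2, mul_zero, zero_add]
      calc p * _ ≤ p * p ^ (T.erase a).card := by gcongr; exact ih _
        _ = p ^ T.card := by
          rw [← pow_succ', Finset.card_erase_add_one hT]
    · have e2 : (fun S => if T ⊆ insert a S then (1:ℝ) else 0)
          = fun S => if T ⊆ S then (1:ℝ) else 0 := by
        funext S
        simp only [Finset.subset_insert_iff_of_notMem hT]
      rw [e2, ← add_mul]
      simpa using ih T

lemma Ex_subset' {p : ℝ} (h0 : 0 ≤ p) (E T : Finset α) [hd : ∀ S : Finset α, Decidable (T ⊆ S)] :
    Ex p E (fun S => if T ⊆ S then 1 else 0) ≤ p ^ T.card := by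
  convert Ex_subset h0 E T

lemma Ex_union [DecidableEq α] (p p1 p2 : ℝ) (h : 1 - p = (1 - p1) * (1 - p2)) (E : Finset α)
    (f : Finset α → ℝ) :
    Ex p E f = Ex p1 E (fun S1 => Ex p2 E (fun S2 => f (S1 ∪ S2))) := by
  induction E using Finset.induction_on generalizing f with
  | empty => simp [Ex_empty]
  | insert a E ha ih =>
    rw [Ex_insert p ha, Ex_insert p1 ha]
    simp only [Ex_insert p2 ha, Finset.insert_union, Finset.union_insert, Finset.insert_idem,
      Ex_add, Ex_mul]
    rw [← ih f, ← ih (fun S => f (insert a S))]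
    have hp : p = 1 - (1 - p1) * (1 - p2) := by linarith
    rw [hp]
    ring

lemma Ex_markov {p : ℝ} (h0 : 0 ≤ p) (h1 : p ≤ 1) (E : Finset α) (f : Finset α → ℝ)
    (hf : ∀ S, 0 ≤ f S) {t : ℝ} (ht : 0 < t) :
    Ex p E (fun S => if t ≤ f S then 1 else 0) ≤ Ex p E f / t := by
  rw [le_div_iff₀ ht, mul_comm, ← Ex_mul]
  apply Ex_mono h0 h1
  intro S _
  split_ifs with h
  · linarith
  · simpa using hf S

/-- All edges. -/
noncomputable def allE (n : ℕ) : Finset (Sym2 (Fin n)) := (⊤ : SimpleGraph (Fin n)).edgeFinset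

lemma card_allE (n : ℕ) : (allE n).card = n.choose 2 := by
  unfold allE
  rw [SimpleGraph.card_edgeFinset_top_eq_card_choose_two]
  simp

lemma mem_allE {n : ℕ} {e : Sym2 (Fin n)} : e ∈ allE n ↔ ¬ e.IsDiag := by
  simp [allE]

lemma edgeSet_from {n : ℕ} {S : Finset (Sym2 (Fin n))} (hS : S ⊆ allE n) :
    (fromEdgeSet (S : Set (Sym2 (Fin n)))).edgeSet = S := by
  rw [edgeSet_fromEdgeSet]
  ext e
  simp only [Set.mem_sdiff, Finset.mem_coe]
  exact ⟨fun h => h.1, fun h => ⟨h, mem_allE.1 (hS h)⟩⟩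

lemma erProb_eq (n : ℕ) (p : ℝ) (P : SimpleGraph (Fin n) → Prop) :
    erProb n p P = Ex p (allE n)
      (fun S => if P (fromEdgeSet (S : Set (Sym2 (Fin n)))) then 1 else 0) := by
  unfold erProb Ex
  symm
  refine Finset.sum_nbij' (fun S => fromEdgeSet (S : Set (Sym2 (Fin n))))
    (fun G => G.edgeFinset) ?_ ?_ ?_ ?_ ?_
  · simp
  · intro G _
    rw [Finset.mem_powerset]
    intro e he
    rw [mem_allE]
    exact G.not_isDiag_of_mem_edgeFinset he
  · intro S hS
    have := edgeSet_from (Finset.mem_powerset.1 hS)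
    apply Finset.coe_injective
    simpa using this
  · intro G _
    simp
  · intro S hS
    have := edgeSet_from (Finset.mem_powerset.1 hS)
    rw [this, Set.ncard_coe_finset, card_allE]
    by_cases h : P (fromEdgeSet (S : Set (Sym2 (Fin n)))) <;> simp [h]

end prob
section comb
open scoped Classical

/-- Number of edges inside `U`. -/
noncomputable def eU {n : ℕ} (S : Finset (Sym2 (Fin n))) (U : Finset (Fin n)) : ℕ :=
  (S.filter (fun e => e ∈ U.sym2)).card

lemma sum_dg {n : ℕ} {S : Finset (Sym2 (Fin n))} (hS : S ⊆ allE n) (U : Finset (Fin n)) :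
    ∑ v ∈ U, dg (fromEdgeSet (S : Set (Sym2 (Fin n)))) U v = 2 * eU S U := by
  obtain ⟨R, hR⟩ : ∃ R, R = S.filter (fun e => e ∈ U.sym2) := ⟨_, rfl⟩
  have hRS : R ⊆ allE n := by
    rw [hR]; exact (Finset.filter_subset _ _).trans hS
  obtain ⟨H, hH⟩ : ∃ H, H = fromEdgeSet (R : Set (Sym2 (Fin n))) := ⟨_, rfl⟩
  have hE : H.edgeFinset = R := by
    apply Finset.coe_injective
    rw [coe_edgeFinset, hH, edgeSet_from hRS]
  have h1 := H.sum_degrees_eq_twice_card_edges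
  rw [hE] at h1
  unfold eU
  rw [← hR, ← h1]
  have hadj : ∀ v u, H.Adj v u ↔ v ∈ U ∧ u ∈ U ∧ (fromEdgeSet (S : Set (Sym2 (Fin n)))).Adj v u := by
    intro v u
    simp only [hH, hR, fromEdgeSet_adj, Finset.coe_filter, Set.mem_ofPred_eq, Finset.mk_mem_sym2_iff,
      Finset.mem_coe]
    tauto
  rw [← Finset.sum_subset (Finset.subset_univ U)]
  · refine Finset.sum_congr rfl fun v hv => ?_
    rw [← card_neighborFinset_eq_degree]
    unfold dg
    congr 1
    ext u
    simp only [Finset.mem_filter, mem_neighborFinset, hadj]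
    tauto
  · intro v _ hv
    rw [← card_neighborFinset_eq_degree, Finset.card_eq_zero]
    ext u
    simp [hadj, hv]

lemma eU_forest {n : ℕ} {S : Finset (Sym2 (Fin n))} (hS : S ⊆ allE n)
    (hac : (fromEdgeSet (S : Set (Sym2 (Fin n)))).IsAcyclic) (U : Finset (Fin n)) :
    eU S U ≤ U.card := by
  rcases U.eq_empty_or_nonempty with rfl | hne
  · simp [eU]
  obtain ⟨G, hG⟩ : ∃ G, G = fromEdgeSet (S : Set (Sym2 (Fin n))) := ⟨_, rfl⟩
  have hind := hac.induce (U : Set (Fin n))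
  rw [← hG] at hind
  have : Nonempty (U : Set (Fin n)) := hne.to_subtype
  obtain ⟨T, hGT, -, hT⟩ :=
    (connected_top (V := (U : Set (Fin n)))).exists_isTree_le_of_le_of_isAcyclic le_top hind
  have hcard := hT.card_edgeFinset
  have hU : Fintype.card (U : Set (Fin n)) = U.card := by simp
  have : eU S U ≤ T.edgeFinset.card := by
    refine le_trans (Finset.card_le_card ?_)
      (Finset.card_image_le (s := T.edgeFinset) (f := Sym2.map Subtype.val))
    intro e
    induction e with
    | h a b =>
      intro he
      simp only [Finset.mem_filter, Finset.mk_mem_sym2_iff] at he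
      obtain ⟨heS, ha, hb⟩ := he
      rw [Finset.mem_image]
      refine ⟨s(⟨a, ha⟩, ⟨b, hb⟩), ?_, by simp⟩
      rw [mem_edgeFinset]
      apply hGT
      rw [comap_adj, hG, fromEdgeSet_adj]
      refine ⟨heS, ?_⟩
      have := mem_allE.1 (hS heS)
      simpa using this
  omega

/-- All cycles of the complete graph. -/
noncomputable def allC (n : ℕ) :
    Finset (Σ u : Fin n, (⊤ : SimpleGraph (Fin n)).Walk u u) :=
  Finset.univ.sigma fun u => (Finset.range n).biUnion fun l =>
    ((⊤ : SimpleGraph (Fin n)).finsetWalkLength (l + 1) u u).filter (fun c => c.IsCycle)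

/-- number of cycles in `S`. -/
noncomputable def cyc {n : ℕ} (S : Finset (Sym2 (Fin n))) : ℕ :=
  ((allC n).filter (fun c => c.2.edges.toFinset ⊆ S)).card

lemma mem_allC {n : ℕ} {u : Fin n} (c : (⊤ : SimpleGraph (Fin n)).Walk u u) (hc : c.IsCycle) :
    (⟨u, c⟩ : Σ u : Fin n, (⊤ : SimpleGraph (Fin n)).Walk u u) ∈ allC n := by
  have h3 := hc.three_le_length
  have hp := hc.isPath_tail.length_lt
  have hl := Walk.length_tail_add_one hc.not_nil
  simp only [Fintype.card_fin] at hp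
  simp only [allC, Finset.mem_sigma, Finset.mem_univ, true_and, Finset.mem_biUnion,
    Finset.mem_range, Finset.mem_filter, mem_finsetWalkLength_iff]
  exact ⟨c.length - 1, by omega, by omega, hc⟩

lemma exists_forest {n : ℕ} (S : Finset (Sym2 (Fin n))) :
    ∃ R : Finset (Sym2 (Fin n)), R.card ≤ cyc S ∧
      (fromEdgeSet ((S \ R : Finset (Sym2 (Fin n))) : Set (Sym2 (Fin n)))).IsAcyclic := by
  obtain ⟨R, hR⟩ : ∃ R, R = ((allC n).filter (fun c => c.2.edges.toFinset ⊆ S)).image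
    (fun c => s(c.1, c.2.snd)) := ⟨_, rfl⟩
  refine ⟨R, hR ▸ Finset.card_image_le, ?_⟩
  intro u c hc
  have hsub : ∀ e ∈ c.edges, e ∈ S \ R := by
    intro e he
    have := c.edges_subset_edgeSet he
    rw [edgeSet_fromEdgeSet] at this
    exact this.1
  have hmem : s(u, (c.mapLe le_top).snd) ∈ R := by
    refine (Finset.ext_iff.1 hR _).2 (Finset.mem_image.2 ?_)
    refine ⟨⟨u, c.mapLe le_top⟩, ?_, rfl⟩
    rw [Finset.mem_filter]
    refine ⟨mem_allC _ ((Walk.isCycle_mapLe le_top).2 hc), ?_⟩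
    intro e he
    have he' : e ∈ c.edges := by simpa using he
    exact (Finset.mem_sdiff.1 (hsub e he')).1
  have hmem2 : s(u, (c.mapLe le_top).snd) ∈ c.edges := by
    have h1 : ¬ (c.mapLe (le_top : _ ≤ (⊤ : SimpleGraph (Fin n)))).Nil :=
      ((Walk.isCycle_mapLe le_top).2 hc).not_nil
    have h2 := Walk.mk_start_snd_mem_edges h1
    simpa using h2
  exact (Finset.mem_sdiff.1 (hsub _ hmem2)).2 hmem

lemma eU_union_le {n : ℕ} (S T : Finset (Sym2 (Fin n))) (U : Finset (Fin n)) :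
    eU (S ∪ T) U ≤ eU S U + T.card := by
  unfold eU
  rw [Finset.filter_union]
  refine (Finset.card_union_le _ _).trans ?_
  gcongr
  exact Finset.filter_subset _ _

lemma eU_mono {n : ℕ} {S T : Finset (Sym2 (Fin n))} (h : S ⊆ T) (U : Finset (Fin n)) :
    eU S U ≤ eU T U := Finset.card_le_card (Finset.filter_subset_filter _ h)

lemma eU_le_cyc {n : ℕ} {S : Finset (Sym2 (Fin n))} (hS : S ⊆ allE n) (U : Finset (Fin n)) :
    eU S U ≤ U.card + cyc S := by
  obtain ⟨R, hR, hac⟩ := exists_forest S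
  have h1 := eU_forest (Finset.sdiff_subset.trans hS) hac U
  have h2 := eU_union_le (S \ R) R U
  have h3 : eU S U ≤ eU (S \ R ∪ R) U := eU_mono (by simp) U
  omega

lemma walk_count {n : ℕ} (l : ℕ) (u v : Fin n) :
    ((⊤ : SimpleGraph (Fin n)).finsetWalkLength (l + 1) u v).card ≤ n ^ l := by
  have : (Finset.univ : Finset (Fin l → Fin n)).card = n ^ l := by simp
  rw [← this]
  refine Finset.card_le_card_of_injOn (fun w i => w.getVert (i + 1)) (by simp) ?_
  intro p hp q hq hpq
  have hp' : p.length = l + 1 := by simpa [mem_finsetWalkLength_iff] using hp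
  have hq' : q.length = l + 1 := by simpa [mem_finsetWalkLength_iff] using hq
  apply Walk.ext_getVert_le_length (by omega)
  intro j hj
  rcases Nat.eq_zero_or_pos j with rfl | hj0
  · simp
  · rcases hj.lt_or_eq with hlt | heq
    · have := congrFun hpq ⟨j - 1, by omega⟩
      simpa [Nat.sub_add_cancel hj0] using this
    · rw [heq, Walk.getVert_length, hp', ← hq', Walk.getVert_length]

lemma Ex_cyc {n : ℕ} {p : ℝ} (h0 : 0 ≤ p) (h1 : p ≤ 1) (hn : n * p < 1) :
    Ex p (allE n) (fun S => (cyc S : ℝ)) ≤ 1 / (1 - n * p) := by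
  have e1 : (fun S : Finset (Sym2 (Fin n)) => (cyc S : ℝ)) =
      fun S => ∑ c ∈ allC n, if c.2.edges.toFinset ⊆ S then (1 : ℝ) else 0 := by
    funext S
    rw [cyc, Finset.card_filter]
    push_cast
    rfl
  rw [e1, Ex_sum]
  calc ∑ c ∈ allC n, Ex p (allE n) (fun S => if c.2.edges.toFinset ⊆ S then (1 : ℝ) else 0)
      ≤ ∑ c ∈ allC n, p ^ c.2.length := by
        refine Finset.sum_le_sum fun c hc => ?_
        refine (Ex_subset' h0 _ _).trans_eq ?_
        have hcyc : c.2.IsCycle := by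
          obtain ⟨l, _, h⟩ := Finset.mem_biUnion.1 (Finset.mem_sigma.1 hc).2
          exact (Finset.mem_filter.1 h).2
        rw [List.toFinset_card_of_nodup hcyc.edges_nodup, Walk.length_edges]
    _ = ∑ u : Fin n, ∑ c ∈ (Finset.range n).biUnion fun l =>
          ((⊤ : SimpleGraph (Fin n)).finsetWalkLength (l + 1) u u).filter (fun c => c.IsCycle),
          p ^ c.length := by
        rw [allC, Finset.sum_sigma]
    _ ≤ ∑ u : Fin n, ∑ l ∈ Finset.range n, (n : ℝ) ^ l * p ^ (l + 1) := by
        refine Finset.sum_le_sum fun u _ => ?_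
        rw [Finset.sum_biUnion]
        swap
        · intro a _ b _ hab
          refine Finset.disjoint_left.2 fun c hca hcb => hab ?_
          have h1 := mem_finsetWalkLength_iff.1 (Finset.mem_filter.1 hca).1
          have h2 := mem_finsetWalkLength_iff.1 (Finset.mem_filter.1 hcb).1
          omega
        refine Finset.sum_le_sum fun l _ => ?_
        calc _ ≤ ∑ c ∈ (⊤ : SimpleGraph (Fin n)).finsetWalkLength (l + 1) u u, p ^ (l + 1) := by
              refine (Finset.sum_le_sum_of_subset_of_nonneg (Finset.filter_subset _ _)
                (fun _ _ _ => by positivity)).trans_eq ?_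
              refine Finset.sum_congr rfl fun c hc => ?_
              rw [mem_finsetWalkLength_iff.1 hc]
          _ ≤ _ := by
              rw [Finset.sum_const, nsmul_eq_mul]
              gcongr
              exact_mod_cast walk_count l u u
    _ = ∑ l ∈ Finset.range n, ((n : ℝ) * p) ^ (l + 1) := by
        rw [Finset.sum_const, Finset.card_univ, Fintype.card_fin, nsmul_eq_mul, Finset.mul_sum]
        refine Finset.sum_congr rfl fun l _ => ?_
        rw [mul_pow, pow_succ (n : ℝ)]
        ring
    _ ≤ ∑ l ∈ Finset.range n, ((n : ℝ) * p) ^ l := by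
        refine Finset.sum_le_sum fun l _ => ?_
        exact pow_le_pow_of_le_one (by positivity) hn.le (Nat.le_succ l)
    _ ≤ 1 / (1 - n * p) := by
        rw [one_div, ← tsum_geometric_of_lt_one (by positivity) hn]
        exact (summable_geometric_of_lt_one (by positivity) hn).sum_le_tsum _
          (fun _ _ => by positivity)

end comb
section small
open scoped Classical

lemma pow_self_le (s : ℕ) : (s : ℝ) ^ s ≤ 3 ^ s * (s.factorial : ℝ) := by
  have h := Real.pow_div_factorial_le_exp (s : ℝ) (by positivity) s
  have hf : (0 : ℝ) < s.factorial := by exact_mod_cast s.factorial_pos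
  rw [div_le_iff₀ hf] at h
  refine h.trans ?_
  gcongr
  have : Real.exp (s : ℝ) = Real.exp 1 ^ s := by rw [← Real.exp_nat_mul]; simp
  rw [this]
  gcongr
  exact Real.exp_one_lt_three.le

lemma choose_bound (N s : ℕ) (hs : 0 < s) : (N.choose s : ℝ) ≤ (3 * N / s) ^ s := by
  refine (Nat.choose_le_pow_div s N).trans ?_
  have hf : (0 : ℝ) < s.factorial := by exact_mod_cast s.factorial_pos
  have hs' : (0 : ℝ) < (s : ℝ) ^ s := by positivity
  rw [div_pow, mul_pow, div_le_div_iff₀ hf hs']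
  have := pow_self_le s
  calc (N : ℝ) ^ s * (s : ℝ) ^ s ≤ (N : ℝ) ^ s * (3 ^ s * (s.factorial : ℝ)) := by gcongr
    _ = _ := by ring

lemma term_bound (A : ℕ) (hA : 0 < A) (n s : ℕ) (hn : 0 < n) (hs : 0 < s) (δ p : ℝ)
    (hδ : 648 ^ A * δ ≤ (1 / 4) ^ A) (hsn : (s : ℝ) ≤ δ * n) (hp0 : 0 ≤ p) (hp : p ≤ 2 / n) :
    (n.choose s : ℝ) * (((s + 1).choose 2).choose (s + (s / A + 1)) * p ^ (s + (s / A + 1)))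
      ≤ 648 ^ A * 4 ^ A / n * (1 / 2) ^ s := by
  obtain ⟨j, hj⟩ : ∃ j, j = s / A := ⟨_, rfl⟩
  have hn' : (0 : ℝ) < n := by exact_mod_cast hn
  have hs' : (0 : ℝ) < s := by exact_mod_cast hs
  have hjs : j ≤ s := hj ▸ Nat.div_le_self s A
  have hsA : s < A * (j + 1) := by
    rw [hj]; exact Nat.lt_mul_div_succ s hA
  rw [← hj]
  obtain ⟨m, hm⟩ : ∃ m, m = s + (j + 1) := ⟨_, rfl⟩
  rw [← hm]
  have hm0 : 0 < m := by omega
  obtain ⟨x, hx⟩ : ∃ x : ℝ, x = s / n := ⟨_, rfl⟩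
  have hx0 : 0 < x := by rw [hx]; positivity
  have hxδ : x ≤ δ := by rw [hx, div_le_iff₀ hn']; exact hsn
  have b1 : (n.choose s : ℝ) ≤ (3 / x) ^ s := by
    refine (choose_bound n s hs).trans_eq ?_
    rw [hx]; congr 1; field_simp
  have b2 : (((s + 1).choose 2).choose m : ℝ) ≤ (3 * s) ^ m := by
    refine (choose_bound _ m hm0).trans ?_
    gcongr
    rw [div_le_iff₀ (by exact_mod_cast hm0)]
    have hc : ((s + 1).choose 2) ≤ s * s := by
      rw [Nat.choose_two_right]
      apply Nat.div_le_of_le_mul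
      simp only [Nat.add_sub_cancel]
      nlinarith
    have hc' : (((s + 1).choose 2 : ℕ) : ℝ) ≤ (s : ℝ) * s := by exact_mod_cast hc
    have hsm : (s : ℝ) ≤ m := by exact_mod_cast (by omega : s ≤ m)
    nlinarith
  have b3 : p ^ m ≤ (2 / n) ^ m := by gcongr
  calc (n.choose s : ℝ) * (((s + 1).choose 2).choose m * p ^ m)
      ≤ (3 / x) ^ s * ((3 * s) ^ m * (2 / n) ^ m) := by gcongr
    _ = 3 ^ s * 6 ^ m * x ^ (j + 1) := by
        rw [← mul_pow, show 3 * (s : ℝ) * (2 / n) = 6 * x by rw [hx]; ring, mul_pow, hm,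
          pow_add x s, div_pow]
        field_simp
    _ ≤ 3 ^ s * 6 ^ (3 * s) * x ^ (j + 1) := by
        gcongr
        · norm_num
        · omega
    _ = 648 ^ s * x ^ (j + 1) := by
        rw [pow_mul, ← mul_pow]; norm_num
    _ ≤ 648 ^ (A * (j + 1)) * x ^ (j + 1) := by
        gcongr
        norm_num
    _ = (648 ^ A * x) * (648 ^ A * x) ^ j := by
        rw [pow_mul, ← mul_pow, pow_succ']
    _ ≤ (648 ^ A * x) * ((1 / 4) ^ A) ^ j := by
        gcongr
        refine le_trans ?_ hδ
        gcongr
    _ ≤ (648 ^ A * x) * (4 ^ A * (1 / 4) ^ s) := by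
        gcongr
        rw [← pow_mul]
        have : ((1 : ℝ) / 4) ^ (A * j) = 4 ^ A * (1 / 4) ^ (A * (j + 1)) := by
          rw [mul_add, pow_add, mul_one, mul_comm ((1 / 4 : ℝ) ^ (A * j)), ← mul_assoc, ← mul_pow]
          norm_num
        rw [this]
        gcongr 4 ^ A * ?_
        exact pow_le_pow_of_le_one (by norm_num) (by norm_num) hsA.le
    _ = 648 ^ A * 4 ^ A / n * (s * (1 / 4) ^ s) := by rw [hx]; ring
    _ ≤ 648 ^ A * 4 ^ A / n * (1 / 2) ^ s := by
        gcongr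
        have h2 : (s : ℝ) ≤ 2 ^ s := by exact_mod_cast Nat.lt_two_pow_self.le
        calc (s : ℝ) * (1 / 4) ^ s ≤ 2 ^ s * (1 / 4) ^ s := by gcongr
          _ = (1 / 2) ^ s := by rw [← mul_pow]; norm_num

lemma small_event (A : ℕ) (hA : 0 < A) (n : ℕ) (hn : 0 < n) (δ p : ℝ)
    (hδ : 648 ^ A * δ ≤ (1 / 4) ^ A) (hp0 : 0 ≤ p) (hp1 : p ≤ 1) (hp : p ≤ 2 / n) :
    Ex p (allE n) (fun S => if ∃ U : Finset (Fin n), (U.card : ℝ) ≤ δ * n ∧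
      (A + 1) * U.card < A * eU S U then 1 else 0) ≤ 2 * (648 ^ A * 4 ^ A) / n := by
  obtain ⟨m, hm⟩ : ∃ m : ℕ → ℕ, m = fun s => s + (s / A + 1) := ⟨_, rfl⟩
  obtain ⟨g, hg⟩ : ∃ g : ℕ → ℝ, g = fun s : ℕ => if 0 < s ∧ (s : ℝ) ≤ δ * n then
    ((((s + 1).choose 2).choose (m s) : ℕ) : ℝ) * p ^ m s else 0 := ⟨_, rfl⟩
  obtain ⟨Us, hUs⟩ : ∃ Us : Finset (Finset (Fin n)), Us =
    Finset.univ.filter (fun U => 0 < U.card ∧ (U.card : ℝ) ≤ δ * n) := ⟨_, rfl⟩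
  calc _ ≤ Ex p (allE n) (fun S => ∑ U ∈ Us, ∑ T ∈ Finset.powersetCard (m U.card) U.sym2,
          if T ⊆ S then (1 : ℝ) else 0) := by
        apply Ex_mono hp0 hp1
        intro S _
        have hnn : ∀ U ∈ Us, (0 : ℝ) ≤ ∑ T ∈ Finset.powersetCard (m U.card) U.sym2,
          if T ⊆ S then (1 : ℝ) else 0 := fun U _ =>
            Finset.sum_nonneg fun T _ => by split_ifs <;> norm_num
        split_ifs with h
        · obtain ⟨U, hU1, hU2⟩ := h
          have hUpos : 0 < U.card := by
            rcases Nat.eq_zero_or_pos U.card with h0 | h0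
            · have : U = ∅ := Finset.card_eq_zero.1 h0
              subst this
              simp [eU] at hU2
            · exact h0
          have hUm : U ∈ Us := by
            rw [hUs, Finset.mem_filter]
            exact ⟨Finset.mem_univ _, hUpos, hU1⟩
          refine le_trans ?_ (Finset.single_le_sum hnn hUm)
          have hcard : m U.card ≤ (S.filter (fun e => e ∈ U.sym2)).card := by
            have hdiv : A * (U.card / A) ≤ U.card := Nat.mul_div_le _ _
            simp only [hm]
            by_contra hcon
            have hle : eU S U ≤ U.card + U.card / A := by unfold eU; omega
            have := Nat.mul_le_mul_left A hle
            nlinarith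
          obtain ⟨T, hT1, hT2⟩ := Finset.exists_subset_card_eq hcard
          have hTm : T ∈ Finset.powersetCard (m U.card) U.sym2 := by
            rw [Finset.mem_powersetCard]
            refine ⟨fun e he => (Finset.mem_filter.1 (hT1 he)).2, hT2⟩
          have hTS : T ⊆ S := fun e he => (Finset.mem_filter.1 (hT1 he)).1
          refine le_trans ?_ (Finset.single_le_sum
            (f := fun T => if T ⊆ S then (1 : ℝ) else 0) ?_ hTm)
          · simp [hTS]
          · intro T _
            split_ifs <;> norm_num
        · exact Finset.sum_nonneg hnn
    _ = ∑ U ∈ Us, ∑ T ∈ Finset.powersetCard (m U.card) U.sym2,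
          Ex p (allE n) (fun S => if T ⊆ S then (1 : ℝ) else 0) := by
        rw [Ex_sum]
        refine Finset.sum_congr rfl fun U _ => ?_
        rw [Ex_sum]
    _ ≤ ∑ U ∈ Us, g U.card := by
        refine Finset.sum_le_sum fun U hU => ?_
        rw [hUs, Finset.mem_filter] at hU
        calc _ ≤ ∑ T ∈ Finset.powersetCard (m U.card) U.sym2, p ^ m U.card := by
              refine Finset.sum_le_sum fun T hT => ?_
              refine (Ex_subset' hp0 _ _).trans_eq ?_
              rw [(Finset.mem_powersetCard.1 hT).2]
          _ = g U.card := by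
              rw [hg, Finset.sum_const, Finset.card_powersetCard, Finset.card_sym2, nsmul_eq_mul]
              exact (if_pos hU.2).symm
    _ ≤ ∑ U ∈ (Finset.univ : Finset (Fin n)).powerset, g U.card := by
        refine Finset.sum_le_sum_of_subset_of_nonneg (by intro U _; simp) ?_
        intro U _ _
        rw [hg]
        simp only []
        split_ifs
        · positivity
        · exact le_rfl
    _ = ∑ s ∈ Finset.range (n + 1), (n.choose s : ℝ) * g s := by
        rw [Finset.sum_powerset_apply_card]
        simp
    _ ≤ ∑ s ∈ Finset.range (n + 1), (648 : ℝ) ^ A * 4 ^ A / n * (1 / 2) ^ s := by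
        refine Finset.sum_le_sum fun s _ => ?_
        rw [hg]
        simp only [hm]
        split_ifs with h
        · exact term_bound A hA n s hn h.1 δ p hδ h.2 hp0 hp
        · rw [mul_zero]; positivity
    _ ≤ 2 * (648 ^ A * 4 ^ A) / n := by
        rw [← Finset.mul_sum]
        calc _ ≤ 648 ^ A * 4 ^ A / (n : ℝ) * 2 := by
              gcongr
              exact sum_geometric_two_le _
          _ = _ := by ring

end small
section final
open scoped Classical

lemma big_event (n : ℕ) (hn : 2 ≤ n) (ε γ : ℝ) (hε : 0 < ε) (hε1 : ε < 1 / 2) (hγ : 0 < γ) :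
    Ex ((1 + ε) / n) (allE n) (fun S => if ∃ U : Finset (Fin n), (U.card : ℝ) + γ * n < eU S U
      then 1 else 0) ≤ 2 / (ε * γ) / n + Real.exp (-(γ / 4 - 2 * ε) * n) := by
  have hn' : (2 : ℝ) ≤ n := by exact_mod_cast hn
  have hn0 : (0 : ℝ) < n := by linarith
  obtain ⟨p1, hp1⟩ : ∃ p1 : ℝ, p1 = (1 - ε) / n := ⟨_, rfl⟩
  have hp1n : n * p1 = 1 - ε := by rw [hp1]; field_simp
  have hp10 : 0 ≤ p1 := by rw [hp1]; apply div_nonneg <;> linarith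
  have hp1h : p1 ≤ 1 / 2 := by
    rw [hp1, div_le_iff₀ hn0]; linarith
  have hpos : 0 < 1 - p1 := by linarith
  obtain ⟨p2, hp2⟩ : ∃ p2 : ℝ, p2 = (2 * ε / n) / (1 - p1) := ⟨_, rfl⟩
  have hp20 : 0 ≤ p2 := by rw [hp2]; positivity
  have hp2b : p2 ≤ 4 * ε / n := by
    rw [hp2, div_le_iff₀ hpos]
    have : 0 ≤ 4 * ε / n := by positivity
    calc 2 * ε / n = 4 * ε / n * (1 / 2) := by ring
      _ ≤ _ := by gcongr; linarith
  have hp21 : p2 ≤ 1 := by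
    refine hp2b.trans ?_
    rw [div_le_iff₀ hn0]; linarith
  have hpp : 1 - (1 + ε) / n = (1 - p1) * (1 - p2) := by
    rw [mul_sub, mul_one, hp2, mul_div_cancel₀ _ hpos.ne', hp1]
    ring
  rw [Ex_union _ p1 p2 hpp]
  obtain ⟨t, ht⟩ : ∃ t : ℝ, t = (2 : ℝ) ^ (γ * n / 2) := ⟨_, rfl⟩
  have ht0 : 0 < t := by rw [ht]; positivity
  have hg0 : 0 < γ * n / 2 := by positivity
  calc _ ≤ Ex p1 (allE n) (fun S1 => Ex p2 (allE n) (fun S2 =>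
          (if γ * n / 2 ≤ (cyc S1 : ℝ) then (1 : ℝ) else 0) +
          (if t ≤ (2 : ℝ) ^ S2.card then (1 : ℝ) else 0))) := by
        refine Ex_mono hp10 (by linarith) fun S1 hS1 => ?_
        refine Ex_mono hp20 hp21 fun S2 hS2 => ?_
        by_cases hU : ∃ U : Finset (Fin n), (U.card : ℝ) + γ * n < eU (S1 ∪ S2) U
        · rw [if_pos hU]
          obtain ⟨U, hU⟩ := hU
          have h1 := eU_union_le S1 S2 U
          have h2 := eU_le_cyc hS1 U
          have h3 : (eU (S1 ∪ S2) U : ℝ) ≤ U.card + cyc S1 + S2.card := by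
            exact_mod_cast h1.trans (by omega)
          rcases le_or_gt (γ * n / 2) (cyc S1 : ℝ) with h4 | h4
          · rw [if_pos h4]
            split_ifs <;> norm_num
          · have h5 : γ * n / 2 ≤ (S2.card : ℝ) := by linarith
            have h6 : t ≤ (2 : ℝ) ^ S2.card := by
              rw [ht, ← Real.rpow_natCast]
              exact Real.rpow_le_rpow_of_exponent_le (by norm_num) h5
            rw [if_pos h6]
            split_ifs <;> norm_num
        · rw [if_neg hU]
          split_ifs <;> norm_num
    _ = Ex p1 (allE n) (fun S1 => if γ * n / 2 ≤ (cyc S1 : ℝ) then (1 : ℝ) else 0) +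
        Ex p2 (allE n) (fun S2 => if t ≤ (2 : ℝ) ^ S2.card then (1 : ℝ) else 0) := by
        simp only [Ex_add, Ex_const]
    _ ≤ (1 / (1 - n * p1)) / (γ * n / 2) + (1 + p2) ^ (allE n).card / t := by
        refine add_le_add ?_ ?_
        · refine (Ex_markov hp10 (by linarith) _ _ (fun S => by positivity) hg0).trans ?_
          gcongr
          exact Ex_cyc hp10 (by linarith) (by rw [hp1n]; linarith)
        · rw [← Ex_two_pow]
          exact Ex_markov hp20 hp21 _ _ (fun S => by positivity) ht0
    _ ≤ 2 / (ε * γ) / n + Real.exp (-(γ / 4 - 2 * ε) * n) := by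
        refine add_le_add (le_of_eq ?_) ?_
        · rw [hp1n]
          have : 1 - (1 - ε) = ε := by ring
          rw [this]
          field_simp
        · have e1 : (1 + p2) ^ (allE n).card ≤ Real.exp (2 * ε * n) := by
            calc (1 + p2) ^ (allE n).card ≤ Real.exp p2 ^ (allE n).card := by
                  gcongr
                  linarith [Real.add_one_le_exp p2]
              _ = Real.exp ((allE n).card * p2) := by rw [← Real.exp_nat_mul]
              _ ≤ Real.exp (2 * ε * n) := by
                  apply Real.exp_le_exp.2
                  have hc : ((allE n).card : ℝ) ≤ n * n / 2 := by
                    rw [card_allE, Nat.cast_choose_two]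
                    nlinarith
                  calc ((allE n).card : ℝ) * p2 ≤ (n * n / 2) * (4 * ε / n) := by gcongr
                    _ = 2 * ε * n := by field_simp; ring
          have e2 : Real.exp (γ / 4 * n) ≤ t := by
            rw [ht, Real.rpow_def_of_pos (by norm_num)]
            apply Real.exp_le_exp.2
            have := Real.log_two_gt_d9
            nlinarith
          calc _ ≤ Real.exp (2 * ε * n) / Real.exp (γ / 4 * n) := by gcongr
            _ = _ := by rw [← Real.exp_sub]; congr 1; ring

end final

/-- For any `α > 0` and any positive integer `k` there exists `ε₀ > 0` such that for all
`0 < ε < ε₀`, w.h.p. the edge set of `G_{n,(1+ε)/n}` can be partitioned as `F ∪ M` where `F`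
is a forest and the distance in `F` between any two distinct edges of `M` is at least `k`
(i.e. every walk in `F` joining an endpoint of one to an endpoint of the other has length
at least `k`). -/
theorem statement5 (α : ℝ) (hα : 0 < α) (k : ℕ) (hk : 0 < k) :
    ∃ ε₀ : ℝ, 0 < ε₀ ∧ ∀ ε : ℝ, 0 < ε → ε < ε₀ →
      Tendsto
        (fun n : ℕ => erProb n ((1 + ε) / n) (fun G =>
          ∃ (F : SimpleGraph (Fin n)) (M : Set (Sym2 (Fin n))),
            F.IsAcyclic ∧
            F.edgeSet ∪ M = G.edgeSet ∧
            Disjoint F.edgeSet M ∧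
            ∀ e₁ ∈ M, ∀ e₂ ∈ M, e₁ ≠ e₂ →
              ∀ x ∈ e₁, ∀ y ∈ e₂, ∀ w : F.Walk x y, k ≤ w.length))
        atTop (nhds 1) := by
  classical
  obtain ⟨A, hA⟩ : ∃ A, A = 6 * k + 3 := ⟨_, rfl⟩
  have hA0 : 0 < A := by omega
  have hA0' : (0 : ℝ) < A := by exact_mod_cast hA0
  obtain ⟨δ, hδ⟩ : ∃ δ : ℝ, δ = (1 / 4) ^ A / 648 ^ A := ⟨_, rfl⟩
  have hδ0 : 0 < δ := by rw [hδ]; positivity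
  have hδA : 648 ^ A * δ ≤ (1 / 4) ^ A := by
    rw [hδ, mul_div_cancel₀ _ (by positivity)]
  obtain ⟨γ, hγ⟩ : ∃ γ : ℝ, γ = δ / A := ⟨_, rfl⟩
  have hγ0 : 0 < γ := by rw [hγ]; positivity
  refine ⟨min (1 / 2) (γ / 16), by positivity, ?_⟩
  intro ε hε hεlt
  have hε1 : ε < 1 / 2 := hεlt.trans_le (min_le_left _ _)
  have hε2 : ε < γ / 16 := hεlt.trans_le (min_le_right _ _)
  have hlow : Tendsto (fun n : ℕ => 1 - (2 * (648 ^ A * 4 ^ A) / (n : ℝ) +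
      (2 / (ε * γ) / n + Real.exp (-(γ / 4 - 2 * ε) * n)))) atTop (nhds 1) := by
    have h1 : Tendsto (fun n : ℕ => 2 * (648 ^ A * 4 ^ A) / (n : ℝ)) atTop (nhds 0) :=
      tendsto_const_div_atTop_nhds_zero_nat _
    have h2 : Tendsto (fun n : ℕ => 2 / (ε * γ) / (n : ℝ)) atTop (nhds 0) :=
      tendsto_const_div_atTop_nhds_zero_nat _
    have h3 : Tendsto (fun n : ℕ => Real.exp (-(γ / 4 - 2 * ε) * n)) atTop (nhds 0) := by
      apply Real.tendsto_exp_atBot.comp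
      apply Tendsto.const_mul_atTop_of_neg (by linarith)
      exact tendsto_natCast_atTop_atTop
    simpa using (h1.add (h2.add h3)).const_sub 1
  refine tendsto_of_tendsto_of_tendsto_of_le_of_le' hlow tendsto_const_nhds ?_ ?_
  · filter_upwards [eventually_ge_atTop 2] with n hn
    have hn' : (2 : ℝ) ≤ n := by exact_mod_cast hn
    have hn0 : (0 : ℝ) < n := by linarith
    have hp0 : 0 ≤ (1 + ε) / n := by positivity
    have hp1 : (1 + ε) / n ≤ 1 := by rw [div_le_iff₀ hn0]; linarith
    have hp2 : (1 + ε) / n ≤ 2 / n := by gcongr; linarith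
    have b1 := small_event A hA0 n (by omega) δ _ hδA hp0 hp1 hp2
    have b2 := big_event n hn ε γ hε hε1 hγ0
    rw [erProb_eq]
    rw [sub_le_iff_le_add]
    refine le_trans ?_ (add_le_add le_rfl (add_le_add b1 b2))
    rw [← Ex_add, ← Ex_add]
    refine le_of_eq_of_le (Ex_const ((1 + ε) / n) (allE n) 1).symm (Ex_mono hp0 hp1 fun S hS => ?_)
    by_cases h1 : ∃ U : Finset (Fin n), (U.card : ℝ) ≤ δ * n ∧ (A + 1) * U.card < A * eU S U
    · rw [if_pos h1]
      split_ifs <;> norm_num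
    by_cases h2 : ∃ U : Finset (Fin n), (U.card : ℝ) + γ * n < eU S U
    · rw [if_pos h2]
      split_ifs <;> norm_num
    rw [if_pos]
    · rw [if_neg h1, if_neg h2]; norm_num
    push Not at h1 h2
    have hdense : ∀ U : Finset (Fin n), A * eU S U ≤ (A + 1) * U.card := by
      intro U
      rcases le_or_gt (U.card : ℝ) (δ * n) with h | h
      · exact h1 U h
      · have h3 := h2 U
        have h4 : (A : ℝ) * eU S U ≤ (A + 1) * U.card := by
          calc (A : ℝ) * eU S U ≤ A * (U.card + γ * n) := by gcongr
            _ = A * U.card + δ * n := by rw [hγ]; field_simp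
            _ ≤ _ := by linarith
        exact_mod_cast h4
    obtain ⟨M, hM1, hM2, -, hM3⟩ := det_main k A hk hA.ge
      (fromEdgeSet (S : Set (Sym2 (Fin n)))) (fun U => by
        rw [sum_dg hS]
        have := hdense U
        nlinarith)
    refine ⟨_, M, hM2, ?_, ?_, hM3⟩
    · rw [edgeSet_deleteEdges]
      exact Set.diff_union_of_subset hM1
    · rw [edgeSet_deleteEdges]
      exact Set.disjoint_sdiff_left
  · filter_upwards [eventually_ge_atTop 2] with n hn
    have hn' : (2 : ℝ) ≤ n := by exact_mod_cast hn
    have hn0 : (0 : ℝ) < n := by linarith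
    have hp0 : 0 ≤ (1 + ε) / n := by positivity
    have hp1 : (1 + ε) / n ≤ 1 := by rw [div_le_iff₀ hn0]; linarith
    rw [erProb_eq]
    refine le_of_le_of_eq (Ex_mono hp0 hp1 fun S hS => ?_) (Ex_const ((1 + ε) / n) (allE n) 1)
    split_ifs <;> norm_num
end

section
/- Let c > 0, let n be a positive integer, and let β ∈ (0,1) be such that βn is an integer and c < n. Then C(n, βn) · 2^{βn} · (1 − c/n)^{β²n²/4} < ( 2^β · e^{−cβ²/4} / (β^β (1−β)^{1−β}) )^n, and consequently the probability that G_{n,c/n} contains an induced bipartite subgraph on βn vertices is less than ( 2^β e^{−cβ²/4} / (β^β (1−β)^{1−β}) )^n. -/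
open Filter SimpleGraph

/-- The graph `G` has no edge in `F`. -/
def auxAvoid {n : ℕ} (F : Finset (Sym2 (Fin n))) (G : SimpleGraph (Fin n)) : Prop :=
  ∀ e ∈ F, e ∉ G.edgeSet

lemma aux_bin (n m : ℕ) (β : ℝ) (hβ0 : 0 < β) (hβ1 : β < 1) (hm : (m : ℝ) = β * n) (hn : 0 < n) :
    (n.choose m : ℝ) * (β ^ m * (1 - β) ^ (n - m)) ≤ 1 / 2 := by
  have hn' : (0 : ℝ) < n := by exact_mod_cast hn
  have hm0 : 0 < m := by
    have : (0 : ℝ) < m := by rw [hm]; positivity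
    exact_mod_cast this
  have hmn : m < n := by
    have : (m : ℝ) < n := by rw [hm]; nlinarith
    exact_mod_cast this
  obtain ⟨j, rfl⟩ : ∃ j, m = j + 1 := ⟨m - 1, by omega⟩
  obtain ⟨k, rfl⟩ : ∃ k, n = j + 1 + (k + 1) := ⟨n - j - 2, by omega⟩
  set N := j + 1 + (k + 1) with hN
  set γ := 1 - β with hγ
  have hγ0 : 0 < γ := by rw [hγ]; linarith
  have hsum : ∑ i ∈ Finset.range (N + 1), β ^ i * γ ^ (N - i) * (N.choose i : ℝ) = 1 := by
    rw [← add_pow]; simp [hγ]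
  have hsub : ∑ i ∈ ({j, j + 1, j + 2} : Finset ℕ), β ^ i * γ ^ (N - i) * (N.choose i : ℝ) ≤ 1 := by
    rw [← hsum]
    apply Finset.sum_le_sum_of_subset_of_nonneg
    · intro i hi
      simp only [Finset.mem_insert, Finset.mem_singleton] at hi
      simp only [Finset.mem_range]; omega
    · intros; positivity
  rw [Finset.sum_insert (by simp), Finset.sum_insert (by simp), Finset.sum_singleton] at hsub
  have e1 : N - j = k + 2 := by omega
  have e2 : N - (j + 1) = k + 1 := by omega
  have e3 : N - (j + 2) = k := by omega
  have c1 : (N.choose (j + 1) : ℝ) * (j + 1) = N.choose j * (k + 2) := by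
    have := Nat.choose_succ_right_eq N j
    rw [e1] at this
    exact_mod_cast this
  have c2 : (N.choose (j + 2) : ℝ) * (j + 2) = N.choose (j + 1) * (k + 1) := by
    have := Nat.choose_succ_right_eq N (j + 1)
    rw [e2] at this
    exact_mod_cast this
  rw [e1, e2, e3] at hsub
  rw [e2]
  have hm' : (j + 1 : ℝ) * γ = β * (k + 1) := by
    have : ((j + 1 : ℕ) : ℝ) = β * ((j + 1 + (k + 1) : ℕ) : ℝ) := hm
    push_cast at this
    rw [hγ]; linarith
  set X := β ^ j * γ ^ k * (N.choose (j + 1) : ℝ) with hX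
  have hX0 : 0 ≤ X := by positivity
  have hj : (0 : ℝ) ≤ j := by positivity
  have hk : (0 : ℝ) ≤ k := by positivity
  have t1 : β ^ j * γ ^ (k + 2) * (N.choose j : ℝ) = X * (β * γ) * ((k + 1) / (k + 2)) := by
    have : (N.choose j : ℝ) = N.choose (j + 1) * (j + 1) / (k + 2) := by
      rw [c1]; field_simp
    rw [this, hX]
    field_simp
    rw [show γ ^ (k + 2) = γ ^ k * γ * γ by ring]
    linear_combination ((N.choose (j + 1) : ℝ) * γ ^ k * γ) * hm'
  have t3 : β ^ (j + 2) * γ ^ k * (N.choose (j + 2) : ℝ) = X * (β * γ) * ((j + 1) / (j + 2)) := by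
    have : (N.choose (j + 2) : ℝ) = N.choose (j + 1) * (k + 1) / (j + 2) := by
      rw [← c2]; field_simp
    rw [this, hX, show β ^ (j + 2) = β ^ j * β * β by ring]
    field_simp
    linear_combination (-(N.choose (j + 1) : ℝ)) * hm'
  have t2 : β ^ (j + 1) * γ ^ (k + 1) * (N.choose (j + 1) : ℝ) = X * (β * γ) := by
    rw [hX]; ring
  rw [t1, t2, t3] at hsub
  have goal' : (N.choose (j + 1) : ℝ) * (β ^ (j + 1) * γ ^ (k + 1)) = X * (β * γ) := by
    rw [hX]; ring
  rw [goal']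
  have h1 : (1 : ℝ) / 2 ≤ (k + 1) / (k + 2) := by
    rw [div_le_div_iff₀ (by norm_num) (by positivity)]; linarith
  have h2 : (1 : ℝ) / 2 ≤ (j + 1) / (j + 2) := by
    rw [div_le_div_iff₀ (by norm_num) (by positivity)]; linarith
  have hY : 0 ≤ X * (β * γ) := by positivity
  nlinarith [mul_le_mul_of_nonneg_left h1 hY, mul_le_mul_of_nonneg_left h2 hY]

lemma aux_log (t : ℝ) (ht0 : 0 < t) (ht1 : t < 1) :
    2 * (t + t ^ 3 / 3) ≤ Real.log (1 + t) - Real.log (1 - t) := by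
  have h := Real.hasSum_log_sub_log_of_abs_lt_one (x := t) (by rw [abs_lt]; constructor <;> linarith)
  have := sum_le_hasSum (Finset.range 2) (fun i _ => by positivity) h
  refine le_trans (le_of_eq ?_) this
  simp [Finset.sum_range_succ]; ring

lemma aux_main (m : ℕ) (hm : 3 ≤ m) (p : ℝ) (hp0 : 0 < p) (hp1 : p < 1) :
    (1 - p) ^ (((m : ℝ) ^ 2 - 2 * m) / 4) < 2 * Real.exp (-p * (m : ℝ) ^ 2 / 4) := by
  have hm' : (3 : ℝ) ≤ m := by exact_mod_cast hm
  generalize (m : ℝ) = x at hm' ⊢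
  have hq : 0 < 1 - p := by linarith
  rw [Real.rpow_def_of_pos hq]
  have h2 : (2 : ℝ) = Real.exp (Real.log 2) := (Real.exp_log (by norm_num)).symm
  have h2e : 2 * Real.exp (-p * x ^ 2 / 4) = Real.exp (Real.log 2 + -p * x ^ 2 / 4) := by
    rw [Real.exp_add, ← h2]
  rw [h2e, Real.exp_lt_exp]
  have hl2 := Real.log_two_gt_d9
  set t : ℝ := 1 / (x - 1) with ht
  have hx1 : 0 < x - 1 := by linarith
  have ht0 : 0 < t := by positivity
  have htx : t * (x - 1) = 1 := by rw [ht]; field_simp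
  have ht2 : t ≤ 1 / 2 := by
    rw [ht, div_le_div_iff₀ hx1 (by norm_num)]; linarith
  have hlog := aux_log t ht0 (by linarith)
  have e : Real.log (1 + t) - Real.log (1 - t) = Real.log x - Real.log (x - 2) := by
    rw [← Real.log_div (by linarith) (by linarith), ← Real.log_div (by linarith) (by linarith)]
    congr 1
    rw [div_eq_div_iff (by linarith) (by linarith)]
    linear_combination 2 * htx
  rw [e] at hlog
  have htan := Real.log_le_sub_one_of_pos (x := (1 - p) * x / (x - 2))
    (div_pos (mul_pos hq (by linarith)) (by linarith))
  rw [Real.log_div (by nlinarith) (by linarith), Real.log_mul (by linarith) (by linarith)] at htan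
  have hA : 0 < x * (x - 2) := mul_pos (by linarith) (by linarith)
  have h3 := mul_le_mul_of_nonneg_left htan hA.le
  have h4 := mul_le_mul_of_nonneg_left hlog hA.le
  have e5 : x * (x - 2) * ((1 - p) * x / (x - 2) - 1) = x ^ 2 * (1 - p) - x * (x - 2) := by
    have : x - 2 ≠ 0 := by linarith
    field_simp
  have e6 : x * (x - 2) * (2 * (t + t ^ 3 / 3)) = 2 * (x - 1) - 4 * t / 3 - 2 * t ^ 3 / 3 := by
    have : x - 1 ≠ 0 := by linarith
    rw [ht]; field_simp; ring
  rw [e5] at h3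
  rw [e6] at h4
  have h7 : t ^ 3 ≤ 1 / 8 := by
    calc t ^ 3 ≤ (1 / 2) ^ 3 := by gcongr
      _ = 1 / 8 := by norm_num
  linarith

open scoped Classical in
lemma aux_er (n : ℕ) (p : ℝ) (hp0 : 0 ≤ p) (hp1 : p ≤ 1) (F : Finset (Sym2 (Fin n)))
    (hF : F ⊆ (⊤ : SimpleGraph (Fin n)).edgeFinset) :
    erProb n p (fun G => auxAvoid F G) ≤ (1 - p) ^ F.card := by
  set E := (⊤ : SimpleGraph (Fin n)).edgeFinset with hE
  have hEc : E.card = n.choose 2 := by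
    rw [hE, SimpleGraph.card_edgeFinset_top_eq_card_choose_two]; simp
  have hq : 0 ≤ 1 - p := by linarith
  have h0 : erProb n p (fun G => auxAvoid F G) =
      ∑ G ∈ Finset.univ.filter fun G : SimpleGraph (Fin n) => auxAvoid F G,
        p ^ G.edgeSet.ncard * (1 - p) ^ (n.choose 2 - G.edgeSet.ncard) := by
    unfold erProb
    rw [Finset.sum_filter]
  rw [h0]
  have h1 : (1 - p) ^ F.card = ∑ T ∈ (E \ F).powerset, p ^ T.card * (1 - p) ^ (n.choose 2 - T.card) := by
    have h := Finset.sum_pow_mul_eq_add_pow p (1 - p) (E \ F)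
    have : p + (1 - p) = 1 := by ring
    rw [this, one_pow] at h
    have h' := congrArg (fun z => (1 - p) ^ F.card * z) h
    simp only [mul_one, Finset.mul_sum] at h'
    rw [← h']
    apply Finset.sum_congr rfl
    intro T hT
    have hTc := Finset.card_le_card (Finset.mem_powerset.1 hT)
    have h2 := Finset.card_sdiff_add_card_eq_card hF
    rw [mul_left_comm, ← pow_add]
    congr 2
    omega
  rw [h1]
  have h2 : ∀ G : SimpleGraph (Fin n), G.edgeSet.ncard = G.edgeFinset.card := by
    intro G
    rw [← SimpleGraph.coe_edgeFinset, Set.ncard_coe_finset]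
  calc _ = ∑ T ∈ (Finset.univ.filter fun G : SimpleGraph (Fin n) => auxAvoid F G).image
        (fun G => G.edgeFinset), p ^ T.card * (1 - p) ^ (n.choose 2 - T.card) := by
        rw [Finset.sum_image]
        · refine Finset.sum_congr (by ext; simp) ?_
          intro G _
          rw [h2]
        · intro G _ H _ h
          exact SimpleGraph.edgeFinset_inj.1 h
    _ ≤ _ := by
        apply Finset.sum_le_sum_of_subset_of_nonneg
        · intro T hT
          obtain ⟨G, hG, rfl⟩ := Finset.mem_image.1 hT
          have hG' := (Finset.mem_filter.1 hG).2
          rw [Finset.mem_powerset]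
          intro e he
          rw [Finset.mem_sdiff]
          refine ⟨?_, fun hf => hG' e hf (SimpleGraph.mem_edgeFinset.1 he)⟩
          exact SimpleGraph.edgeFinset_mono le_top he
        · intros
          positivity

lemma aux_choose (a b : ℕ) : (((a + b : ℕ) : ℝ) ^ 2 - 2 * (a + b : ℕ)) / 4 ≤ ((a.choose 2 + b.choose 2 : ℕ) : ℝ) := by
  push_cast
  rw [Nat.cast_choose_two, Nat.cast_choose_two]
  nlinarith [sq_nonneg ((a : ℝ) - b)]

open scoped Classical in
lemma aux_union (n m : ℕ) (p : ℝ) (hp0 : 0 ≤ p) (hp1 : p < 1) :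
    erProb n p (fun G =>
        ∃ S : Finset (Fin n), S.card = m ∧ (G.induce (S : Set (Fin n))).Colorable 2) ≤
      (n.choose m : ℝ) * 2 ^ m * (1 - p) ^ (((m : ℝ) ^ 2 - 2 * m) / 4) := by
  have hq : 0 < 1 - p := by linarith
  let F : Finset (Fin n) → Finset (Sym2 (Fin n)) := fun A => A.offDiag.image Sym2.mk.uncurry
  let D : Finset (Fin n) → Finset (Fin n) → Finset (Sym2 (Fin n)) := fun S A => F A ∪ F (S \ A)
  have key : ∀ S ∈ Finset.powersetCard m (Finset.univ : Finset (Fin n)), ∀ A ∈ S.powerset,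
      erProb n p (fun G => auxAvoid (D S A) G) ≤
        (1 - p) ^ (((m : ℝ) ^ 2 - 2 * m) / 4) := by
    intro S hS A hA
    rw [Finset.mem_powersetCard] at hS
    rw [Finset.mem_powerset] at hA
    have hD : D S A ⊆ (⊤ : SimpleGraph (Fin n)).edgeFinset := by
      intro e he
      simp only [D, F, Finset.mem_union, Finset.mem_image, Finset.mem_offDiag] at he
      rcases he with ⟨⟨x, y⟩, h, rfl⟩ | ⟨⟨x, y⟩, h, rfl⟩ <;>
      · rw [SimpleGraph.mem_edgeFinset]
        exact h.2.2
    have hcard : (D S A).card = A.card.choose 2 + (S \ A).card.choose 2 := by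
      simp only [D]
      rw [Finset.card_union_of_disjoint]
      · simp only [F, Sym2.card_image_offDiag]
      · rw [Finset.disjoint_left]
        intro e he he'
        simp only [F, Finset.mem_image, Finset.mem_offDiag] at he he'
        obtain ⟨⟨x, y⟩, h, rfl⟩ := he
        obtain ⟨⟨u, v⟩, h', h2⟩ := he'
        have h2' : s(u, v) = s(x, y) := h2
        rw [Sym2.eq_iff] at h2'
        simp only [Finset.mem_sdiff] at h h'
        rcases h2' with ⟨rfl, rfl⟩ | ⟨rfl, rfl⟩ <;> tauto
    refine (aux_er n p hp0 hp1.le _ hD).trans ?_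
    rw [← Real.rpow_natCast]
    apply Real.rpow_le_rpow_of_exponent_ge hq (by linarith)
    rw [hcard]
    have hab : A.card + (S \ A).card = m := by
      rw [add_comm, Finset.card_sdiff_add_card_eq_card hA, hS.2]
    have := aux_choose A.card (S \ A).card
    rwa [hab] at this
  have hcount : ∑ S ∈ Finset.powersetCard m (Finset.univ : Finset (Fin n)), ∑ A ∈ S.powerset,
      (1 - p) ^ (((m : ℝ) ^ 2 - 2 * m) / 4) =
      (n.choose m : ℝ) * 2 ^ m * (1 - p) ^ (((m : ℝ) ^ 2 - 2 * m) / 4) := by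
    rw [Finset.sum_congr rfl (g := fun _ => 2 ^ m * (1 - p) ^ (((m : ℝ) ^ 2 - 2 * m) / 4))]
    · simp [mul_assoc]
    · intro S hS
      rw [Finset.mem_powersetCard] at hS
      simp [hS.2]
  rw [← hcount]
  refine le_trans ?_ (Finset.sum_le_sum fun S hS => Finset.sum_le_sum fun A hA => key S hS A hA)
  unfold erProb
  simp_rw [Finset.sum_comm (t := (Finset.univ : Finset (SimpleGraph (Fin n))))]
  apply Finset.sum_le_sum
  intro G _
  set w := p ^ G.edgeSet.ncard * (1 - p) ^ (n.choose 2 - G.edgeSet.ncard) with hw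
  have hw0 : 0 ≤ w := by positivity
  have hnn : ∀ (S A : Finset (Fin n)), 0 ≤ if auxAvoid (D S A) G then w else 0 := by
    intro S A
    split_ifs <;> simp [hw0]
  split_ifs with hP
  · obtain ⟨S, hS, ⟨C⟩⟩ := hP
    let A : Finset (Fin n) := S.filter fun v => ∃ h : v ∈ S, C ⟨v, h⟩ = 0
    have hA : A ∈ S.powerset := Finset.mem_powerset.2 (Finset.filter_subset _ _)
    have hSm : S ∈ Finset.powersetCard m (Finset.univ : Finset (Fin n)) := by
      simp [Finset.mem_powersetCard, hS]
    have hgood : auxAvoid (D S A) G := by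
      intro e he
      have hne : ∀ x y (hx : x ∈ S) (hy : y ∈ S), C ⟨x, hx⟩ = C ⟨y, hy⟩ → ¬ G.Adj x y := by
        intro x y hx hy hxy hadj
        exact C.valid (v := ⟨x, hx⟩) (w := ⟨y, hy⟩) hadj hxy
      simp only [D, F, Finset.mem_union, Finset.mem_image, Finset.mem_offDiag] at he
      rcases he with ⟨⟨x, y⟩, h, rfl⟩ | ⟨⟨x, y⟩, h, rfl⟩
      · obtain ⟨h1, h2, -⟩ := h
        obtain ⟨hx, hx0⟩ := (Finset.mem_filter.1 h1).2
        obtain ⟨hy, hy0⟩ := (Finset.mem_filter.1 h2).2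
        exact hne x y hx hy (hx0.trans hy0.symm)
      · obtain ⟨h1, h2, -⟩ := h
        have aux : ∀ z, z ∈ S \ A → ∃ hz : z ∈ S, C ⟨z, hz⟩ = 1 := by
          intro z hz
          rw [Finset.mem_sdiff] at hz
          refine ⟨hz.1, ?_⟩
          have : C ⟨z, hz.1⟩ ≠ 0 := fun h0 => hz.2 (Finset.mem_filter.2 ⟨hz.1, hz.1, h0⟩)
          exact Fin.eq_one_of_ne_zero _ this
        obtain ⟨hx, hx0⟩ := aux x h1
        obtain ⟨hy, hy0⟩ := aux y h2
        exact hne x y hx hy (hx0.trans hy0.symm)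
    calc w = if auxAvoid (D S A) G then w else 0 := by rw [if_pos hgood]
      _ ≤ ∑ A ∈ S.powerset, if auxAvoid (D S A) G then w else 0 :=
          Finset.single_le_sum (f := fun A => if auxAvoid (D S A) G then w else 0)
            (fun A _ => hnn S A) hA
      _ ≤ _ := Finset.single_le_sum
            (f := fun S => ∑ A ∈ S.powerset, if auxAvoid (D S A) G then w else 0)
            (fun S _ => Finset.sum_nonneg fun A _ => hnn S A) hSm
  · exact Finset.sum_nonneg fun S _ => Finset.sum_nonneg fun A _ => hnn S A

lemma aux_le_one (n : ℕ) (p : ℝ) (hp0 : 0 ≤ p) (hp1 : p ≤ 1) (P : SimpleGraph (Fin n) → Prop) :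
    erProb n p P ≤ 1 := by
  have h := aux_er n p hp0 hp1 ∅ (by simp)
  simp only [Finset.card_empty, pow_zero] at h
  refine le_trans ?_ h
  unfold erProb
  have hq : 0 ≤ 1 - p := by linarith
  apply Finset.sum_le_sum
  intro G _
  have : 0 ≤ p ^ G.edgeSet.ncard * (1 - p) ^ (n.choose 2 - G.edgeSet.ncard) := by positivity
  simp only [auxAvoid, Finset.notMem_empty, false_imp_iff, implies_true, if_true]
  split_ifs
  · exact le_rfl
  · exact this

/-- For `c > 0`, `n ≥ 1`, `β ∈ (0,1)` with `βn = m` an integer and `c < n`: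
`C(n, βn) · 2^{βn} · (1 - c/n)^{β²n²/4} < (2^β e^{-cβ²/4} / (β^β (1-β)^{1-β}))^n`, and
consequently the probability that `G_{n,c/n}` contains an induced bipartite subgraph on `βn`
vertices is less than `(2^β e^{-cβ²/4} / (β^β (1-β)^{1-β}))^n`. -/
theorem statement10 (c : ℝ) (hc : 0 < c) (n : ℕ) (hn : 0 < n) (β : ℝ)
    (hβ0 : 0 < β) (hβ1 : β < 1) (m : ℕ) (hm : (m : ℝ) = β * n) (hcn : c < n) :
    (n.choose m : ℝ) * 2 ^ m * (1 - c / n) ^ (β ^ 2 * (n : ℝ) ^ 2 / 4) <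
      (2 ^ β * Real.exp (-c * β ^ 2 / 4) / (β ^ β * (1 - β) ^ (1 - β))) ^ n ∧
    erProb n (c / n) (fun G =>
        ∃ S : Finset (Fin n), S.card = m ∧ (G.induce (S : Set (Fin n))).Colorable 2) <
      (2 ^ β * Real.exp (-c * β ^ 2 / 4) / (β ^ β * (1 - β) ^ (1 - β))) ^ n := by
  have hn' : (0 : ℝ) < n := by exact_mod_cast hn
  have hm0 : 0 < m := by
    have : (0 : ℝ) < m := by rw [hm]; positivity
    exact_mod_cast this
  have hmn : m < n := by
    have : (m : ℝ) < n := by rw [hm]; nlinarith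
    exact_mod_cast this
  have hγ0 : 0 < 1 - β := by linarith
  set p : ℝ := c / n with hp
  have hp0 : 0 < p := by positivity
  have hp1 : p < 1 := by rw [hp, div_lt_one hn']; exact hcn
  have hcp : c = p * n := by rw [hp]; field_simp
  have hR : (2 ^ β * Real.exp (-c * β ^ 2 / 4) / (β ^ β * (1 - β) ^ (1 - β))) ^ n =
      2 ^ m * Real.exp (-p * (m : ℝ) ^ 2 / 4) / (β ^ m * (1 - β) ^ (n - m)) := by
    have g1 : ∀ b : ℝ, 0 < b → (b ^ β) ^ n = b ^ m := by
      intro b hb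
      rw [← Real.rpow_mul_natCast hb.le, ← hm, Real.rpow_natCast]
    have g2 : ((1 - β) ^ (1 - β)) ^ n = (1 - β) ^ (n - m) := by
      rw [← Real.rpow_mul_natCast hγ0.le, ← Real.rpow_natCast, Nat.cast_sub hmn.le, hm]
      congr 1
      ring
    rw [div_pow, mul_pow, mul_pow, g1 2 (by norm_num), g1 β hβ0, g2, ← Real.exp_nat_mul]
    congr 3
    rw [hm, hcp]
    ring
  rw [hR]
  have hb := aux_bin n m β hβ0 hβ1 hm hn
  set Z := β ^ m * (1 - β) ^ (n - m) with hZ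
  have hZ0 : 0 < Z := by positivity
  set X := Real.exp (-p * (m : ℝ) ^ 2 / 4) with hX
  have hX0 : 0 < X := Real.exp_pos _
  have hC : (1 : ℝ) ≤ n.choose m := by exact_mod_cast Nat.choose_pos hmn.le
  have hlow : (n.choose m : ℝ) * 2 ^ m * (2 * X) ≤ 2 ^ m * X / Z := by
    rw [le_div_iff₀ hZ0]
    have h2 : (0 : ℝ) ≤ 2 ^ m * X := by positivity
    nlinarith [mul_le_mul_of_nonneg_left hb h2]
  have hCm : (0 : ℝ) < (n.choose m : ℝ) * 2 ^ m := by positivity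
  constructor
  · refine lt_of_lt_of_le ?_ hlow
    apply mul_lt_mul_of_pos_left _ hCm
    have hq : 0 < 1 - p := by linarith
    have : (1 - p) ^ (β ^ 2 * (n : ℝ) ^ 2 / 4) ≤ X := by
      rw [Real.rpow_def_of_pos hq, hX, Real.exp_le_exp]
      have hl := Real.log_le_sub_one_of_pos hq
      have e : β ^ 2 * (n : ℝ) ^ 2 / 4 = (m : ℝ) ^ 2 / 4 := by rw [hm]; ring
      rw [e]
      have h4 : (0 : ℝ) ≤ (m : ℝ) ^ 2 / 4 := by positivity
      nlinarith [mul_le_mul_of_nonneg_right hl h4]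
    linarith
  · refine lt_of_lt_of_le ?_ hlow
    by_cases h3 : 3 ≤ m
    · refine lt_of_le_of_lt (aux_union n m p hp0.le hp1) ?_
      exact mul_lt_mul_of_pos_left (aux_main m h3 p hp0 hp1) hCm
    · refine lt_of_le_of_lt (aux_le_one n p hp0.le hp1.le _) ?_
      have hm2 : (m : ℝ) ≤ 2 := by
        have : m ≤ 2 := by omega
        exact_mod_cast this
      have hX1 : 1 / 3 < X := by
        have h1 : Real.exp (-1) ≤ X := by
          rw [hX, Real.exp_le_exp]
          have hmm : (m : ℝ) ^ 2 ≤ 4 := by nlinarith [(Nat.cast_nonneg m : (0 : ℝ) ≤ m)]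
          nlinarith [sq_nonneg (m : ℝ)]
        refine lt_of_lt_of_le ?_ h1
        rw [Real.exp_neg, ← one_div]
        apply one_div_lt_one_div_of_lt (Real.exp_pos _)
        have := Real.exp_one_lt_d9
        linarith
      have h2m : (2 : ℝ) ≤ 2 ^ m := by
        calc (2 : ℝ) = 2 ^ 1 := by norm_num
          _ ≤ 2 ^ m := pow_le_pow_right₀ (by norm_num) hm0
      have : (2 : ℝ) ≤ (n.choose m : ℝ) * 2 ^ m := by nlinarith
      nlinarith
end
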